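/- For every positive integer t there exists a positive integer c = c(t) with the following property: for every (theta, prism, K_{1,t})-free graph G and every normal weight function w on G, there exists Y ⊆ V(G) with |Y| ≤ c such that the closed neighborhood N[Y] is a w-balanced separator in G. -/

import Mathlib

open SimpleGraph

namespace Paper

variable {V : Type}

/-- Two vertex sets are anticomplete: no edges between them. -/
def Anticomplete (G : SimpleGraph V) (A B : Set V) : Prop :=
  ∀ a ∈ A, ∀ b ∈ B, ¬ G.Adj a b

/-- A stable (independent) set of vertices. -/
def StableSet (G : SimpleGraph V) (A : Set V) : Prop :=
  ∀ x ∈ A, ∀ y ∈ A, x ≠ y → ¬ G.Adj x y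

/-- A walk is induced in `G`: any two adjacent vertices on it are consecutive. -/
def InducedWalk (G : SimpleGraph V) {u v : V} (P : G.Walk u v) : Prop :=
  ∀ x ∈ P.support, ∀ y ∈ P.support, G.Adj x y → s(x, y) ∈ P.edges

/-- The interior (set of internal vertices) of a walk from `u` to `v`. -/
def Interior {G : SimpleGraph V} {u v : V} (P : G.Walk u v) : Set V :=
  {w | w ∈ P.support ∧ w ≠ u ∧ w ≠ v}

/-- Closed neighborhood of a set of vertices. -/
def ClosedNbhd (G : SimpleGraph V) (A : Set V) : Set V :=
  A ∪ {v | ∃ a ∈ A, G.Adj v a}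

/-- Open neighborhood of a set of vertices. -/
def OpenNbhd (G : SimpleGraph V) (A : Set V) : Set V :=
  {v | v ∉ A ∧ ∃ a ∈ A, G.Adj v a}

/-- `M` separates `x` and `y` in `G`: there is a separation `(L, M, R)` with `x ∈ L`, `y ∈ R`. -/
def Separates (G : SimpleGraph V) (M : Set V) (x y : V) : Prop :=
  ∃ L R : Set V,
    L ∪ M ∪ R = Set.univ ∧
    Disjoint L M ∧ Disjoint L R ∧ Disjoint M R ∧
    L.Nonempty ∧ R.Nonempty ∧ Anticomplete G L R ∧ x ∈ L ∧ y ∈ R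

/-- `G` contains a theta as an induced subgraph. -/
def ContainsTheta (G : SimpleGraph V) : Prop :=
  ∃ (a b : V) (P₁ P₂ P₃ : G.Walk a b),
    a ≠ b ∧ ¬ G.Adj a b ∧
    P₁.IsPath ∧ P₂.IsPath ∧ P₃.IsPath ∧
    InducedWalk G P₁ ∧ InducedWalk G P₂ ∧ InducedWalk G P₃ ∧
    2 ≤ P₁.length ∧ 2 ≤ P₂.length ∧ 2 ≤ P₃.length ∧
    Disjoint (Interior P₁) (Interior P₂) ∧
    Disjoint (Interior P₁) (Interior P₃) ∧
    Disjoint (Interior P₂) (Interior P₃) ∧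
    Anticomplete G (Interior P₁) (Interior P₂) ∧
    Anticomplete G (Interior P₁) (Interior P₃) ∧
    Anticomplete G (Interior P₂) (Interior P₃)

/-- `G` contains a prism as an induced subgraph (one path may have length zero). -/
def ContainsPrism (G : SimpleGraph V) : Prop :=
  ∃ (a b : Fin 3 → V) (P : ∀ i, G.Walk (a i) (b i)),
    (∀ i j, i ≠ j → G.Adj (a i) (a j)) ∧
    (∀ i j, i ≠ j → G.Adj (b i) (b j)) ∧
    (∀ i, (P i).IsPath) ∧ (∀ i, InducedWalk G (P i)) ∧
    (∀ i j, i ≠ j → ∀ x, x ∈ (P i).support → x ∉ (P j).support) ∧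
    (∀ i j, i ≠ j → ∀ x ∈ (P i).support, ∀ y ∈ (P j).support,
        G.Adj x y → (x = a i ∧ y = a j) ∨ (x = b i ∧ y = b j)) ∧
    (∀ i j, i ≠ j → 2 ≤ (P i).length + (P j).length)

/-- `G` contains `K_{1,t}` as an induced subgraph. -/
def ContainsK1t (G : SimpleGraph V) (t : ℕ) : Prop :=
  ∃ (v : V) (S : Finset V),
    S.card = t ∧ v ∉ S ∧ (∀ x ∈ S, G.Adj v x) ∧ StableSet G ↑S

/-- `G` belongs to the class `C_t` of (theta, prism, `K_{1,t}`)-free graphs. -/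
def MemCt (t : ℕ) (G : SimpleGraph V) : Prop :=
  ¬ ContainsTheta G ∧ ¬ ContainsPrism G ∧ ¬ ContainsK1t G t

/-- A tree decomposition of `G`. -/
structure TreeDecomp (G : SimpleGraph V) where
  ι : Type
  T : SimpleGraph ι
  isTree : T.IsTree
  bag : ι → Set V
  mem_bag : ∀ v : V, ∃ i, v ∈ bag i
  edge_bag : ∀ u v : V, G.Adj u v → ∃ i, u ∈ bag i ∧ v ∈ bag i
  bag_connected : ∀ v : V, (T.induce {i | v ∈ bag i}).Connected

/-- The tree independence number of `G` is at most `k`. -/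
def TreeAlphaLE (G : SimpleGraph V) (k : ℕ) : Prop :=
  ∃ D : TreeDecomp G, ∀ i : D.ι, ∀ S : Finset V,
    ↑S ⊆ D.bag i → StableSet G ↑S → S.card ≤ k

/-- Sum of weights over a vertex set. -/
noncomputable def wSum [Fintype V] (w : V → ℝ) (A : Set V) : ℝ :=
  ∑ v, A.indicator w v

/-- `D` is a connected component of `G \ X`. -/
def IsComponentOf (G : SimpleGraph V) (X D : Set V) : Prop :=
  D.Nonempty ∧ D ⊆ Xᶜ ∧ (G.induce D).Connected ∧
  ∀ D' : Set V, D ⊆ D' → D' ⊆ Xᶜ → (G.induce D').Connected → D' = D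

/-- `X` is a `w`-balanced separator in `G`. -/
def BalancedSeparator [Fintype V] (G : SimpleGraph V) (w : V → ℝ) (X : Set V) : Prop :=
  ∀ D : Set V, IsComponentOf G X D → wSum w D ≤ 1 / 2

/-- A closed walk is a hole (induced cycle of length at least four) in `G`. -/
def IsHoleWalk (G : SimpleGraph V) {h : V} (H : G.Walk h h) : Prop :=
  H.IsCycle ∧ 4 ≤ H.length ∧ InducedWalk G H

/-- The neighbors of `c` on the hole `H`. -/
def HoleNbrs (G : SimpleGraph V) {h : V} (H : G.Walk h h) (c : V) : Set V :=
  {v | v ∈ H.support ∧ G.Adj c v}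

/-- `(H, c)` is a wheel in `G`. -/
def IsWheel (G : SimpleGraph V) {h : V} (H : G.Walk h h) (c : V) : Prop :=
  IsHoleWalk G H ∧ c ∉ H.support ∧ 3 ≤ (HoleNbrs G H c).ncard

/-- `P` is a sector of the wheel `(H, c)`. -/
def IsSector (G : SimpleGraph V) {h : V} (H : G.Walk h h) (c : V)
    {x y : V} (P : G.Walk x y) : Prop :=
  P.IsPath ∧ 0 < P.length ∧
  (∀ w ∈ P.support, w ∈ H.support) ∧
  (∀ e ∈ P.edges, e ∈ H.edges) ∧
  G.Adj c x ∧ G.Adj c y ∧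
  ∀ w ∈ P.support, w ≠ x → w ≠ y → ¬ G.Adj c w

/-- The wheel `(H, c)` is special. -/
def IsSpecialWheel (G : SimpleGraph V) {h : V} (H : G.Walk h h) (c : V) : Prop :=
  IsWheel G H c ∧ ∃ a b d : V,
    a ≠ b ∧ a ≠ d ∧ b ≠ d ∧
    HoleNbrs G H c = {a, b, d} ∧
    s(a, b) ∈ H.edges ∧ s(a, d) ∉ H.edges ∧ s(b, d) ∉ H.edges

/-- `Z(W)` for a non-special wheel `W = (H, c)`. -/
def ZNonSpecial (G : SimpleGraph V) {h : V} (H : G.Walk h h) (c : V) : Set V :=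
  {c} ∪ HoleNbrs G H c

/-- `Z(W)` for a special wheel `W = (H, c)` with length-one sector `ab` and third neighbor `d`. -/
def ZSpecial (G : SimpleGraph V) {h : V} (H : G.Walk h h) (c a b d : V) : Set V :=
  ({a, b, c, d} : Set V) ∪ {v | s(v, d) ∈ H.edges}

/-- A pyramid in `G` with apex `apx`, base `b 0, b 1, b 2` and paths `P i`. -/
def IsPyramid (G : SimpleGraph V) (apx : V) (b : Fin 3 → V)
    (P : ∀ i, G.Walk apx (b i)) : Prop :=
  (∀ i, b i ≠ apx) ∧
  (∀ i j, i ≠ j → G.Adj (b i) (b j)) ∧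
  (∀ i, (P i).IsPath) ∧ (∀ i, InducedWalk G (P i)) ∧
  (∀ i, 1 ≤ (P i).length) ∧
  (∀ i j, i ≠ j → ∀ x, x ∈ (P i).support → x ∈ (P j).support → x = apx) ∧
  (∀ i j, i ≠ j → ∀ x ∈ (P i).support, ∀ y ∈ (P j).support,
      x ≠ apx → y ≠ apx → G.Adj x y → x = b i ∧ y = b j) ∧
  (∀ i j, i ≠ j → 3 ≤ (P i).length + (P j).length)

/-- `Z(Σ)` for a pyramid. -/
def ZPyramid (G : SimpleGraph V) (apx : V) (b : Fin 3 → V)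
    (P : ∀ i, G.Walk apx (b i)) : Set V :=
  {apx} ∪ {v | (∃ i, v ∈ (P i).support) ∧ G.Adj apx v} ∪ Set.range b

/-- `x : Fin k → V` enumerates `X` in an order witnessing that `(P, X)` is an alignment. -/
def AlignmentOrder (G : SimpleGraph V) {p q : V} (P : G.Walk p q)
    (X : Finset V) {k : ℕ} (x : Fin k → V) : Prop :=
  Function.Injective x ∧ (∀ l, x l ∈ X) ∧ (∀ z ∈ X, ∃ l, x l = z) ∧
  ∃ lo hi : Fin k → ℕ,
    (∀ l, lo l ≤ hi l) ∧
    (∀ l m : Fin k, l < m → hi l < lo m) ∧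
    (∀ l, hi l < P.support.length) ∧
    ∀ (l : Fin k) (n : Fin P.support.length),
      G.Adj (x l) (P.support.get n) → lo l ≤ (n : ℕ) ∧ (n : ℕ) ≤ hi l

/-- `(P, X)` is an alignment. -/
def IsAlignment (G : SimpleGraph V) {p q : V} (P : G.Walk p q) (X : Finset V) : Prop :=
  (∀ z ∈ X, z ∉ P.support) ∧
  (∀ z ∈ X, ∃ u ∈ P.support, G.Adj z u) ∧
  ∃ (k : ℕ) (x : Fin k → V), AlignmentOrder G P X x

/-- Every vertex of `X` has two non-adjacent neighbors in `P`. -/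
def WideAl (G : SimpleGraph V) {p q : V} (P : G.Walk p q) (X : Finset V) : Prop :=
  ∀ z ∈ X, ∃ u v : V, u ∈ P.support ∧ v ∈ P.support ∧
    G.Adj z u ∧ G.Adj z v ∧ u ≠ v ∧ ¬ G.Adj u v

/-- Every vertex of `X` has a unique neighbor in `P`. -/
def SpikyAl (G : SimpleGraph V) {p q : V} (P : G.Walk p q) (X : Finset V) : Prop :=
  ∀ z ∈ X, ∃! u : V, u ∈ P.support ∧ G.Adj z u

/-- Every vertex of `X` has exactly two neighbors in `P`, and they are adjacent. -/
def TriangularAl (G : SimpleGraph V) {p q : V} (P : G.Walk p q) (X : Finset V) : Prop :=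
  ∀ z ∈ X, ∃ u v : V, u ∈ P.support ∧ v ∈ P.support ∧
    G.Adj z u ∧ G.Adj z v ∧ u ≠ v ∧ G.Adj u v ∧
    ∀ w ∈ P.support, G.Adj z w → w = u ∨ w = v

/-- `(P, X)` is a consistent alignment. -/
def ConsistentAlignment (G : SimpleGraph V) {p q : V} (P : G.Walk p q) (X : Finset V) : Prop :=
  IsAlignment G P X ∧ (WideAl G P X ∨ SpikyAl G P X ∨ TriangularAl G P X)

/-- A branch vertex of a graph: a vertex of degree at least three. -/
def BranchVtx {W : Type} (T : SimpleGraph W) (v : W) : Prop :=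
  3 ≤ (T.neighborSet v).ncard

/-- `T` is a caterpillar: a tree of maximum degree three, no two branch vertices adjacent,
and some path contains all branch vertices. -/
def IsCaterpillar {W : Type} (T : SimpleGraph W) : Prop :=
  T.IsTree ∧ (∀ v, (T.neighborSet v).ncard ≤ 3) ∧
  (∀ u v, BranchVtx T u → BranchVtx T v → ¬ T.Adj u v) ∧
  ∃ (x y : W) (P : T.Walk x y), P.IsPath ∧ ∀ v, BranchVtx T v → v ∈ P.support

/-- `T` is a subdivided star with root `r`. -/
def IsSubdividedStar {W : Type} (T : SimpleGraph W) (r : W) : Prop :=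
  T.IsTree ∧ 3 ≤ (T.neighborSet r).ncard ∧ ∀ v, v ≠ r → (T.neighborSet v).ncard ≤ 2

/-- `H` is isomorphic to the line graph of a caterpillar. -/
def IsLineCaterpillar {U : Type} (H : SimpleGraph U) : Prop :=
  ∃ (W : Type) (T : SimpleGraph W), IsCaterpillar T ∧ Nonempty (H ≃g T.lineGraph)

/-- `H` is isomorphic to the line graph of a subdivided star. -/
def IsLineSubdividedStar {U : Type} (H : SimpleGraph U) : Prop :=
  ∃ (W : Type) (T : SimpleGraph W) (r : W),
    IsSubdividedStar T r ∧ Nonempty (H ≃g T.lineGraph)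

/-- `v` is a simplicial vertex of `G[S]`. -/
def SimplicialIn (G : SimpleGraph V) (S : Set V) (v : V) : Prop :=
  v ∈ S ∧ ∀ u ∈ S, ∀ w ∈ S, G.Adj v u → G.Adj v w → u ≠ w → G.Adj u w

/-- `G[S]` is one of the four connectifier shapes. -/
def ConnType (G : SimpleGraph V) (S : Set V) : Prop :=
  IsCaterpillar (G.induce S) ∨ IsLineCaterpillar (G.induce S) ∨
  (∃ r, IsSubdividedStar (G.induce S) r) ∨ IsLineSubdividedStar (G.induce S)

/-- `(G[S], X)` is a connectifier. -/
def IsConnectifier (G : SimpleGraph V) (S : Set V) (X : Finset V) : Prop :=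
  (∀ z ∈ X, (z : V) ∉ S) ∧ (∀ z ∈ X, ∃ r ∈ S, G.Adj z r) ∧
  ( (∃ v, S = {v}) ∨
    ( ConnType G S ∧
      (∀ z ∈ X, ∀ r₁ ∈ S, ∀ r₂ ∈ S, G.Adj z r₁ → G.Adj z r₂ → r₁ = r₂) ∧
      (∀ z ∈ X, ∀ r ∈ S, G.Adj z r → SimplicialIn G S r) ∧
      (∀ v, SimplicialIn G S v → ∃ z ∈ X, G.Adj z v) ) )

/-- The connectifier `(G[S], X)` is concentrated. -/
def Concentrated (G : SimpleGraph V) (S : Set V) : Prop :=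
  (∃ v, S = {v}) ∨ (∃ r, IsSubdividedStar (G.induce S) r) ∨
  IsLineSubdividedStar (G.induce S)

/-- Reachability inside a vertex set `A`. -/
def Reaches (G : SimpleGraph V) (A : Set V) (u v : V) : Prop :=
  ∃ (w : G.Walk u v), ∀ z ∈ w.support, z ∈ A

/-- `Pw` is a spine of the caterpillar `G[S]`: a maximal path containing all branch vertices. -/
def IsSpineOf (G : SimpleGraph V) (S : Set V) {p q : V} (Pw : G.Walk p q) : Prop :=
  Pw.IsPath ∧ (∀ w ∈ Pw.support, w ∈ S) ∧
  (∀ v ∈ S, 3 ≤ ({u | u ∈ S ∧ G.Adj v u}).ncard → v ∈ Pw.support) ∧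
  ∀ (p' q' : V) (P' : G.Walk p' q'), P'.IsPath → (∀ w ∈ P'.support, w ∈ S) →
    (∀ w ∈ Pw.support, w ∈ P'.support) → ∀ w ∈ P'.support, w ∈ Pw.support

/-- `Pw` realizes `P(H)` for `H = G[S]`, when `H` is a caterpillar or the line graph
of a caterpillar. -/
def IsPHOf (G : SimpleGraph V) (S : Set V) {p q : V} (Pw : G.Walk p q) : Prop :=
  Pw.IsPath ∧ (∀ w ∈ Pw.support, w ∈ S) ∧
  ( (IsCaterpillar (G.induce S) ∧ IsSpineOf G S Pw) ∨
    (∃ (W : Type) (T : SimpleGraph W) (φ : T.lineGraph ≃g G.induce S)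
        (x y : W) (Q : T.Walk x y),
      IsCaterpillar T ∧ Q.IsPath ∧
      (∀ v, BranchVtx T v → v ∈ Q.support) ∧
      (∀ (x' y' : W) (Q' : T.Walk x' y'), Q'.IsPath →
        (∀ w ∈ Q.support, w ∈ Q'.support) → ∀ w ∈ Q'.support, w ∈ Q.support) ∧
      {w | w ∈ Pw.support} = {v : V | ∃ e : T.edgeSet, (e : Sym2 W) ∈ Q.edges ∧ ↑(φ e) = v}) )

/-- `x` enumerates `X` in the order given by the (non-concentrated) connectifier `(G[S], X)`
with central path `Pw = P(H)`. -/
def ConnectifierOrder (G : SimpleGraph V) (S : Set V) (X : Finset V)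
    {p q : V} (Pw : G.Walk p q) {k : ℕ} (x : Fin k → V) : Prop :=
  Function.Injective x ∧ (∀ l, x l ∈ X) ∧ (∀ z ∈ X, ∃ l, x l = z) ∧
  ∃ (s : Fin k → V) (lo hi : Fin k → ℕ),
    (∀ l, lo l ≤ hi l) ∧ (∀ l m : Fin k, l < m → hi l < lo m) ∧
    (∀ l, hi l < Pw.support.length) ∧
    (∀ (l : Fin k) (n : Fin Pw.support.length),
      G.Adj (s l) (Pw.support.get n) → lo l ≤ (n : ℕ) ∧ (n : ℕ) ≤ hi l) ∧
    ∀ l : Fin k, s l ∈ S ∧ s l ∉ Pw.support ∧ (∃ u ∈ Pw.support, G.Adj (s l) u) ∧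
      ∀ r ∈ S, G.Adj (x l) r → Reaches G (S \ {w | w ∈ Pw.support}) r (s l)

/-- `(G[S], X)` is a consistent alignment (with `G[S]` a path). -/
def ConsistentAlignmentSet (G : SimpleGraph V) (S : Set V) (X : Finset V) : Prop :=
  ∃ (p q : V) (Pw : G.Walk p q), Pw.IsPath ∧ InducedWalk G Pw ∧
    {w | w ∈ Pw.support} = S ∧ ConsistentAlignment G Pw X

/-- The orders on `X` given by `(D1, X)` and by `(G[S], X)` coincide. -/
def OrdersAgree (G : SimpleGraph V) {p q : V} (D1w : G.Walk p q)
    (S : Set V) (X : Finset V) : Prop :=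
  ∃ (k : ℕ) (x : Fin k → V),
    AlignmentOrder G D1w X x ∧
    ( (∃ (p' q' : V) (Pw : G.Walk p' q'), IsPHOf G S Pw ∧ ConnectifierOrder G S X Pw x) ∨
      (∃ (p' q' : V) (Pw : G.Walk p' q'), Pw.IsPath ∧ InducedWalk G Pw ∧
        {w | w ∈ Pw.support} = S ∧ AlignmentOrder G Pw X x) )

/-- `(D1, Y, D2)` is an `s`-trisection of `G`, where `D1` is (the support of) the path `D1w`. -/
def IsTrisection (G : SimpleGraph V) (s : ℕ) {p q : V} (D1w : G.Walk p q)
    (Y D2 : Set V) : Prop :=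
  D1w.IsPath ∧ InducedWalk G D1w ∧
  (∀ w ∈ D1w.support, w ∉ Y ∧ w ∉ D2) ∧ Disjoint Y D2 ∧
  ({w | w ∈ D1w.support} ∪ Y ∪ D2 = Set.univ) ∧
  D2.Nonempty ∧
  (∀ a ∈ D1w.support, ∀ b ∈ D2, ¬ G.Adj a b) ∧
  StableSet G Y ∧ Y.ncard = s ∧
  OpenNbhd G {w | w ∈ D1w.support} = Y ∧ OpenNbhd G D2 = Y ∧
  (∀ y ∈ Y, ∃ d ∈ D1w.support, ∀ z ∈ Y, (G.Adj d z ↔ z = y))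

/-- The conclusion of amiability for the trisection `(D1w, Y, D2)` with parameter `x`:
the pair `(G[S], X)` is "given by amiability". -/
def AmiableOutcome (G : SimpleGraph V) {p q : V} (D1w : G.Walk p q)
    (Y D2 : Set V) (x : ℕ) (S : Set V) (X : Finset V) : Prop :=
  S ⊆ D2 ∧ ↑X ⊆ Y ∧ X.card = x ∧
  ConsistentAlignment G D1w X ∧
  (IsConnectifier G S X ∨ ConsistentAlignmentSet G S X) ∧
  (¬ (IsConnectifier G S X ∧ Concentrated G S) → OrdersAgree G D1w S X)

section Basics

variable {G : SimpleGraph V} {A B C : Set V} {u v x y z : V}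

/-- No vertex of `A` equals or is adjacent to a vertex of `B`. -/
def Apart (G : SimpleGraph V) (A B : Set V) : Prop :=
  ∀ x ∈ A, ∀ y ∈ B, x ≠ y ∧ ¬ G.Adj x y

/-- The set of values of a sequence on the interval `[a, b]`. -/
def Seg (r : ℕ → V) (a b : ℕ) : Set V := {x | ∃ s, a ≤ s ∧ s ≤ b ∧ x = r s}

/-- Some vertex of `K` equals or is adjacent to `u`. -/
def Touch (G : SimpleGraph V) (K : Set V) (u : V) : Prop := ∃ x ∈ K, x = u ∨ G.Adj x u

/-- Any two vertices of `K` are joined by a walk inside `K`. -/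
def Linked (G : SimpleGraph V) (K : Set V) : Prop := ∀ u ∈ K, ∀ v ∈ K, Reaches G K u v

lemma Apart.symm (h : Apart G A B) : Apart G B A := fun x hx y hy =>
  ⟨(h y hy x hx).1.symm, fun e => (h y hy x hx).2 e.symm⟩

lemma Apart.union_left (h₁ : Apart G A C) (h₂ : Apart G B C) : Apart G (A ∪ B) C := by
  rintro x (hx | hx)
  · exact h₁ x hx
  · exact h₂ x hx

lemma Apart.union_right (h₁ : Apart G A B) (h₂ : Apart G A C) : Apart G A (B ∪ C) :=
  (h₁.symm.union_left h₂.symm).symm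

lemma apart_seg {r q : ℕ → V} {a b c d : ℕ}
    (h : ∀ s t, a ≤ s → s ≤ b → c ≤ t → t ≤ d → r s ≠ q t ∧ ¬ G.Adj (r s) (q t)) :
    Apart G (Seg r a b) (Seg q c d) := by
  rintro _ ⟨s, h1, h2, rfl⟩ _ ⟨t, h3, h4, rfl⟩
  exact h s t h1 h2 h3 h4

lemma mem_seg {r : ℕ → V} {a b s : ℕ} (h₁ : a ≤ s) (h₂ : s ≤ b) : r s ∈ Seg r a b :=
  ⟨s, h₁, h₂, rfl⟩

lemma Reaches.mono (h : Reaches G A x y) (hAB : A ⊆ B) : Reaches G B x y := by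
  obtain ⟨w, hw⟩ := h
  exact ⟨w, fun z hz => hAB (hw z hz)⟩

lemma Reaches.trans (h₁ : Reaches G A x y) (h₂ : Reaches G A y z) : Reaches G A x z := by
  obtain ⟨w, hw⟩ := h₁
  obtain ⟨w', hw'⟩ := h₂
  refine ⟨w.append w', fun z hz => ?_⟩
  rcases (Walk.mem_support_append_iff w w').1 hz with h | h
  exacts [hw _ h, hw' _ h]

lemma Reaches.symm (h : Reaches G A x y) : Reaches G A y x := by
  obtain ⟨w, hw⟩ := h
  exact ⟨w.reverse, fun z hz => hw z (by simpa using hz)⟩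

lemma reaches_refl (h : x ∈ A) : Reaches G A x x := ⟨Walk.nil, by simpa using h⟩

lemma reaches_adj (hx : x ∈ A) (hy : y ∈ A) (h : G.Adj x y) : Reaches G A x y :=
  ⟨h.toWalk, by
    intro z hz
    simp only [Walk.support_cons, Walk.support_nil, List.mem_cons, List.not_mem_nil,
      or_false] at hz
    rcases hz with rfl | rfl <;> assumption⟩

lemma Reaches.mem_left (h : Reaches G A x y) : x ∈ A := by
  obtain ⟨w, hw⟩ := h
  exact hw _ w.start_mem_support

lemma Reaches.mem_right (h : Reaches G A x y) : y ∈ A := h.symm.mem_left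

lemma reaches_seg {r : ℕ → V} {a b s t : ℕ} (hadj : ∀ i, a ≤ i → i < b → G.Adj (r i) (r (i + 1)))
    (hA : ∀ i, a ≤ i → i ≤ b → r i ∈ A) (hs : a ≤ s) (hs' : s ≤ b) (ht : a ≤ t) (ht' : t ≤ b) :
    Reaches G A (r s) (r t) := by
  have key : ∀ i, a ≤ i → i ≤ b → Reaches G A (r a) (r i) := by
    intro i hi
    induction i, hi using Nat.le_induction with
    | base => intro h; exact reaches_refl (hA _ le_rfl h)
    | succ i hi ih =>
      intro h
      exact (ih (by omega)).trans (reaches_adj (hA _ hi (by omega)) (hA _ (by omega) h)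
        (hadj _ hi (by omega)))
  exact (key s hs hs').symm.trans (key t ht ht')

/-- A walk in sequence form. -/
lemma Reaches.exists_seq (h : Reaches G A x y) :
    ∃ (k : ℕ → V) (m : ℕ), k 0 = x ∧ k m = y ∧ (∀ i ≤ m, k i ∈ A) ∧
      ∀ i < m, G.Adj (k i) (k (i + 1)) := by
  obtain ⟨w, hw⟩ := h
  refine ⟨w.getVert, w.length, by simp, by simp, fun i _ => hw _ (w.getVert_mem_support i),
    fun i hi => w.adj_getVert_succ hi⟩

/-- An induced path in sequence form. -/
def IsSeq (G : SimpleGraph V) (k : ℕ → V) (m : ℕ) : Prop :=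
  (∀ i ≤ m, ∀ j ≤ m, k i = k j → i = j) ∧
  ∀ i ≤ m, ∀ j ≤ m, G.Adj (k i) (k j) ↔ i + 1 = j ∨ j + 1 = i

lemma exists_min_seq {K : Set V} (R : V → V → Prop) (hK : Linked G K)
    (h : ∃ x ∈ K, ∃ y ∈ K, R x y) :
    ∃ (k : ℕ → V) (m : ℕ), IsSeq G k m ∧ (∀ i ≤ m, k i ∈ K) ∧ R (k 0) (k m) ∧
      ∀ i ≤ m, ∀ j ≤ m, R (k i) (k j) → (i = 0 ∧ j = m) ∨ (i = m ∧ j = 0) := by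
  classical
  let S : ℕ → Prop := fun m => ∃ k : ℕ → V, (∀ i < m, G.Adj (k i) (k (i + 1))) ∧
    (∀ i ≤ m, k i ∈ K) ∧ R (k 0) (k m)
  have hS : ∃ m, S m := by
    obtain ⟨x, hx, y, hy, hR⟩ := h
    obtain ⟨k, m, rfl, rfl, h1, h2⟩ := (hK x hx y hy).exists_seq
    exact ⟨m, k, h2, h1, hR⟩
  obtain ⟨k, hadj, hmem, hR⟩ := Nat.find_spec hS
  have hmin : ∀ l < Nat.find hS, ¬ S l := fun l hl => Nat.find_min hS hl
  set m := Nat.find hS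
  refine ⟨k, m, ⟨?_, ?_⟩, hmem, hR, ?_⟩
  · have key : ∀ i j, i < j → j ≤ m → k i ≠ k j := by
      intro i j hij hj e
      apply hmin (m - (j - i)) (by omega)
      refine ⟨fun s => if s ≤ i then k s else k (s + (j - i)), ?_, ?_, ?_⟩
      · intro s hs
        rcases lt_trichotomy s i with h | h | h
        · simpa [show s ≤ i by omega, show s + 1 ≤ i by omega] using hadj s (by omega)
        · subst h
          have := hadj j (by omega)
          simp only [le_refl, if_true, show ¬ (s + 1 ≤ s) by omega, if_false, e]
          rwa [show s + 1 + (j - s) = j + 1 by omega]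
        · simp only [show ¬ s ≤ i by omega, show ¬ s + 1 ≤ i by omega, if_false]
          rw [show s + 1 + (j - i) = s + (j - i) + 1 by omega]
          exact hadj _ (by omega)
      · intro s hs
        dsimp only
        split_ifs <;> exact hmem _ (by omega)
      · dsimp only
        by_cases h' : m - (j - i) ≤ i
        · rw [if_pos (by omega), if_pos h', show m - (j - i) = i by omega, e,
            show j = m by omega]
          exact hR
        · rw [if_pos (by omega), if_neg h', show m - (j - i) + (j - i) = m by omega]
          exact hR
    intro i hi j hj e
    rcases lt_trichotomy i j with h | h | h
    · exact (key i j h hj e).elim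
    · exact h
    · exact (key j i h hi e.symm).elim
  · have key : ∀ i j, i + 1 < j → j ≤ m → ¬ G.Adj (k i) (k j) := by
      intro i j hij hj e
      apply hmin (m - (j - i - 1)) (by omega)
      refine ⟨fun s => if s ≤ i then k s else k (s + (j - i - 1)), ?_, ?_, ?_⟩
      · intro s hs
        rcases lt_trichotomy s i with h | h | h
        · simpa [show s ≤ i by omega, show s + 1 ≤ i by omega] using hadj s (by omega)
        · subst h
          simp only [le_refl, if_true, show ¬ (s + 1 ≤ s) by omega, if_false]
          rwa [show s + 1 + (j - s - 1) = j by omega]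
        · simp only [show ¬ s ≤ i by omega, show ¬ s + 1 ≤ i by omega, if_false]
          rw [show s + 1 + (j - i - 1) = s + (j - i - 1) + 1 by omega]
          exact hadj _ (by omega)
      · intro s hs
        dsimp only
        split_ifs <;> exact hmem _ (by omega)
      · dsimp only
        rw [if_pos (by omega), if_neg (by omega), show m - (j - i - 1) + (j - i - 1) = m by omega]
        exact hR
    intro i hi j hj
    constructor
    · intro e
      rcases lt_trichotomy i j with h | h | h
      · by_contra h'
        exact key i j (by omega) hj e
      · subst h; exact (G.loopless.irrefl _ e).elim
      · by_contra h'
        exact key j i (by omega) hi e.symm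
    · rintro (rfl | rfl)
      · exact hadj _ (by omega)
      · exact (hadj _ (by omega)).symm
  · intro i hi j hj hR'
    by_contra hne
    rcases le_total i j with h | h
    · apply hmin (j - i) (by omega)
      refine ⟨fun s => k (s + i), ?_, fun s hs => hmem _ (by omega), ?_⟩
      · intro s hs
        dsimp only
        rw [show s + 1 + i = s + i + 1 by omega]
        exact hadj _ (by omega)
      · simpa [show j - i + i = j by omega] using hR'
    · apply hmin (i - j) (by omega)
      refine ⟨fun s => k (i - s), ?_, fun s hs => hmem _ (by omega), ?_⟩
      · intro s hs
        have := hadj (i - s - 1) (by omega)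
        rw [show i - s - 1 + 1 = i - s by omega] at this
        simpa [show i - (s + 1) = i - s - 1 by omega] using this.symm
      · simpa [show i - (i - j) = j by omega] using hR'

lemma IsSeq.exists_walk {m : ℕ} : ∀ {k : ℕ → V}, IsSeq G k m →
    ∃ P : G.Walk (k 0) (k m), P.IsPath ∧ P.length = m ∧
      (∀ x, x ∈ P.support ↔ ∃ i ≤ m, x = k i) ∧ ∀ i < m, s(k i, k (i + 1)) ∈ P.edges := by
  induction m with
  | zero =>
    intro k _
    exact ⟨Walk.nil, by simp⟩
  | succ m ih =>
    intro k hk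
    have hk' : IsSeq G (fun i => k (i + 1)) m := by
      refine ⟨fun i hi j hj e => ?_, fun i hi j hj => ?_⟩
      · have := hk.1 _ (by omega) _ (by omega) e
        omega
      · have := hk.2 (i + 1) (by omega) (j + 1) (by omega)
        simp only [this]
        omega
    obtain ⟨P, hP, hl, hs, he⟩ := ih hk'
    have hadj : G.Adj (k 0) (k (0 + 1)) := (hk.2 0 (by omega) 1 (by omega)).2 (by omega)
    refine ⟨Walk.cons hadj P, ?_, by simp [hl], ?_, ?_⟩
    · rw [Walk.cons_isPath_iff]
      refine ⟨hP, fun hmem => ?_⟩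
      obtain ⟨i, hi, e⟩ := (hs _).1 hmem
      have := hk.1 0 (by omega) (i + 1) (by omega) e
      omega
    · intro x
      rw [Walk.support_cons, List.mem_cons, hs]
      constructor
      · rintro (rfl | ⟨i, hi, rfl⟩)
        · exact ⟨0, by omega, rfl⟩
        · exact ⟨i + 1, by omega, rfl⟩
      · rintro ⟨i, hi, rfl⟩
        rcases i with _ | i
        · exact Or.inl rfl
        · exact Or.inr ⟨i, by omega, rfl⟩
    · intro i hi
      rw [Walk.edges_cons, List.mem_cons]
      rcases i with _ | i
      · exact Or.inl rfl
      · exact Or.inr (he i (by omega))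

lemma Reaches.linked (h : Reaches G A x y) :
    ∃ B ⊆ A, Linked G B ∧ x ∈ B ∧ y ∈ B := by
  obtain ⟨k, m, rfl, rfl, h1, h2⟩ := h.exists_seq
  refine ⟨Seg k 0 m, ?_, ?_, mem_seg (by omega) (by omega), mem_seg (by omega) le_rfl⟩
  · rintro _ ⟨s, _, hs, rfl⟩
    exact h1 s hs
  · rintro _ ⟨s, _, hs, rfl⟩ _ ⟨t, _, ht, rfl⟩
    exact reaches_seg (fun i _ hi => h2 i hi) (fun i h h' => mem_seg h h') (by omega) hs
      (by omega) ht

lemma Reaches.exists_isSeq (h : Reaches G A x y) :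
    ∃ (k : ℕ → V) (m : ℕ), IsSeq G k m ∧ k 0 = x ∧ k m = y ∧ ∀ i ≤ m, k i ∈ A := by
  obtain ⟨B, hBA, hB, hx, hy⟩ := h.linked
  obtain ⟨k, m, h1, h2, h3, -⟩ := exists_min_seq (fun a b => a = x ∧ b = y) hB
    ⟨x, hx, y, hy, rfl, rfl⟩
  exact ⟨k, m, h1, h3.1, h3.2, fun i hi => hBA (h2 i hi)⟩

lemma Reaches.exists_inducedWalk (h : Reaches G A x y) :
    ∃ P : G.Walk x y, P.IsPath ∧ InducedWalk G P ∧ ∀ z ∈ P.support, z ∈ A := by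
  obtain ⟨k, m, hk, rfl, rfl, hA⟩ := h.exists_isSeq
  obtain ⟨P, hP, -, hs, he⟩ := hk.exists_walk
  refine ⟨P, hP, ?_, ?_⟩
  · intro x hx y hy hadj
    obtain ⟨i, hi, rfl⟩ := (hs x).1 hx
    obtain ⟨j, hj, rfl⟩ := (hs y).1 hy
    rcases (hk.2 i hi j hj).1 hadj with rfl | rfl
    · exact he _ (by omega)
    · rw [Sym2.eq_swap]
      exact he _ (by omega)
  · intro z hz
    obtain ⟨i, hi, rfl⟩ := (hs z).1 hz
    exact hA i hi

lemma two_le_length (hne : x ≠ y) (hadj : ¬ G.Adj x y) (P : G.Walk x y) : 2 ≤ P.length := by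
  by_contra h
  have h' : P.length = 0 ∨ P.length = 1 := by omega
  rcases h' with h' | h'
  · exact hne (Walk.eq_of_length_eq_zero h')
  · exact hadj (Walk.adj_of_length_eq_one h')

lemma containsTheta_of_apart {a b : V} {D₁ D₂ D₃ : Set V} (hne : a ≠ b) (hadj : ¬ G.Adj a b)
    (h₁ : Reaches G (insert a (insert b D₁)) a b) (h₂ : Reaches G (insert a (insert b D₂)) a b)
    (h₃ : Reaches G (insert a (insert b D₃)) a b)
    (h₁₂ : Apart G D₁ D₂) (h₁₃ : Apart G D₁ D₃) (h₂₃ : Apart G D₂ D₃) : ContainsTheta G := by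
  obtain ⟨P₁, hP₁, hI₁, hs₁⟩ := h₁.exists_inducedWalk
  obtain ⟨P₂, hP₂, hI₂, hs₂⟩ := h₂.exists_inducedWalk
  obtain ⟨P₃, hP₃, hI₃, hs₃⟩ := h₃.exists_inducedWalk
  have key : ∀ {D : Set V} (P : G.Walk a b), (∀ z ∈ P.support, z ∈ insert a (insert b D)) →
      Interior P ⊆ D := by
    rintro D P hP z ⟨hz, hza, hzb⟩
    simpa [hza, hzb] using hP z hz
  have k₁ := key P₁ hs₁
  have k₂ := key P₂ hs₂
  have k₃ := key P₃ hs₃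
  refine ⟨a, b, P₁, P₂, P₃, hne, hadj, hP₁, hP₂, hP₃, hI₁, hI₂, hI₃,
    two_le_length hne hadj _, two_le_length hne hadj _, two_le_length hne hadj _,
    ?_, ?_, ?_, ?_, ?_, ?_⟩
  · exact Set.disjoint_left.2 fun x hx hy => (h₁₂ x (k₁ hx) x (k₂ hy)).1 rfl
  · exact Set.disjoint_left.2 fun x hx hy => (h₁₃ x (k₁ hx) x (k₃ hy)).1 rfl
  · exact Set.disjoint_left.2 fun x hx hy => (h₂₃ x (k₂ hx) x (k₃ hy)).1 rfl
  · exact fun x hx y hy => (h₁₂ x (k₁ hx) y (k₂ hy)).2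
  · exact fun x hx y hy => (h₁₃ x (k₁ hx) y (k₃ hy)).2
  · exact fun x hx y hy => (h₂₃ x (k₂ hx) y (k₃ hy)).2

/-- `E` and `F` are disjoint, and `a a'` and `b b'` are the only edges between them. -/
def Rungs (G : SimpleGraph V) (E F : Set V) (a a' b b' : V) : Prop :=
  ∀ x ∈ E, ∀ y ∈ F, x ≠ y ∧ (G.Adj x y → (x = a ∧ y = a') ∨ (x = b ∧ y = b'))

lemma Rungs.union_left {E E' F : Set V} {a a' b b' : V} (h : Rungs G E F a a' b b')
    (h' : Rungs G E' F a a' b b') : Rungs G (E ∪ E') F a a' b b' := by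
  rintro x (hx | hx)
  exacts [h x hx, h' x hx]

lemma Rungs.symm {E F : Set V} {a a' b b' : V} (h : Rungs G E F a a' b b') :
    Rungs G F E a' a b' b := by
  intro x hx y hy
  have := h y hy x hx
  refine ⟨this.1.symm, fun e => ?_⟩
  have := this.2 e.symm
  tauto

lemma Rungs.union_right {E F F' : Set V} {a a' b b' : V} (h : Rungs G E F a a' b b')
    (h' : Rungs G E F' a a' b b') : Rungs G E (F ∪ F') a a' b b' :=
  (h.symm.union_left h'.symm).symm

lemma Apart.rungs {E F : Set V} (h : Apart G E F) (a a' b b' : V) : Rungs G E F a a' b b' :=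
  fun x hx y hy => ⟨(h x hx y hy).1, fun e => ((h x hx y hy).2 e).elim⟩

lemma rungs_seg {r q : ℕ → V} {a b c d : ℕ} {u u' v v' : V}
    (h : ∀ s t, a ≤ s → s ≤ b → c ≤ t → t ≤ d →
      r s ≠ q t ∧ (G.Adj (r s) (q t) → (r s = u ∧ q t = u') ∨ (r s = v ∧ q t = v'))) :
    Rungs G (Seg r a b) (Seg q c d) u u' v v' := by
  rintro _ ⟨s, h1, h2, rfl⟩ _ ⟨t, h3, h4, rfl⟩
  exact h s t h1 h2 h3 h4

lemma containsPrism_of_rungs {a₁ a₂ a₃ b₁ b₂ b₃ : V} {E₁ E₂ E₃ : Set V}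
    (ha₁₂ : G.Adj a₁ a₂) (ha₁₃ : G.Adj a₁ a₃) (ha₂₃ : G.Adj a₂ a₃)
    (hb₁₂ : G.Adj b₁ b₂) (hb₁₃ : G.Adj b₁ b₃) (hb₂₃ : G.Adj b₂ b₃)
    (h₁ : Reaches G E₁ a₁ b₁) (h₂ : Reaches G E₂ a₂ b₂) (h₃ : Reaches G E₃ a₃ b₃)
    (h₁₂ : Rungs G E₁ E₂ a₁ a₂ b₁ b₂) (h₁₃ : Rungs G E₁ E₃ a₁ a₃ b₁ b₃)
    (h₂₃ : Rungs G E₂ E₃ a₂ a₃ b₂ b₃)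
    (hl₁ : a₁ ≠ b₁) (hl₂ : a₂ ≠ b₂) (hl₃ : a₃ = b₃ → ¬ G.Adj a₁ b₁ ∧ ¬ G.Adj a₂ b₂) :
    ContainsPrism G := by
  obtain ⟨P₁, hP₁, hI₁, hs₁⟩ := h₁.exists_inducedWalk
  obtain ⟨P₂, hP₂, hI₂, hs₂⟩ := h₂.exists_inducedWalk
  obtain ⟨P₃, hP₃, hI₃, hs₃⟩ := h₃.exists_inducedWalk
  have pos : ∀ {x y : V} (P : G.Walk x y), x ≠ y → 1 ≤ P.length := fun P h => by
    by_contra h'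
    exact h (Walk.eq_of_length_eq_zero (p := P) (by omega))
  have l₁ := pos P₁ hl₁
  have l₂ := pos P₂ hl₂
  have l₁₃ : 2 ≤ P₁.length + P₃.length ∧ 2 ≤ P₂.length + P₃.length := by
    by_cases h : a₃ = b₃
    · have := two_le_length hl₁ (hl₃ h).1 P₁
      have := two_le_length hl₂ (hl₃ h).2 P₂
      omega
    · have := pos P₃ h
      omega
  let P : ∀ i : Fin 3, G.Walk (![a₁, a₂, a₃] i) (![b₁, b₂, b₃] i) := fun i =>
    match i with
    | 0 => P₁
    | 1 => P₂
    | 2 => P₃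
  let E : Fin 3 → Set V := ![E₁, E₂, E₃]
  have hE : ∀ i, ∀ x ∈ (P i).support, x ∈ E i := by
    intro i
    fin_cases i
    exacts [hs₁, hs₂, hs₃]
  have hR : ∀ i j, i ≠ j → Rungs G (E i) (E j) (![a₁, a₂, a₃] i) (![a₁, a₂, a₃] j)
      (![b₁, b₂, b₃] i) (![b₁, b₂, b₃] j) := by
    intro i j hij
    fin_cases i <;> fin_cases j
    exacts [(hij rfl).elim, h₁₂, h₁₃, h₁₂.symm, (hij rfl).elim, h₂₃, h₁₃.symm, h₂₃.symm,
      (hij rfl).elim]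
  refine ⟨![a₁, a₂, a₃], ![b₁, b₂, b₃], P, ?_, ?_, ?_, ?_, ?_, ?_, ?_⟩
  · intro i j hij
    fin_cases i <;> fin_cases j
    exacts [(hij rfl).elim, ha₁₂, ha₁₃, ha₁₂.symm, (hij rfl).elim, ha₂₃, ha₁₃.symm, ha₂₃.symm,
      (hij rfl).elim]
  · intro i j hij
    fin_cases i <;> fin_cases j
    exacts [(hij rfl).elim, hb₁₂, hb₁₃, hb₁₂.symm, (hij rfl).elim, hb₂₃, hb₁₃.symm, hb₂₃.symm,
      (hij rfl).elim]
  · intro i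
    fin_cases i
    exacts [hP₁, hP₂, hP₃]
  · intro i
    fin_cases i
    exacts [hI₁, hI₂, hI₃]
  · intro i j hij x hx hx'
    exact (hR i j hij x (hE i x hx) x (hE j x hx')).1 rfl
  · intro i j hij x hx y hy
    exact (hR i j hij x (hE i x hx) y (hE j y hy)).2
  · intro i j hij
    fin_cases i <;> fin_cases j
    exacts [(hij rfl).elim, (by change 2 ≤ P₁.length + P₂.length; omega), l₁₃.1,
      (by change 2 ≤ P₂.length + P₁.length; omega), (hij rfl).elim, l₁₃.2,
      (by change 2 ≤ P₃.length + P₁.length; omega), (by change 2 ≤ P₃.length + P₂.length; omega),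
      (hij rfl).elim]

end Basics

section Pyramids

variable {G : SimpleGraph V}

/-- An induced pyramid with apex `a`, whose legs are the sequences `r i` of lengths `n i`. -/
structure Pyr (G : SimpleGraph V) (a : V) (r : Fin 3 → ℕ → V) (n : Fin 3 → ℕ) : Prop where
  pos : ∀ i, 1 ≤ n i
  two : ∀ i j, i ≠ j → 3 ≤ n i + n j
  apex : ∀ i, r i 0 = a
  inj : ∀ i j s t, s ≤ n i → t ≤ n j → r i s = r j t → (i = j ∧ s = t) ∨ (s = 0 ∧ t = 0)
  adj : ∀ i j s t, s ≤ n i → t ≤ n j → (G.Adj (r i s) (r j t) ↔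
    (s = 0 ∧ t = 1) ∨ (s = 1 ∧ t = 0) ∨ (i = j ∧ (s + 1 = t ∨ t + 1 = s)) ∨
      (i ≠ j ∧ s = n i ∧ t = n j))

variable {a : V} {r : Fin 3 → ℕ → V} {n : Fin 3 → ℕ}

lemma Pyr.apart_ne (h : Pyr G a r n) {i j : Fin 3} (hij : i ≠ j) {s t : ℕ} (hs : s ≤ n i)
    (ht : t ≤ n j) (hs0 : s = 0 → 2 ≤ t) (ht0 : t = 0 → 2 ≤ s) (hst : ¬ (s = n i ∧ t = n j)) :
    r i s ≠ r j t ∧ ¬ G.Adj (r i s) (r j t) := by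
  refine ⟨fun e => ?_, fun e => ?_⟩
  · rcases h.inj i j s t hs ht e with h | h
    · exact hij h.1
    · omega
  · rcases (h.adj i j s t hs ht).1 e with h | h | h | h
    · omega
    · omega
    · exact hij h.1
    · exact hst h.2

lemma Pyr.apart_eq (h : Pyr G a r n) {i : Fin 3} {s t : ℕ} (hst : s + 2 ≤ t) (ht : t ≤ n i) :
    r i s ≠ r i t ∧ ¬ G.Adj (r i s) (r i t) := by
  refine ⟨fun e => ?_, fun e => ?_⟩
  · rcases h.inj i i s t (by omega) ht e with h | h <;> omega
  · rcases (h.adj i i s t (by omega) ht).1 e with h | h | h | h <;> omega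

lemma Pyr.adj_succ (h : Pyr G a r n) {i : Fin 3} {s : ℕ} (hs : s < n i) :
    G.Adj (r i s) (r i (s + 1)) :=
  (h.adj i i s (s + 1) (by omega) (by omega)).2 (by simp)

lemma Pyr.adj_last (h : Pyr G a r n) {i j : Fin 3} (hij : i ≠ j) :
    G.Adj (r i (n i)) (r j (n j)) :=
  (h.adj i j _ _ le_rfl le_rfl).2 (by simp [hij])

lemma Pyr.reaches (h : Pyr G a r n) {i : Fin 3} {A : Set V} {c d s t : ℕ} (hd : d ≤ n i)
    (hA : ∀ s, c ≤ s → s ≤ d → r i s ∈ A) (hs : c ≤ s) (hs' : s ≤ d) (ht : c ≤ t) (ht' : t ≤ d) :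
    Reaches G A (r i s) (r i t) :=
  reaches_seg (fun _ _ h2 => h.adj_succ (by omega)) hA hs hs' ht ht'

lemma exists_first_last {p : ℕ → Prop} {N : ℕ} (h : ∃ s ≤ N, p s) :
    ∃ f g, f ≤ g ∧ g ≤ N ∧ p f ∧ p g ∧ ∀ s ≤ N, p s → f ≤ s ∧ s ≤ g := by
  classical
  have hfin : {s | s ≤ N ∧ p s}.Finite := (Set.finite_Iic N).subset fun s hs => hs.1
  obtain ⟨s₀, hs₀⟩ := h
  obtain ⟨f, hf⟩ := hfin.exists_minimal ⟨s₀, hs₀⟩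
  obtain ⟨g, hg⟩ := hfin.exists_maximal ⟨s₀, hs₀⟩
  have key : ∀ s ≤ N, p s → f ≤ s ∧ s ≤ g := fun s hs hp => by
    refine ⟨?_, ?_⟩
    · by_contra h'
      exact h' (hf.2 ⟨hs, hp⟩ (by omega))
    · by_contra h'
      exact h' (hg.2 ⟨hs, hp⟩ (by omega))
  exact ⟨f, g, (key g hg.1.1 hg.1.2).1, hg.1.1, hf.1.2, hg.1.2, key⟩

lemma Pyr.false_of_seq (hP : Pyr G a r n) (hθ : ¬ ContainsTheta G) (hπ : ¬ ContainsPrism G)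
    {k : ℕ → V} {m : ℕ} (hk : IsSeq G k m) {i j l : Fin 3} (hij : i ≠ j) (hil : i ≠ l)
    (hjl : j ≠ l) (hout : ∀ s ≤ m, ∀ i, ∀ t ≤ n i, k s ≠ r i t)
    (hav : ∀ s ≤ m, ∀ i, ¬ G.Adj (k s) (r i 0) ∧ ¬ G.Adj (k s) (r i 1) ∧
      ¬ G.Adj (k s) (r i (n i)))
    (hi : ∀ s ≤ m, ∀ t ≤ n i, G.Adj (k s) (r i t) → s = 0)
    (hi' : ∃ t ≤ n i, G.Adj (k 0) (r i t))
    (hj : ∀ s ≤ m, ∀ t ≤ n j, G.Adj (k s) (r j t) → s = m)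
    (hj' : ∃ t ≤ n j, G.Adj (k m) (r j t))
    (hl : ∀ s ≤ m, ∀ t ≤ n l, ¬ G.Adj (k s) (r l t)) : False := by
  obtain ⟨f, g, hfg, hg, hf1, hg1, hfirst⟩ := exists_first_last hi'
  obtain ⟨d, hd, hd1⟩ := hj'
  have hpos := hP.pos
  have ne_of : ∀ {i s t} {x : V}, G.Adj x (r i s) → ¬ G.Adj x (r i t) → s ≠ t := by
    rintro i s t x h1 h2 rfl
    exact h2 h1
  have hf2 : 2 ≤ f := by
    have := ne_of hf1 (hav 0 (by omega) i).1
    have := ne_of hf1 (hav 0 (by omega) i).2.1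
    omega
  have hg2 : g < n i := by
    have := ne_of hg1 (hav 0 (by omega) i).2.2
    omega
  have hd2 : 2 ≤ d ∧ d < n j := by
    have := ne_of hd1 (hav m (by omega) j).1
    have := ne_of hd1 (hav m (by omega) j).2.1
    have := ne_of hd1 (hav m (by omega) j).2.2
    omega
  have kreach : ∀ {A : Set V} {c s t}, (∀ s, c ≤ s → s ≤ m → k s ∈ A) → c ≤ s → s ≤ m → c ≤ t →
      t ≤ m → Reaches G A (k s) (k t) := fun hA h1 h2 h3 h4 =>
    reaches_seg (fun s _ hs => (hk.2 s (by omega) (s + 1) (by omega)).2 (by omega)) hA h1 h2 h3 h4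
  by_cases hcase : g = f
  · subst hcase
    have hend : G.Adj (k 0) (r i g) := hf1
    refine hθ (containsTheta_of_apart (a := r i g) (b := r i 0) (D₁ := Seg (r i) 1 (g - 1))
      (D₂ := Seg (r i) (g + 1) (n i) ∪ Seg (r l) 1 (n l))
      (D₃ := Seg k 0 m ∪ Seg (r j) 1 (n j - 1)) ?_ ?_ ?_ ?_ ?_ ?_ ?_ ?_)
    · exact (hP.apart_eq (s := 0) (by omega) (by omega)).1.symm
    · exact fun h => (hP.apart_eq (s := 0) (by omega) (by omega)).2 h.symm
    · refine hP.reaches (c := 0) (d := g) (by omega) (fun s _ hs => ?_) (by omega) le_rfl le_rfl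
        (by omega)
      rcases Nat.eq_zero_or_pos s with rfl | h0
      · simp
      · rcases hs.eq_or_lt with rfl | h1
        · simp
        · exact Or.inr (Or.inr (mem_seg (by omega) (by omega)))
    · refine Reaches.trans (y := r i (n i)) ?_ (Reaches.trans (y := r l (n l)) ?_ ?_)
      · refine hP.reaches (c := g) (d := n i) le_rfl (fun s hs hs' => ?_) le_rfl (by omega)
          (by omega) le_rfl
        rcases hs.eq_or_lt with rfl | h1
        · simp
        · exact Or.inr (Or.inr (Or.inl (mem_seg (by omega) (by omega))))
      · exact reaches_adj (Or.inr (Or.inr (Or.inl (mem_seg (by omega) (by omega)))))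
          (Or.inr (Or.inr (Or.inr (mem_seg (hpos l) le_rfl)))) (hP.adj_last hil)
      · rw [hP.apex i, ← hP.apex l]
        refine hP.reaches (c := 0) (d := n l) le_rfl (fun s hs hs' => ?_) (by omega) le_rfl
          (by omega) (by omega)
        rcases Nat.eq_zero_or_pos s with rfl | h0
        · simp
        · exact Or.inr (Or.inr (Or.inr (mem_seg (by omega) (by omega))))
    · refine Reaches.trans (y := k 0) ?_ (Reaches.trans (y := k m) ?_
        (Reaches.trans (y := r j d) ?_ ?_))
      · exact reaches_adj (by simp) (Or.inr (Or.inr (Or.inl (mem_seg le_rfl (by omega)))))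
          hend.symm
      · exact kreach (c := 0) (fun s h1 h2 => Or.inr (Or.inr (Or.inl (mem_seg h1 h2))))
          (by omega) (by omega) (by omega) le_rfl
      · exact reaches_adj (Or.inr (Or.inr (Or.inl (mem_seg (by omega) le_rfl))))
          (Or.inr (Or.inr (Or.inr (mem_seg (by omega) (by omega))))) hd1
      · rw [hP.apex i, ← hP.apex j]
        refine hP.reaches (c := 0) (d := n j - 1) (by omega) (fun s hs hs' => ?_) (by omega)
          (by omega) (by omega) (by omega)
        rcases Nat.eq_zero_or_pos s with rfl | h0
        · simp
        · exact Or.inr (Or.inr (Or.inr (mem_seg (by omega) (by omega))))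
    · refine Apart.union_right (apart_seg fun s t h1 h2 h3 h4 => hP.apart_eq (by omega) (by omega))
        (apart_seg fun s t h1 h2 h3 h4 => hP.apart_ne hil (by omega) (by omega) (by omega)
          (by omega) (by omega))
    · refine Apart.union_right (Apart.symm (apart_seg fun s t h1 h2 h3 h4 =>
        ⟨hout s h2 i t (by omega), fun e => ?_⟩))
        (apart_seg fun s t h1 h2 h3 h4 => hP.apart_ne hij (by omega) (by omega) (by omega)
          (by omega) (by omega))
      obtain rfl := hi s h2 t (by omega) e
      have := hfirst t (by omega) e
      omega
    · refine Apart.union_left (Apart.union_right (Apart.symm (apart_seg fun s t h1 h2 h3 h4 =>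
        ⟨hout s h2 i t (by omega), fun e => ?_⟩)) (apart_seg fun s t h1 h2 h3 h4 =>
          hP.apart_ne hij (by omega) (by omega) (by omega) (by omega) (by omega)))
        (Apart.union_right (Apart.symm (apart_seg fun s t h1 h2 h3 h4 =>
        ⟨hout s h2 l t (by omega), hl s h2 t h4⟩)) (apart_seg fun s t h1 h2 h3 h4 =>
          hP.apart_ne hjl.symm (by omega) (by omega) (by omega) (by omega) (by omega)))
      obtain rfl := hi s h2 t (by omega) e
      have := hfirst t (by omega) e
      omega
  by_cases hcase2 : g = f + 1
  · subst hcase2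
    refine hπ (containsPrism_of_rungs (a₁ := r i f) (a₂ := r i (f + 1)) (a₃ := k 0)
      (b₁ := r l (n l)) (b₂ := r i (n i)) (b₃ := r j (n j))
      (E₁ := Seg (r i) 0 f ∪ Seg (r l) 1 (n l)) (E₂ := Seg (r i) (f + 1) (n i))
      (E₃ := Seg k 0 m ∪ Seg (r j) 2 (n j)) (hP.adj_succ (by omega)) hf1.symm hg1.symm
      (hP.adj_last hil.symm) (hP.adj_last hjl.symm) (hP.adj_last hij)
      ?_ ?_ ?_ ?_ ?_ ?_ ?_ ?_ ?_)
    · refine Reaches.trans (y := r i 0) ?_ ?_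
      · exact hP.reaches (c := 0) (d := f) (by omega) (fun s h1 h2 => Or.inl (mem_seg h1 h2))
          (by omega) (by omega) (by omega) (by omega)
      · rw [hP.apex i, ← hP.apex l]
        refine hP.reaches (c := 0) (d := n l) (by omega) (fun s h1 h2 => ?_)
          (by omega) (by omega) (by omega) (by omega)
        rcases Nat.eq_zero_or_pos s with rfl | h0
        · rw [hP.apex l, ← hP.apex i]
          exact Or.inl (mem_seg (by omega) (by omega))
        · exact Or.inr (mem_seg (by omega) (by omega))
    · exact hP.reaches (c := f + 1) (d := n i) (by omega) (fun s h1 h2 => mem_seg h1 h2)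
          (by omega) (by omega) (by omega) (by omega)
    · refine Reaches.trans (y := k m) ?_ (Reaches.trans (y := r j d) ?_ ?_)
      · exact kreach (c := 0) (fun s h1 h2 => Or.inl (mem_seg h1 h2))
          (by omega) (by omega) (by omega) le_rfl
      · exact reaches_adj (Or.inl (mem_seg (by omega) le_rfl))
          (Or.inr (mem_seg (by omega) (by omega))) hd1
      · exact hP.reaches (c := 2) (d := n j) le_rfl (fun s h1 h2 => Or.inr (mem_seg h1 h2))
          (by omega) (by omega) (by omega) (by omega)
    · refine Rungs.union_left (rungs_seg fun s t h1 h2 h3 h4 => ?_)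
        (rungs_seg fun s t h1 h2 h3 h4 => ?_)
      · by_cases h : s = f ∧ t = f + 1
        · obtain ⟨rfl, rfl⟩ := h
          exact ⟨(hP.adj_succ (by omega)).ne, fun _ => Or.inl ⟨rfl, rfl⟩⟩
        · have := hP.apart_eq (i := i) (s := s) (t := t) (by omega) (by omega)
          exact ⟨this.1, fun e => (this.2 e).elim⟩
      · by_cases h : s = n l ∧ t = n i
        · obtain ⟨rfl, rfl⟩ := h
          exact ⟨(hP.adj_last hil.symm).ne, fun _ => Or.inr ⟨rfl, rfl⟩⟩
        · have := hP.apart_ne hil.symm (s := s) (t := t) (by omega) (by omega) (by omega)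
            (by omega) h
          exact ⟨this.1, fun e => (this.2 e).elim⟩
    · refine Rungs.union_left (Rungs.union_right (Rungs.symm (rungs_seg fun s t h1 h2 h3 h4 => ?_))
        (rungs_seg fun s t h1 h2 h3 h4 => ?_)) (Rungs.union_right (Apart.rungs (Apart.symm
          (apart_seg fun s t h1 h2 h3 h4 => ⟨hout s h2 l t (by omega), hl s h2 t h4⟩)) _ _ _ _)
          (rungs_seg fun s t h1 h2 h3 h4 => ?_))
      · refine ⟨hout s h2 i t (by omega), fun e => ?_⟩
        obtain rfl := hi s h2 t (by omega) e
        have := hfirst t (by omega) e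
        obtain rfl : t = f := by omega
        exact Or.inl ⟨rfl, rfl⟩
      · have := hP.apart_ne hij (s := s) (t := t) (by omega) (by omega) (by omega)
            (by omega) (by omega)
        exact ⟨this.1, fun e => (this.2 e).elim⟩
      · by_cases h : s = n l ∧ t = n j
        · obtain ⟨rfl, rfl⟩ := h
          exact ⟨(hP.adj_last hjl.symm).ne, fun _ => Or.inr ⟨rfl, rfl⟩⟩
        · have := hP.apart_ne hjl.symm (s := s) (t := t) (by omega) (by omega) (by omega)
            (by omega) h
          exact ⟨this.1, fun e => (this.2 e).elim⟩
    · refine Rungs.union_right (Rungs.symm (rungs_seg fun s t h1 h2 h3 h4 => ?_))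
        (rungs_seg fun s t h1 h2 h3 h4 => ?_)
      · refine ⟨hout s h2 i t (by omega), fun e => ?_⟩
        obtain rfl := hi s h2 t (by omega) e
        have := hfirst t (by omega) e
        obtain rfl : t = f + 1 := by omega
        exact Or.inl ⟨rfl, rfl⟩
      · by_cases h : s = n i ∧ t = n j
        · obtain ⟨rfl, rfl⟩ := h
          exact ⟨(hP.adj_last hij).ne, fun _ => Or.inr ⟨rfl, rfl⟩⟩
        · have := hP.apart_ne hij (s := s) (t := t) (by omega) (by omega) (by omega)
            (by omega) h
          exact ⟨this.1, fun e => (this.2 e).elim⟩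
    · exact (hP.apart_ne hil (by omega) le_rfl (by omega) (by have := hpos l; omega) (by omega)).1
    · intro e
      have := hP.inj i i _ _ (by omega) le_rfl e
      have := hP.apart_ne hil (s := f + 1) (t := 0) (by omega) (by omega) (by omega) (by omega)
      omega
    · exact fun e => (hout 0 (by omega) j (n j) le_rfl e).elim
  · refine hθ (containsTheta_of_apart (a := k 0) (b := r i 0) (D₁ := Seg (r i) 1 f)
      (D₂ := Seg (r i) g (n i) ∪ Seg (r l) 1 (n l))
      (D₃ := Seg k 1 m ∪ Seg (r j) 1 (n j - 1)) ?_ ?_ ?_ ?_ ?_ ?_ ?_ ?_)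
    · exact hout 0 (by omega) i 0 (by omega)
    · exact (hav 0 (by omega) i).1
    · refine Reaches.trans (y := r i f) ?_ ?_
      · exact reaches_adj (by simp) (Or.inr (Or.inr (mem_seg (by omega) (by omega)))) hf1
      · refine hP.reaches (c := 0) (d := f) (by omega) (fun s _ hs => ?_) (by omega) le_rfl le_rfl
          (by omega)
        rcases Nat.eq_zero_or_pos s with rfl | h0
        · simp
        · exact Or.inr (Or.inr (mem_seg (by omega) (by omega)))
    · refine Reaches.trans (y := r i g) ?_ (Reaches.trans (y := r i (n i)) ?_
        (Reaches.trans (y := r l (n l)) ?_ ?_))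
      · exact reaches_adj (by simp) (Or.inr (Or.inr (Or.inl (mem_seg (by omega) (by omega))))) hg1
      · refine hP.reaches (c := g) (d := n i) le_rfl (fun s hs hs' => ?_) le_rfl (by omega)
          (by omega) le_rfl
        exact Or.inr (Or.inr (Or.inl (mem_seg (by omega) (by omega))))
      · exact reaches_adj (Or.inr (Or.inr (Or.inl (mem_seg (by omega) (by omega)))))
          (Or.inr (Or.inr (Or.inr (mem_seg (hpos l) le_rfl)))) (hP.adj_last hil)
      · rw [hP.apex i, ← hP.apex l]
        refine hP.reaches (c := 0) (d := n l) le_rfl (fun s hs hs' => ?_) (by omega) le_rfl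
          (by omega) (by omega)
        rcases Nat.eq_zero_or_pos s with rfl | h0
        · simp
        · exact Or.inr (Or.inr (Or.inr (mem_seg (by omega) (by omega))))
    · refine Reaches.trans (y := k m) ?_ (Reaches.trans (y := r j d) ?_ ?_)
      · refine kreach (c := 0) (fun s h1 h2 => ?_) (by omega) (by omega) (by omega) le_rfl
        rcases Nat.eq_zero_or_pos s with rfl | h0
        · simp
        · exact Or.inr (Or.inr (Or.inl (mem_seg h0 h2)))
      · refine reaches_adj ?_ (Or.inr (Or.inr (Or.inr (mem_seg (by omega) (by omega))))) hd1
        rcases Nat.eq_zero_or_pos m with rfl | h0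
        · simp
        · exact Or.inr (Or.inr (Or.inl (mem_seg h0 le_rfl)))
      · rw [hP.apex i, ← hP.apex j]
        refine hP.reaches (c := 0) (d := n j - 1) (by omega) (fun s hs hs' => ?_) (by omega)
          (by omega) (by omega) (by omega)
        rcases Nat.eq_zero_or_pos s with rfl | h0
        · simp
        · exact Or.inr (Or.inr (Or.inr (mem_seg (by omega) (by omega))))
    · refine Apart.union_right (apart_seg fun s t h1 h2 h3 h4 => hP.apart_eq (by omega) (by omega))
        (apart_seg fun s t h1 h2 h3 h4 => hP.apart_ne hil (by omega) (by omega) (by omega)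
          (by omega) (by omega))
    · refine Apart.union_right (Apart.symm (apart_seg fun s t h1 h2 h3 h4 =>
        ⟨hout s h2 i t (by omega), fun e => ?_⟩))
        (apart_seg fun s t h1 h2 h3 h4 => hP.apart_ne hij (by omega) (by omega) (by omega)
          (by omega) (by omega))
      have := hi s h2 t (by omega) e
      omega
    · refine Apart.union_left (Apart.union_right (Apart.symm (apart_seg fun s t h1 h2 h3 h4 =>
        ⟨hout s h2 i t (by omega), fun e => ?_⟩)) (apart_seg fun s t h1 h2 h3 h4 =>
          hP.apart_ne hij (by omega) (by omega) (by omega) (by omega) (by omega)))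
        (Apart.union_right (Apart.symm (apart_seg fun s t h1 h2 h3 h4 =>
        ⟨hout s h2 l t (by omega), hl s h2 t h4⟩)) (apart_seg fun s t h1 h2 h3 h4 =>
          hP.apart_ne hjl.symm (by omega) (by omega) (by omega) (by omega) (by omega)))
      have := hi s h2 t (by omega) e
      omega

lemma Pyr.containsTheta_of_adj_all (hP : Pyr G a r n) {x : V}
    (hout : ∀ i, ∀ t ≤ n i, x ≠ r i t)
    (hav : ∀ i, ¬ G.Adj x (r i 0) ∧ ¬ G.Adj x (r i (n i)))
    (h : ∀ i, ∃ t ≤ n i, G.Adj x (r i t)) : ContainsTheta G := by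
  choose f hf hadj using h
  have hf1 : ∀ i, 1 ≤ f i := fun i => by
    by_contra h'
    have := hadj i
    rw [show f i = 0 by omega] at this
    exact (hav i).1 this
  have hf2 : ∀ i, f i < n i := fun i => by
    refine lt_of_le_of_ne (hf i) fun h' => ?_
    have := hadj i
    rw [h'] at this
    exact (hav i).2 this
  have hreach : ∀ i, Reaches G (insert x (insert a (Seg (r i) 1 (f i)))) x a := fun i => by
    refine Reaches.trans (y := r i (f i)) ?_ ?_
    · exact reaches_adj (by simp) (Or.inr (Or.inr (mem_seg (hf1 i) le_rfl))) (hadj i)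
    · rw [← hP.apex i]
      refine hP.reaches (c := 0) (d := f i) (hf i) (fun s _ hs => ?_) (by omega) le_rfl le_rfl
        (by omega)
      rcases Nat.eq_zero_or_pos s with rfl | h0
      · simp
      · exact Or.inr (Or.inr (mem_seg h0 hs))
  have hap : ∀ i j, i ≠ j → Apart G (Seg (r i) 1 (f i)) (Seg (r j) 1 (f j)) := fun i j hij =>
    apart_seg fun s t h1 h2 h3 h4 => by
      have := hf2 i
      have := hf2 j
      exact hP.apart_ne hij (by omega) (by omega) (by omega) (by omega) (by omega)
  refine containsTheta_of_apart (a := x) (b := a) ?_ ?_ (hreach 0) (hreach 1) (hreach 2)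
    (hap 0 1 (by decide)) (hap 0 2 (by decide)) (hap 1 2 (by decide))
  · rw [← hP.apex 0]
    exact hout 0 0 (by omega)
  · rw [← hP.apex 0]
    exact (hav 0).1

lemma Pyr.not_touch_two (hP : Pyr G a r n) (hθ : ¬ ContainsTheta G) (hπ : ¬ ContainsPrism G)
    {K : Set V} (hK : Linked G K)
    (hav : ∀ i, ¬ Touch G K (r i 0) ∧ ¬ Touch G K (r i 1) ∧ ¬ Touch G K (r i (n i)))
    {i j : Fin 3} (hij : i ≠ j) {s t : ℕ} (hs : s ≤ n i) (ht : t ≤ n j)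
    (h₁ : Touch G K (r i s)) (h₂ : Touch G K (r j t)) : False := by
  let T : V → Fin 3 → Prop := fun x i => ∃ s ≤ n i, x = r i s ∨ G.Adj x (r i s)
  obtain ⟨x, hx, hx'⟩ := h₁
  obtain ⟨y, hy, hy'⟩ := h₂
  obtain ⟨k, m, hk, hkK, hR, hmin⟩ := exists_min_seq
    (fun x y => ∃ i j, i ≠ j ∧ T x i ∧ T y j) hK ⟨x, hx, y, hy, i, j, hij, ⟨s, hs, hx'⟩, t, ht, hy'⟩
  clear hx' hy' hs ht s t hij i j
  have hout : ∀ s ≤ m, ∀ i, ∀ t ≤ n i, k s ≠ r i t := by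
    intro s hs i t ht e
    have hT : T (k s) i := ⟨t, ht, Or.inl e⟩
    have ht2 : 2 ≤ t ∧ t < n i := by
      refine ⟨?_, ?_⟩
      · by_contra h
        have h : t = 0 ∨ t = 1 := by omega
        rcases h with rfl | rfl
        · exact (hav i).1 ⟨k s, hkK s hs, Or.inl e⟩
        · exact (hav i).2.1 ⟨k s, hkK s hs, Or.inl e⟩
      · refine lt_of_le_of_ne ht ?_
        rintro rfl
        exact (hav i).2.2 ⟨k s, hkK s hs, Or.inl e⟩
    have own : ∀ i', T (k s) i' → i' = i := by
      rintro i' ⟨t', ht', h | h⟩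
      · rcases hP.inj i i' t t' ht ht' (e.symm.trans h) with h | h
        · exact h.1.symm
        · omega
      · rw [e] at h
        by_contra hne
        exact (hP.apart_ne (Ne.symm hne) ht ht' (by omega) (by omega) (by omega)).2 h
    obtain ⟨i₀, j₀, h₀, hi₀, hj₀⟩ := hR
    rcases Nat.eq_zero_or_pos m with rfl | hm
    · obtain rfl : s = 0 := by omega
      exact h₀ ((own _ hi₀).trans (own _ hj₀).symm)
    rcases Nat.eq_zero_or_pos s with rfl | hs0
    · have h1 : T (k 1) i :=
        ⟨t, ht, Or.inr (e ▸ (hk.2 1 (by omega) 0 (by omega)).2 (by omega))⟩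
      have := hmin 1 (by omega) m le_rfl ⟨i, j₀, own _ hi₀ ▸ h₀, h1, hj₀⟩
      omega
    rcases hs.eq_or_lt with rfl | hsm
    · have h1 : T (k (s - 1)) i :=
        ⟨t, ht, Or.inr (e ▸ (hk.2 (s - 1) (by omega) s (by omega)).2 (by omega))⟩
      have := hmin 0 (by omega) (s - 1) (by omega) ⟨i₀, i, own _ hj₀ ▸ h₀, hi₀, h1⟩
      omega
    by_cases h : i₀ = i
    · have := hmin s (by omega) m le_rfl ⟨i, j₀, h ▸ h₀, hT, hj₀⟩
      omega
    · have := hmin 0 (by omega) s (by omega) ⟨i₀, i, h, hi₀, hT⟩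
      omega
  have hT : ∀ s ≤ m, ∀ i, T (k s) i → ∃ t ≤ n i, G.Adj (k s) (r i t) := by
    rintro s hs i ⟨t, ht, h | h⟩
    · exact (hout s hs i t ht h).elim
    · exact ⟨t, ht, h⟩
  have hav' : ∀ s ≤ m, ∀ i, ¬ G.Adj (k s) (r i 0) ∧ ¬ G.Adj (k s) (r i 1) ∧
      ¬ G.Adj (k s) (r i (n i)) := fun s hs i =>
    ⟨fun h => (hav i).1 ⟨k s, hkK s hs, Or.inr h⟩, fun h => (hav i).2.1 ⟨k s, hkK s hs, Or.inr h⟩,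
      fun h => (hav i).2.2 ⟨k s, hkK s hs, Or.inr h⟩⟩
  obtain ⟨i, j, hij, hi, hj⟩ := hR
  obtain ⟨l, hil, hjl⟩ : ∃ l, i ≠ l ∧ j ≠ l := by
    clear hi hj hij
    revert i j
    decide
  by_cases hl : m = 0 ∧ T (k 0) l
  · obtain ⟨rfl, hl⟩ := hl
    refine hθ (hP.containsTheta_of_adj_all (x := k 0) (hout 0 le_rfl)
      (fun i => ⟨(hav' 0 le_rfl i).1, (hav' 0 le_rfl i).2.2⟩) fun i' => ?_)
    apply hT 0 le_rfl
    have : i' = i ∨ i' = j ∨ i' = l := by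
      clear hi hj hl hT
      revert i j l i'
      decide
    rcases this with rfl | rfl | rfl <;> assumption
  · refine hP.false_of_seq hθ hπ hk hij hil hjl hout hav' ?_ (hT 0 (by omega) i hi) ?_
      (hT m le_rfl j hj) ?_
    · intro s hs t ht h
      have := hmin s hs m le_rfl ⟨i, j, hij, ⟨t, ht, Or.inr h⟩, hj⟩
      omega
    · intro s hs t ht h
      have := hmin 0 (by omega) s hs ⟨i, j, hij, hi, ⟨t, ht, Or.inr h⟩⟩
      omega
    · intro s hs t ht h
      have h1 := hmin 0 (by omega) s hs ⟨i, l, hil, hi, ⟨t, ht, Or.inr h⟩⟩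
      have h2 := hmin s hs m le_rfl ⟨l, j, hjl.symm, ⟨t, ht, Or.inr h⟩, hj⟩
      obtain rfl : s = 0 := by omega
      exact hl ⟨by omega, t, ht, Or.inr h⟩

end Pyramids

section Holes

variable {G : SimpleGraph V} {h : ℕ → V} {n : ℕ}

/-- The sequence `h`, restricted to `{0, …, n - 1}`, is a hole. -/
structure Hole (G : SimpleGraph V) (h : ℕ → V) (n : ℕ) : Prop where
  four : 4 ≤ n
  inj : ∀ i < n, ∀ j < n, h i = h j → i = j
  adj : ∀ i < n, ∀ j < n, (G.Adj (h i) (h j) ↔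
    i + 1 = j ∨ j + 1 = i ∨ (i = 0 ∧ j + 1 = n) ∨ (j = 0 ∧ i + 1 = n))

/-- Rotation of a cyclic sequence. -/
def rotSeq (h : ℕ → V) (n c : ℕ) : ℕ → V := fun i => if i + c < n then h (i + c) else h (i + c - n)

/-- Reflection of a cyclic sequence. -/
def flipSeq (h : ℕ → V) (n : ℕ) : ℕ → V := fun i => if i = 0 then h 0 else h (n - i)

lemma rotSeq_of_lt {c i : ℕ} (hi : i + c < n) : rotSeq h n c i = h (i + c) := if_pos hi

lemma rotSeq_of_ge {c i : ℕ} (hi : n ≤ i + c) : rotSeq h n c i = h (i + c - n) := if_neg (by omega)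

lemma exists_eq_rot {c : ℕ} (hc : c < n) {i : ℕ} (hi : i < n) : ∃ j < n, rotSeq h n c i = h j := by
  by_cases hic : i + c < n
  · exact ⟨i + c, hic, rotSeq_of_lt hic⟩
  · exact ⟨i + c - n, by omega, rotSeq_of_ge (by omega)⟩

lemma flipSeq_of_pos {i : ℕ} (hi : 0 < i) : flipSeq h n i = h (n - i) := if_neg (by omega)

lemma flipSeq_zero : flipSeq h n 0 = h 0 := if_pos rfl

lemma exists_eq_flip {i : ℕ} (hi : i < n) : ∃ j < n, flipSeq h n i = h j := by
  rcases Nat.eq_zero_or_pos i with rfl | h0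
  · exact ⟨0, hi, flipSeq_zero⟩
  · exact ⟨n - i, by omega, flipSeq_of_pos h0⟩

lemma Hole.rot (H : Hole G h n) {c : ℕ} (hc : c < n) : Hole G (rotSeq h n c) n := by
  have h4 := H.four
  refine ⟨H.four, fun i hi j hj => ?_, fun i hi j hj => ?_⟩
  · unfold Paper.rotSeq
    split_ifs <;> intro e <;> have := H.inj _ (by omega) _ (by omega) e <;> omega
  · unfold Paper.rotSeq
    split_ifs <;> rw [H.adj _ (by omega) _ (by omega)] <;> omega

lemma Hole.flip (H : Hole G h n) : Hole G (flipSeq h n) n := by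
  have h4 := H.four
  refine ⟨H.four, fun i hi j hj => ?_, fun i hi j hj => ?_⟩
  · unfold Paper.flipSeq
    split_ifs <;> intro e <;> have := H.inj _ (by omega) _ (by omega) e <;> omega
  · unfold Paper.flipSeq
    split_ifs <;> rw [H.adj _ (by omega) _ (by omega)] <;> omega

lemma Hole.apart (H : Hole G h n) {i j : ℕ} (hi : i < n) (hj : j < n) (hne : i ≠ j)
    (h₁ : i + 1 ≠ j) (h₂ : j + 1 ≠ i) (h₃ : ¬ (i = 0 ∧ j + 1 = n)) (h₄ : ¬ (j = 0 ∧ i + 1 = n)) :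
    h i ≠ h j ∧ ¬ G.Adj (h i) (h j) := by
  refine ⟨fun e => hne (H.inj i hi j hj e), fun e => ?_⟩
  rcases (H.adj i hi j hj).1 e with h | h | h | h <;> tauto

lemma Hole.apart_segs (H : Hole G h n) {a b c d : ℕ} (hb : b + 1 < c) (hd : d < n)
    (hw : ¬ (a = 0 ∧ d + 1 = n)) : Apart G (Seg h a b) (Seg h c d) :=
  apart_seg fun s t _ _ _ _ => H.apart (by omega) (by omega) (by omega) (by omega)
    (by omega) (by omega) (by omega)

lemma Hole.adj_succ (H : Hole G h n) {i : ℕ} (hi : i + 1 < n) : G.Adj (h i) (h (i + 1)) :=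
  (H.adj i (by omega) (i + 1) hi).2 (Or.inl rfl)

lemma Hole.adj_last (H : Hole G h n) : G.Adj (h (n - 1)) (h 0) := by
  have h4 := H.four
  exact (H.adj (n - 1) (by omega) 0 (by omega)).2 (by omega)

lemma Hole.reaches (H : Hole G h n) {A : Set V} {c d s t : ℕ} (hd : d < n)
    (hA : ∀ s, c ≤ s → s ≤ d → h s ∈ A) (hs : c ≤ s) (hs' : s ≤ d) (ht : c ≤ t) (ht' : t ≤ d) :
    Reaches G A (h s) (h t) :=
  reaches_seg (fun _ _ h2 => H.adj_succ (by omega)) hA hs hs' ht ht'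

lemma IsSeq.reaches {k : ℕ → V} {m : ℕ} (hk : IsSeq G k m) {A : Set V} {c d s t : ℕ} (hd : d ≤ m)
    (hA : ∀ s, c ≤ s → s ≤ d → k s ∈ A) (hs : c ≤ s) (hs' : s ≤ d) (ht : c ≤ t) (ht' : t ≤ d) :
    Reaches G A (k s) (k t) :=
  reaches_seg (fun s _ h2 => (hk.2 s (by omega) (s + 1) (by omega)).2 (by omega)) hA hs hs' ht ht'

lemma IsSeq.linked {k : ℕ → V} {m : ℕ} (hk : IsSeq G k m) : Linked G (Seg k 0 m) := by
  rintro _ ⟨s, _, hs, rfl⟩ _ ⟨t, _, ht, rfl⟩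
  exact hk.reaches (c := 0) le_rfl (fun s h1 h2 => mem_seg h1 h2) (by omega) hs (by omega) ht

/-- A hole together with an induced path from a neighbor of `h 0` to a vertex adjacent to
`h e` and `h (e + 1)` is a pyramid. -/
lemma Hole.pyr (H : Hole G h n) {k : ℕ → V} {m : ℕ} (hk : IsSeq G k m)
    (hkh : ∀ s ≤ m, ∀ i < n, k s ≠ h i) {e : ℕ} (he : 2 ≤ e) (hen : e + 2 < n)
    (hadj : ∀ s ≤ m, ∀ i < n, G.Adj (k s) (h i) ↔
      (s = 0 ∧ i = 0) ∨ (s = m ∧ (i = e ∨ i = e + 1))) :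
    Pyr G (h 0) ![h, flipSeq h n, fun i => if i = 0 then h 0 else k (i - 1)]
      ![e, n - (e + 1), m + 1] := by
  have hadj' : ∀ s ≤ m, ∀ i < n, G.Adj (h i) (k s) ↔
      (s = 0 ∧ i = 0) ∨ (s = m ∧ (i = e ∨ i = e + 1)) := fun s hs i hi => by
    rw [G.adj_comm, hadj s hs i hi]
  have h4 := H.four
  refine ⟨?_, ?_, ?_, ?_, ?_⟩
  · intro i
    fin_cases i <;> simp <;> omega
  · intro i j hij
    fin_cases i <;> fin_cases j <;> simp at hij ⊢ <;> omega
  · intro i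
    fin_cases i <;> simp [flipSeq]
  · intro i j s t hs ht
    fin_cases i <;> fin_cases j <;> simp [flipSeq] at hs ht ⊢ <;> (try split_ifs) <;> intro e <;>
      first
      | omega
      | (have := H.inj _ (by omega) _ (by omega) e; omega)
      | (have := hk.1 _ (by omega) _ (by omega) e; omega)
      | (exact (hkh _ (by omega) _ (by omega) e).elim)
      | (exact (hkh _ (by omega) _ (by omega) e.symm).elim)
  · intro i j s t hs ht
    fin_cases i <;> fin_cases j <;> simp [flipSeq] at hs ht ⊢ <;> (try split_ifs) <;>
      first
      | (rw [H.adj _ (by omega) _ (by omega)]; omega)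
      | (rw [hk.2 _ (by omega) _ (by omega)]; omega)
      | (rw [hadj _ (by omega) _ (by omega)]; omega)
      | (rw [hadj' _ (by omega) _ (by omega)]; omega)

lemma Hole.not_touch_two (H : Hole G h n) (hθ : ¬ ContainsTheta G) (hπ : ¬ ContainsPrism G)
    {k : ℕ → V} {m : ℕ} (hk : IsSeq G k m) (hkh : ∀ s ≤ m, ∀ i < n, k s ≠ h i) {e : ℕ}
    (he : 2 ≤ e) (hen : e + 2 < n)
    (hadj : ∀ s ≤ m, ∀ i < n, G.Adj (k s) (h i) ↔
      (s = 0 ∧ i = 0) ∨ (s = m ∧ (i = e ∨ i = e + 1)))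
    {K : Set V} (hK : Linked G K) (h0 : ¬ Touch G K (h 0)) (h1 : ¬ Touch G K (h 1))
    (hn : ¬ Touch G K (h (n - 1))) (hk0 : ¬ Touch G K (k 0)) (hke : ¬ Touch G K (k m))
    (hee : ¬ Touch G K (h e)) (hee' : ¬ Touch G K (h (e + 1)))
    {i j : ℕ} (hi : i ≤ e) (hj : e < j) (hjn : j < n) (hTi : Touch G K (h i))
    (hTj : Touch G K (h j)) : False := by
  refine (H.pyr hk hkh he hen hadj).not_touch_two hθ hπ hK ?_ (i := 0) (j := 1) (by decide)
    (s := i) (t := n - j) hi ?_ hTi ?_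
  · intro l
    fin_cases l
    · exact ⟨h0, h1, hee⟩
    · refine ⟨?_, ?_, ?_⟩ <;> simp [flipSeq]
      · exact h0
      · exact hn
      · rw [if_neg (by omega), show n - (n - (e + 1)) = e + 1 by omega]
        exact hee'
    · exact ⟨by simpa using h0, by simpa using hk0, by simpa using hke⟩
  · simp
    omega
  · simp only [Matrix.cons_val_one, Matrix.cons_val_zero]
    rw [flipSeq_of_pos (by omega), show n - (n - j) = j by omega]
    exact hTj

end Holes

section Wheels

variable {G : SimpleGraph V} {h : ℕ → V} {n : ℕ}

lemma isSeq_const (v : V) : IsSeq G (fun _ => v) 0 :=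
  ⟨fun i hi j hj _ => by omega, fun i hi j hj => by simp; omega⟩

lemma Apart.singleton_right {A : Set V} {v : V} (hA : ∀ x ∈ A, x ≠ v ∧ ¬ G.Adj x v) :
    Apart G A {v} := by
  rintro x hx _ rfl
  exact hA x hx

lemma Hole.exists_nbr_of_sector (H : Hole G h n) (hθ : ¬ ContainsTheta G)
    (hπ : ¬ ContainsPrism G) {v : V} (hv : ∀ i < n, v ≠ h i) {e : ℕ} (hen : e < n)
    (hv0 : G.Adj v (h 0)) (hve : G.Adj v (h e)) (hno : ∀ i, 0 < i → i < e → ¬ G.Adj v (h i))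
    {K : Set V} (hK : Linked G K) (hKv : ¬ Touch G K v)
    (hav : ∀ i < n, G.Adj v (h i) → ∀ j < n, (j = i ∨ G.Adj (h i) (h j)) → ¬ Touch G K (h j))
    (hi : ∃ i, 0 < i ∧ i < e ∧ Touch G K (h i)) (hj : ∃ j, e < j ∧ j < n ∧ Touch G K (h j)) :
    ∃ p, e + 2 ≤ p ∧ p + 2 ≤ n ∧ G.Adj v (h p) := by
  by_contra hno2
  push Not at hno2
  obtain ⟨i, hi0, hie, hTi⟩ := hi
  obtain ⟨j, hej, hjn, hTj⟩ := hj
  have h4 := H.four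
  have hadjv : ∀ i < n, i ≠ e + 1 → i + 1 ≠ n → (G.Adj v (h i) ↔ i = 0 ∨ i = e) := by
    intro i hi h1 h2
    constructor
    · intro hadj
      rcases Nat.lt_or_ge i (e + 2) with h3 | h3
      · by_contra h'
        exact hno i (by omega) (by omega) hadj
      · exact (hno2 i h3 (by omega) hadj).elim
    · rintro (rfl | rfl) <;> assumption
  have t0 : ¬ Touch G K (h 0) := hav 0 (by omega) hv0 _ (by omega) (Or.inl rfl)
  have t1 : ¬ Touch G K (h 1) :=
    hav 0 (by omega) hv0 _ (by omega) (Or.inr (H.adj_succ (by omega)))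
  have tn : ¬ Touch G K (h (n - 1)) :=
    hav 0 (by omega) hv0 _ (by omega) (Or.inr H.adj_last.symm)
  have te : ¬ Touch G K (h e) := hav e (by omega) hve _ (by omega) (Or.inl rfl)
  have te1 : ¬ Touch G K (h (e + 1)) :=
    hav e (by omega) hve _ (by omega) (Or.inr (H.adj_succ (by omega)))
  have ne_of : ∀ {s t}, Touch G K (h s) → ¬ Touch G K (h t) → s ≠ t := by
    rintro s t h1 h2 rfl
    exact h2 h1
  have hi1 := ne_of hTi t1
  have hj1 := ne_of hTj te1
  have hj2 := ne_of hTj tn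
  by_cases c1 : G.Adj v (h (e + 1)) <;> by_cases c2 : G.Adj v (h (n - 1))
  · have ap : ∀ s t, s ≤ e → e < t → t < n → h s ≠ h t ∧ (G.Adj (h s) (h t) →
        (h s = h 0 ∧ h t = h (n - 1)) ∨ (h s = h e ∧ h t = h (e + 1))) := by
      intro s t h1 h2 h3
      refine ⟨fun e => ?_, fun ha => ?_⟩
      · have := H.inj _ (by omega) _ h3 e
        omega
      · rcases (H.adj s (by omega) t h3).1 ha with h | h | h | h
        · right
          rw [show s = e by omega, show t = e + 1 by omega]
          simp
        · omega
        · left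
          rw [h.1, show t = n - 1 by omega]
          simp
        · omega
    refine hπ (containsPrism_of_rungs (a₁ := h 0) (a₂ := h (n - 1)) (a₃ := v)
      (b₁ := h e) (b₂ := h (e + 1)) (b₃ := v)
      (E₁ := Seg h 0 e) (E₂ := Seg h (e + 1) (n - 1)) (E₃ := {v})
      H.adj_last.symm hv0.symm c2.symm (H.adj_succ (by omega)) hve.symm c1.symm
      ?_ ?_ (reaches_refl rfl) ?_ ?_ ?_ ?_ ?_ ?_)
    · exact H.reaches (c := 0) (d := e) (by omega) (fun s h1 h2 => mem_seg h1 h2)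
        (by omega) (by omega) (by omega) (by omega)
    · exact H.reaches (c := e + 1) (d := n - 1) (by omega) (fun s h1 h2 => mem_seg h1 h2)
        (by omega) (by omega) (by omega) (by omega)
    · exact rungs_seg fun s t h1 h2 h3 h4 => ap s t (by omega) (by omega) (by omega)
    · rintro _ ⟨s, h1, h2, rfl⟩ _ rfl
      refine ⟨(hv s (by omega)).symm, fun ha => ?_⟩
      rcases (hadjv s (by omega) (by omega) (by omega)).1 ha.symm with rfl | rfl <;> simp
    · rintro _ ⟨s, h1, h2, rfl⟩ _ rfl
      refine ⟨(hv s (by omega)).symm, fun ha => ?_⟩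
      by_cases h5 : s = e + 1
      · subst h5; simp
      by_cases h6 : s + 1 = n
      · have : s = n - 1 := by omega
        subst this; simp
      rcases (hadjv s (by omega) h5 h6).1 ha.symm with rfl | rfl <;> omega
    · exact (H.apart (by omega) (by omega) (by omega) (by omega) (by omega) (by omega)
        (by omega)).1
    · exact (H.apart (by omega) (by omega) (by omega) (by omega) (by omega) (by omega)
        (by omega)).1
    · exact fun _ => ⟨(H.apart (by omega) (by omega) (by omega) (by omega) (by omega) (by omega)
        (by omega)).2, (H.apart (by omega) (by omega) (by omega) (by omega) (by omega) (by omega)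
        (by omega)).2⟩
  · refine H.not_touch_two hθ hπ (isSeq_const v) (fun _ _ => hv) (e := e) (by omega) (by omega) ?_
      hK t0 t1 tn hKv hKv te te1 (i := i) (j := j) (by omega) hej hjn hTi hTj
    intro s hs i hi
    by_cases h5 : i = e + 1
    · subst h5
      simp [c1]
      omega
    by_cases h6 : i + 1 = n
    · have : i = n - 1 := by omega
      subst this
      simp [c2]
      omega
    rw [hadjv i hi h5 h6]
    omega
  · have r0 : rotSeq h n e 0 = h e := by rw [rotSeq_of_lt (by omega), Nat.zero_add]
    have r1 : rotSeq h n e 1 = h (e + 1) := by rw [rotSeq_of_lt (by omega), Nat.add_comm]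
    have r2 : rotSeq h n e (n - 1) = h (e - 1) := by
      rw [rotSeq_of_ge (by omega)]; congr 1; omega
    have r3 : rotSeq h n e (n - e - 1) = h (n - 1) := by
      rw [rotSeq_of_lt (by omega)]; congr 1; omega
    have r4 : rotSeq h n e (n - e - 1 + 1) = h 0 := by
      rw [rotSeq_of_ge (by omega)]; congr 1; omega
    refine (H.rot (c := e) (by omega)).not_touch_two hθ hπ (isSeq_const v)
      (fun _ _ i hi hvi => ?_) (e := n - e - 1) (by omega) (by omega) ?_
      hK (r0 ▸ te) (r1 ▸ te1) ?_ hKv hKv (r3 ▸ tn) (r4 ▸ t0) (i := j - e) (j := i + n - e)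
      (by omega) (by omega) (by omega) ?_ ?_
    · obtain ⟨j, hj, e⟩ := exists_eq_rot (h := h) (c := e) (by omega) hi
      exact hv j hj (hvi.trans e)
    · intro s hs i hi
      by_cases hi' : i + e < n
      · rw [rotSeq_of_lt hi']
        by_cases h6 : i + e + 1 = n
        · rw [show i + e = n - 1 by omega]
          simp [c2]
          omega
        by_cases h5 : i = 1
        · subst h5
          rw [Nat.add_comm 1 e]
          simp [c1]
          omega
        · rw [hadjv _ hi' (by omega) h6]
          omega
      · rw [rotSeq_of_ge (by omega), hadjv _ (by omega) (by omega) (by omega)]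
        omega
    · rw [r2]
      exact hav e (by omega) hve _ (by omega) (Or.inr ((H.adj _ (by omega) _ (by omega)).2
        (by omega)))
    · rw [rotSeq_of_lt (by omega), show j - e + e = j by omega]
      exact hTj
    · rw [rotSeq_of_ge (by omega), show i + n - e + e - n = i by omega]
      exact hTi
  · have hadjv : ∀ i < n, (G.Adj v (h i) ↔ i = 0 ∨ i = e) := by
      intro i hi
      by_cases h5 : i = e + 1
      · subst h5
        simp [c1]
      by_cases h6 : i + 1 = n
      · have : i = n - 1 := by omega
        subst this
        simp [c2]
        omega
      exact hadjv i hi h5 h6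
    refine hθ (containsTheta_of_apart (a := h 0) (b := h e) (D₁ := Seg h 1 (e - 1))
      (D₂ := Seg h (e + 1) (n - 1)) (D₃ := {v}) ?_ ?_ ?_ ?_ ?_ ?_ ?_ ?_)
    · exact (H.apart (by omega) (by omega) (by omega) (by omega) (by omega) (by omega)
        (by omega)).1
    · exact (H.apart (by omega) (by omega) (by omega) (by omega) (by omega) (by omega)
        (by omega)).2
    · refine H.reaches (c := 0) (d := e) (by omega) (fun s h1 h2 => ?_)
        (by omega) (by omega) (by omega) (by omega)
      rcases Nat.eq_zero_or_pos s with rfl | h0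
      · simp
      · rcases h2.eq_or_lt with rfl | h2
        · simp
        · exact Or.inr (Or.inr (mem_seg (by omega) (by omega)))
    · refine Reaches.trans (y := h (n - 1)) ?_ (Reaches.symm ?_)
      · exact reaches_adj (by simp) (Or.inr (Or.inr (mem_seg (by omega) (by omega))))
          H.adj_last.symm
      · refine H.reaches (c := e) (d := n - 1) (by omega) (fun s h1 h2 => ?_)
          (by omega) (by omega) (by omega) (by omega)
        rcases h1.eq_or_lt with rfl | h1
        · simp
        · exact Or.inr (Or.inr (mem_seg (by omega) (by omega)))
    · exact (reaches_adj (by simp) (by simp) hv0.symm).trans (reaches_adj (by simp) (by simp) hve)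
    · exact H.apart_segs (by omega) (by omega) (by omega)
    · refine Apart.singleton_right ?_
      rintro _ ⟨s, h1, h2, rfl⟩
      refine ⟨(hv s (by omega)).symm, fun ha => ?_⟩
      have := (hadjv s (by omega)).1 ha.symm
      omega
    · refine Apart.singleton_right ?_
      rintro _ ⟨s, h1, h2, rfl⟩
      refine ⟨(hv s (by omega)).symm, fun ha => ?_⟩
      have := (hadjv s (by omega)).1 ha.symm
      omega

lemma Hole.edge_of_sector (H : Hole G h n) (hθ : ¬ ContainsTheta G)
    (hπ : ¬ ContainsPrism G) {v : V} (hv : ∀ i < n, v ≠ h i) {e : ℕ} (hen : e < n)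
    (hv0 : G.Adj v (h 0)) (hve : G.Adj v (h e)) (hno : ∀ i, 0 < i → i < e → ¬ G.Adj v (h i))
    {k : ℕ → V} {m : ℕ} (hk : IsSeq G k m) (hkv : ¬ Touch G (Seg k 0 m) v)
    (hkh : ∀ s ≤ m, ∀ i < n, k s ≠ h i)
    (hav : ∀ i < n, G.Adj v (h i) → ∀ j < n, (j = i ∨ G.Adj (h i) (h j)) →
      ¬ Touch G (Seg k 0 m) (h j))
    (hi : ∀ s ≤ m, ∀ i, 0 < i → i < e → G.Adj (k s) (h i) → s = 0)
    (hi' : ∃ i, 0 < i ∧ i < e ∧ G.Adj (k 0) (h i))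
    (hj : ∃ j, e < j ∧ j < n ∧ G.Adj (k m) (h j)) :
    ∃ c, 2 ≤ c ∧ c + 3 ≤ e ∧ ∀ i, 0 < i → i < e → (G.Adj (k 0) (h i) ↔ i = c ∨ i = c + 1) := by
  have h4 := H.four
  have hKm : ∀ {s} (_ : s ≤ m) {x}, G.Adj (k s) x → Touch G (Seg k 0 m) x := fun hs _ hx =>
    ⟨_, mem_seg (by omega) hs, Or.inr hx⟩
  obtain ⟨p, hp1, hp2, hvp⟩ := H.exists_nbr_of_sector hθ hπ hv hen hv0 hve hno hk.linked hkv hav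
    (by
      obtain ⟨i, h1, h2, h3⟩ := hi'
      exact ⟨i, h1, h2, hKm (by omega) h3⟩)
    (by
      obtain ⟨i, h1, h2, h3⟩ := hj
      exact ⟨i, h1, h2, hKm le_rfl h3⟩)
  obtain ⟨j, hej, hjn, hTj⟩ := hj
  have t0 := hav 0 (by omega) hv0 _ (by omega) (Or.inl rfl)
  have t1 := hav 0 (by omega) hv0 _ (by omega) (Or.inr (H.adj_succ (by omega)))
  have tn := hav 0 (by omega) hv0 _ (by omega) (Or.inr H.adj_last.symm)
  have te := hav e (by omega) hve _ (by omega) (Or.inl rfl)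
  have te1 := hav e (by omega) hve _ (by omega) (Or.inr (H.adj_succ (by omega)))
  have ne_of : ∀ {u s t}, u ≤ m → G.Adj (k u) (h s) → ¬ Touch G (Seg k 0 m) (h t) → s ≠ t := by
    rintro u s t hu h1 h2 rfl
    exact h2 (hKm hu h1)
  have hj1 := ne_of le_rfl hTj te1
  have hj2 := ne_of le_rfl hTj tn
  obtain ⟨f, g, hfg, hg, ⟨hf0, hfe, hf1⟩, ⟨hg0, hge, hg1⟩, hfirst⟩ :=
    exists_first_last (p := fun i => 0 < i ∧ i < e ∧ G.Adj (k 0) (h i)) (N := e) (by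
      obtain ⟨i, h1, h2, h3⟩ := hi'
      exact ⟨i, by omega, h1, h2, h3⟩)
  have te2 := hav e (by omega) hve (e - 1) (by omega)
    (Or.inr ((H.adj _ (by omega) _ (by omega)).2 (by omega)))
  have hf2 := ne_of (by omega) hf1 t1
  have hg2 := ne_of (by omega) hg1 te2
  have hvk : ∀ s ≤ m, ¬ G.Adj (k s) v := fun s hs ha => hkv (hKm hs ha)
  have hvk' : ∀ s ≤ m, k s ≠ v := fun s hs ha => hkv ⟨_, mem_seg (by omega) hs, Or.inl ha⟩
  by_cases c1 : g = f
  · subst c1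
    refine (hθ (containsTheta_of_apart (a := h g) (b := v) (D₁ := Seg h 0 (g - 1))
      (D₂ := Seg h (g + 1) e) (D₃ := Seg k 0 m ∪ Seg h (e + 2) (n - 2))
      (hv g (by omega)).symm (fun ha => hno g hg0 hge ha.symm) ?_ ?_ ?_ ?_ ?_ ?_)).elim
    · refine Reaches.trans (y := h 0) ?_ ?_
      · refine H.reaches (c := 0) (d := g) (by omega) (fun s h1 h2 => ?_)
          (by omega) (by omega) (by omega) (by omega)
        rcases h2.eq_or_lt with rfl | h2
        · simp
        · exact Or.inr (Or.inr (mem_seg (by omega) (by omega)))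
      · exact reaches_adj (Or.inr (Or.inr (mem_seg (by omega) (by omega)))) (by simp) hv0.symm
    · refine Reaches.trans (y := h e) ?_ ?_
      · refine H.reaches (c := g) (d := e) (by omega) (fun s h1 h2 => ?_)
          (by omega) (by omega) (by omega) (by omega)
        rcases h1.eq_or_lt with rfl | h2
        · simp
        · exact Or.inr (Or.inr (mem_seg (by omega) (by omega)))
      · exact reaches_adj (Or.inr (Or.inr (mem_seg (by omega) (by omega)))) (by simp) hve.symm
    · refine Reaches.trans (y := k 0) ?_ (Reaches.trans (y := k m) ?_
        (Reaches.trans (y := h j) ?_ (Reaches.trans (y := h p) ?_ ?_)))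
      · exact reaches_adj (by simp) (Or.inr (Or.inr (Or.inl (mem_seg (by omega) (by omega)))))
          hg1.symm
      · exact hk.reaches (c := 0) le_rfl
          (fun s h1 h2 => Or.inr (Or.inr (Or.inl (mem_seg h1 h2))))
          (by omega) (by omega) (by omega) (by omega)
      · exact reaches_adj (Or.inr (Or.inr (Or.inl (mem_seg (by omega) (by omega)))))
          (Or.inr (Or.inr (Or.inr (mem_seg (by omega) (by omega))))) hTj
      · exact H.reaches (c := e + 2) (d := n - 2) (by omega)
          (fun s h1 h2 => Or.inr (Or.inr (Or.inr (mem_seg h1 h2))))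
          (by omega) (by omega) (by omega) (by omega)
      · exact reaches_adj (Or.inr (Or.inr (Or.inr (mem_seg (by omega) (by omega))))) (by simp)
          hvp.symm
    · exact H.apart_segs (by omega) (by omega) (by omega)
    · refine Apart.union_right (Apart.symm (apart_seg fun s t h1 h2 h3 h4 =>
        ⟨hkh s h2 t (by omega), fun ha => ?_⟩)) (H.apart_segs (by omega) (by omega) (by omega))
      have := ne_of h2 ha t0
      obtain rfl := hi s h2 t (by omega) (by omega) ha
      have := hfirst t (by omega) ⟨by omega, by omega, ha⟩
      omega
    · refine Apart.union_right (Apart.symm (apart_seg fun s t h1 h2 h3 h4 =>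
        ⟨hkh s h2 t (by omega), fun ha => ?_⟩)) (H.apart_segs (by omega) (by omega) (by omega))
      have := ne_of h2 ha te
      obtain rfl := hi s h2 t (by omega) (by omega) ha
      have := hfirst t (by omega) ⟨by omega, by omega, ha⟩
      omega
  by_cases c2 : g = f + 1
  · subst c2
    refine ⟨f, by omega, by omega, fun i h1 h2 => ⟨fun h3 => ?_, ?_⟩⟩
    · have := hfirst i (by omega) ⟨h1, h2, h3⟩
      omega
    · rintro (rfl | rfl) <;> assumption
  · refine (hθ (containsTheta_of_apart (a := k 0) (b := v) (D₁ := Seg h 0 f)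
      (D₂ := Seg h g e) (D₃ := Seg k 1 m ∪ Seg h (e + 2) (n - 2))
      (hvk' 0 (by omega)) (hvk 0 (by omega)) ?_ ?_ ?_ ?_ ?_ ?_)).elim
    · refine Reaches.trans (y := h f) ?_ (Reaches.trans (y := h 0) ?_ ?_)
      · exact reaches_adj (by simp) (Or.inr (Or.inr (mem_seg (by omega) (by omega)))) hf1
      · exact H.reaches (c := 0) (d := f) (by omega)
          (fun s h1 h2 => Or.inr (Or.inr (mem_seg (by omega) (by omega))))
          (by omega) (by omega) (by omega) (by omega)
      · exact reaches_adj (Or.inr (Or.inr (mem_seg (by omega) (by omega)))) (by simp) hv0.symm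
    · refine Reaches.trans (y := h g) ?_ (Reaches.trans (y := h e) ?_ ?_)
      · exact reaches_adj (by simp) (Or.inr (Or.inr (mem_seg (by omega) (by omega)))) hg1
      · exact H.reaches (c := g) (d := e) (by omega)
          (fun s h1 h2 => Or.inr (Or.inr (mem_seg (by omega) (by omega))))
          (by omega) (by omega) (by omega) (by omega)
      · exact reaches_adj (Or.inr (Or.inr (mem_seg (by omega) (by omega)))) (by simp) hve.symm
    · have hkmem : ∀ s ≤ m, k s ∈ insert (k 0) (insert v (Seg k 1 m ∪ Seg h (e + 2) (n - 2))) := by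
        intro s hs
        rcases Nat.eq_zero_or_pos s with rfl | h0
        · simp
        · exact Or.inr (Or.inr (Or.inl (mem_seg h0 hs)))
      refine Reaches.trans (y := k m) ?_
        (Reaches.trans (y := h j) ?_ (Reaches.trans (y := h p) ?_ ?_))
      · exact hk.reaches (c := 0) le_rfl (fun s h1 h2 => hkmem s h2)
          (by omega) (by omega) (by omega) (by omega)
      · exact reaches_adj (hkmem m le_rfl)
          (Or.inr (Or.inr (Or.inr (mem_seg (by omega) (by omega))))) hTj
      · exact H.reaches (c := e + 2) (d := n - 2) (by omega)
          (fun s h1 h2 => Or.inr (Or.inr (Or.inr (mem_seg h1 h2))))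
          (by omega) (by omega) (by omega) (by omega)
      · exact reaches_adj (Or.inr (Or.inr (Or.inr (mem_seg (by omega) (by omega))))) (by simp)
          hvp.symm
    · exact H.apart_segs (by omega) (by omega) (by omega)
    · refine Apart.union_right (Apart.symm (apart_seg fun s t h1 h2 h3 h4 =>
        ⟨hkh s h2 t (by omega), fun ha => ?_⟩)) (H.apart_segs (by omega) (by omega) (by omega))
      have := ne_of h2 ha t0
      have := hi s h2 t (by omega) (by omega) ha
      omega
    · refine Apart.union_right (Apart.symm (apart_seg fun s t h1 h2 h3 h4 =>
        ⟨hkh s h2 t (by omega), fun ha => ?_⟩)) (H.apart_segs (by omega) (by omega) (by omega))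
      have := ne_of h2 ha te
      have := hi s h2 t (by omega) (by omega) ha
      omega

lemma Hole.rot_avoid (H : Hole G h n) {l : ℕ} (hl : l < n) {v : V} {K : Set V}
    (hav : ∀ i < n, G.Adj v (h i) → ∀ j < n, (j = i ∨ G.Adj (h i) (h j)) → ¬ Touch G K (h j)) :
    ∀ i < n, G.Adj v (rotSeq h n l i) → ∀ j < n,
      (j = i ∨ G.Adj (rotSeq h n l i) (rotSeq h n l j)) → ¬ Touch G K (rotSeq h n l j) := by
  intro i hi hvi j hj hij
  obtain ⟨i', hi', ei⟩ := exists_eq_rot (h := h) hl hi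
  obtain ⟨j', hj', ej⟩ := exists_eq_rot (h := h) hl hj
  rw [ei] at hvi
  rw [ej]
  refine hav i' hi' hvi j' hj' (hij.imp (fun e => ?_) fun e => ?_)
  · subst e
    exact H.inj _ hj' _ hi' (ej.symm.trans ei)
  · rwa [ei, ej] at e

lemma Hole.edge_of_interval (H : Hole G h n) (hθ : ¬ ContainsTheta G)
    (hπ : ¬ ContainsPrism G) {v : V} (hv : ∀ i < n, v ≠ h i) {l r : ℕ} (hlr : l < r) (hrn : r ≤ n)
    (hl0 : r = n → l ≠ 0)
    (hvl : G.Adj v (h l)) (hvr : (r = n ∧ G.Adj v (h 0)) ∨ (r < n ∧ G.Adj v (h r)))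
    (hno : ∀ i, l < i → i < r → ¬ G.Adj v (h i))
    {k : ℕ → V} {m : ℕ} (hk : IsSeq G k m) (hkv : ¬ Touch G (Seg k 0 m) v)
    (hkh : ∀ s ≤ m, ∀ i < n, k s ≠ h i)
    (hav : ∀ i < n, G.Adj v (h i) → ∀ j < n, (j = i ∨ G.Adj (h i) (h j)) →
      ¬ Touch G (Seg k 0 m) (h j))
    (hi : ∀ s ≤ m, ∀ i, l < i → i < r → G.Adj (k s) (h i) → s = 0)
    (hi' : ∃ i, l < i ∧ i < r ∧ G.Adj (k 0) (h i))
    (hj : ∃ j < n, (j < l ∨ r < j) ∧ G.Adj (k m) (h j)) :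
    ∃ c, l + 2 ≤ c ∧ c + 3 ≤ r ∧
      ∀ i, l < i → i < r → (G.Adj (k 0) (h i) ↔ i = c ∨ i = c + 1) := by
  have r0 : rotSeq h n l 0 = h l := by rw [rotSeq_of_lt (by omega), Nat.zero_add]
  have rlt : ∀ i, i + l < r → rotSeq h n l i = h (i + l) := fun i hi => rotSeq_of_lt (by omega)
  obtain ⟨c, hc1, hc2, hc⟩ := (H.rot (c := l) (by omega)).edge_of_sector hθ hπ (v := v)
    (fun i hi e => by
      obtain ⟨j, hj, e'⟩ := exists_eq_rot (h := h) (c := l) (by omega) hi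
      exact hv j hj (e.trans e')) (e := r - l) (by omega) (by rwa [r0]) (by
      rcases hvr with ⟨rfl, h0⟩ | ⟨hr, h0⟩
      · rwa [rotSeq_of_ge (by omega), show r - l + l - r = 0 by omega]
      · rwa [rotSeq_of_lt (by omega), show r - l + l = r by omega])
    (fun i h1 h2 => by
      rw [rlt i (by omega)]
      exact hno _ (by omega) (by omega)) hk hkv
    (fun s hs i hi e => by
      obtain ⟨j, hj, e'⟩ := exists_eq_rot (h := h) (c := l) (by omega) hi
      exact hkh s hs j hj (e.trans e')) (H.rot_avoid (by omega) hav)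
    (fun s hs i h1 h2 h3 => by
      rw [rlt i (by omega)] at h3
      exact hi s hs _ (by omega) (by omega) h3)
    (by
      obtain ⟨i, h1, h2, h3⟩ := hi'
      refine ⟨i - l, by omega, by omega, ?_⟩
      rwa [rlt _ (by omega), show i - l + l = i by omega])
    (by
      obtain ⟨j, h1, h2 | h2, h3⟩ := hj
      · have : r < j + n := by
          by_contra hr
          obtain rfl : j = 0 := by omega
          rcases hvr with ⟨-, h0⟩ | ⟨hr', -⟩
          · exact hav 0 h1 h0 0 h1 (Or.inl rfl) ⟨k m, mem_seg (by omega) le_rfl, Or.inr h3⟩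
          · omega
        refine ⟨j + n - l, by omega, by omega, ?_⟩
        rwa [rotSeq_of_ge (by omega), show j + n - l + l - n = j by omega]
      · refine ⟨j - l, by omega, by omega, ?_⟩
        rwa [rotSeq_of_lt (by omega), show j - l + l = j by omega])
  refine ⟨c + l, by omega, by omega, fun i h1 h2 => ?_⟩
  have := hc (i - l) (by omega) (by omega)
  rw [rlt _ (by omega), show i - l + l = i by omega] at this
  rw [this]
  omega

lemma Hole.containsPrism_of_edges (H : Hole G h n) {k : ℕ → V} {m : ℕ} (hk : IsSeq G k m)
    (hkh : ∀ s ≤ m, ∀ i < n, k s ≠ h i) {c d : ℕ} (hc : 1 ≤ c) (hcd : c + 3 ≤ d)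
    (hd : d + 2 ≤ n)
    (hadj : ∀ s ≤ m, ∀ i < n, G.Adj (k s) (h i) ↔
      (s = 0 ∧ (i = c ∨ i = c + 1)) ∨ (s = m ∧ (i = d ∨ i = d + 1))) : ContainsPrism G := by
  have h4 := H.four
  have adj' : ∀ s ≤ m, ∀ i < n, ((s = 0 ∧ (i = c ∨ i = c + 1)) ∨ (s = m ∧ (i = d ∨ i = d + 1))) →
    G.Adj (h i) (k s) := fun s hs i hi h => ((hadj s hs i hi).2 h).symm
  have hole : ∀ s t, s < n → t < n → ((s ≤ c ∨ d < s) ∧ c < t ∧ t ≤ d) →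
      h s ≠ h t ∧ (G.Adj (h s) (h t) → (h s = h c ∧ h t = h (c + 1)) ∨
        (h s = h (d + 1) ∧ h t = h d)) := by
    intro s t hs ht hst
    refine ⟨fun e => ?_, fun e => ?_⟩
    · have := H.inj s hs t ht e
      omega
    · have := (H.adj s hs t ht).1 e
      have : (s = c ∧ t = c + 1) ∨ (s = d + 1 ∧ t = d) := by omega
      exact this.imp (fun e => ⟨congrArg h e.1, congrArg h e.2⟩)
        fun e => ⟨congrArg h e.1, congrArg h e.2⟩
  refine containsPrism_of_rungs (a₁ := h c) (a₂ := h (c + 1)) (a₃ := k 0) (b₁ := h (d + 1))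
    (b₂ := h d) (b₃ := k m) (E₁ := Seg h 0 c ∪ Seg h (d + 1) (n - 1)) (E₂ := Seg h (c + 1) d)
    (E₃ := Seg k 0 m) (H.adj_succ (by omega)) (adj' _ (by omega) _ (by omega) (by omega))
    (adj' _ (by omega) _ (by omega) (by omega)) (H.adj_succ (by omega)).symm
    (adj' _ (by omega) _ (by omega) (by omega)) (adj' _ (by omega) _ (by omega) (by omega))
    ?_ ?_ ?_ ?_ ?_ ?_ ?_ ?_ ?_
  · refine Reaches.trans (y := h 0) ?_ (Reaches.trans (y := h (n - 1)) ?_ ?_)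
    · exact H.reaches (c := 0) (d := c) (by omega) (fun s h1 h2 => Or.inl (mem_seg h1 h2))
        (by omega) (by omega) (by omega) (by omega)
    · exact reaches_adj (Or.inl (mem_seg (by omega) (by omega)))
        (Or.inr (mem_seg (by omega) (by omega))) H.adj_last.symm
    · exact H.reaches (c := d + 1) (d := n - 1) (by omega) (fun s h1 h2 => Or.inr (mem_seg h1 h2))
        (by omega) (by omega) (by omega) (by omega)
  · exact H.reaches (c := c + 1) (d := d) (by omega) (fun s h1 h2 => mem_seg h1 h2)
        (by omega) (by omega) (by omega) (by omega)
  · exact hk.reaches (c := 0) (d := m) (by omega) (fun s h1 h2 => mem_seg h1 h2)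
        (by omega) (by omega) (by omega) (by omega)
  · exact Rungs.union_left (rungs_seg fun s t _ _ _ _ => hole s t (by omega) (by omega) (by omega))
      (rungs_seg fun s t _ _ _ _ => hole s t (by omega) (by omega) (by omega))
  · refine Rungs.symm (Rungs.union_right (rungs_seg fun s t h1 h2 h3 h4 =>
      ⟨hkh s h2 t (by omega), fun e => ?_⟩) (rungs_seg fun s t h1 h2 h3 h4 =>
      ⟨hkh s h2 t (by omega), fun e => ?_⟩))
    · have := (hadj s h2 t (by omega)).1 e
      have : s = 0 ∧ t = c := by omega
      exact Or.inl ⟨congrArg k this.1, congrArg h this.2⟩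
    · have := (hadj s h2 t (by omega)).1 e
      have : s = m ∧ t = d + 1 := by omega
      exact Or.inr ⟨congrArg k this.1, congrArg h this.2⟩
  · refine Rungs.symm (rungs_seg fun s t h1 h2 h3 h4 => ⟨hkh s h2 t (by omega), fun e => ?_⟩)
    have := (hadj s h2 t (by omega)).1 e
    have : (s = 0 ∧ t = c + 1) ∨ (s = m ∧ t = d) := by omega
    exact this.imp (fun e => ⟨congrArg k e.1, congrArg h e.2⟩)
      fun e => ⟨congrArg k e.1, congrArg h e.2⟩
  · exact (H.apart (by omega) (by omega) (by omega) (by omega) (by omega) (by omega)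
        (by omega)).1
  · exact (H.apart (by omega) (by omega) (by omega) (by omega) (by omega) (by omega)
        (by omega)).1
  · exact fun _ => ⟨(H.apart (by omega) (by omega) (by omega) (by omega) (by omega) (by omega)
        (by omega)).2, (H.apart (by omega) (by omega) (by omega) (by omega) (by omega) (by omega)
        (by omega)).2⟩

/-- A vertex attaching to three different sectors of a wheel yields a theta. -/
lemma Hole.containsTheta_of_three (H : Hole G h n) {v x : V} (hxv : x ≠ v) (hxv' : ¬ G.Adj x v)
    {p₀ i₁ p₁ i₂ p₂ i₃ : ℕ} (h₁ : p₀ ≤ i₁) (h₂ : i₁ + 1 < p₁) (h₃ : p₁ ≤ i₂) (h₄ : i₂ + 1 < p₂)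
    (h₅ : p₂ ≤ i₃) (h₆ : i₃ < n) (h₇ : ¬ (p₀ = 0 ∧ i₃ + 1 = n))
    (hv₀ : G.Adj v (h p₀)) (hv₁ : G.Adj v (h p₁)) (hv₂ : G.Adj v (h p₂))
    (hx₁ : G.Adj x (h i₁)) (hx₂ : G.Adj x (h i₂)) (hx₃ : G.Adj x (h i₃)) : ContainsTheta G := by
  have key : ∀ {p i}, p ≤ i → i < n → G.Adj v (h p) → G.Adj x (h i) →
      Reaches G (insert x (insert v (Seg h p i))) x v := by
    intro p i hpi hi hv hx
    have hm : ∀ s, p ≤ s → s ≤ i → h s ∈ insert x (insert v (Seg h p i)) := fun s h1 h2 =>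
      Set.mem_insert_of_mem _ (Set.mem_insert_of_mem _ (mem_seg h1 h2))
    exact (reaches_adj (Set.mem_insert _ _) (hm i hpi le_rfl) hx).trans
      ((H.reaches hi hm hpi le_rfl le_rfl hpi).trans (reaches_adj (hm p le_rfl hpi)
        (Set.mem_insert_of_mem _ (Set.mem_insert _ _)) hv.symm))
  exact containsTheta_of_apart hxv hxv' (key h₁ (by omega) hv₀ hx₁) (key h₃ (by omega) hv₁ hx₂)
    (key h₅ h₆ hv₂ hx₃) (H.apart_segs (by omega) (by omega) (by omega))
    (H.apart_segs (by omega) (by omega) (by omega)) (H.apart_segs (by omega) (by omega) (by omega))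

lemma exists_sector {P : ℕ → Prop} (h0 : P 0) {i n : ℕ} (hi : i < n) :
    ∃ l r, l ≤ i ∧ i < r ∧ r ≤ n ∧ P l ∧ (r = n ∨ P r) ∧ ∀ s, l < s → s < r → ¬ P s := by
  obtain ⟨_, l, _, hl, _, hPl, hl'⟩ := exists_first_last (p := P) (N := i) ⟨0, by omega, h0⟩
  obtain ⟨r, _, _, _, hr, _, hr'⟩ := exists_first_last (p := fun s => i < s ∧ (s = n ∨ P s))
    (N := n) ⟨n, le_rfl, hi, Or.inl rfl⟩
  have hrn := (hr' n le_rfl ⟨hi, Or.inl rfl⟩).1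
  refine ⟨l, r, hl, hr.1, hrn, hPl, hr.2, fun s h1 h2 hs => ?_⟩
  by_cases hsi : s ≤ i
  · have := hl' s hsi hs
    omega
  · have := hr' s (by omega) ⟨by omega, Or.inr hs⟩
    omega

lemma IsSeq.reverse {k : ℕ → V} {m : ℕ} (hk : IsSeq G k m) : IsSeq G (fun s => k (m - s)) m := by
  refine ⟨fun i hi j hj e => ?_, fun i hi j hj => ?_⟩
  · have := hk.1 _ (by omega) _ (by omega) e
    omega
  · rw [hk.2 _ (by omega) _ (by omega)]
    omega

/-- A connected set far from a wheel with center `v` attaches to at most one side of the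
pair `h 0`, `h p` of spokes. -/
lemma Hole.not_touch_wheel_base (H : Hole G h n) (hθ : ¬ ContainsTheta G)
    (hπ : ¬ ContainsPrism G) {v : V} (hv : ∀ i < n, v ≠ h i) (hv0 : G.Adj v (h 0))
    {K : Set V} (hK : Linked G K) (hKv : ¬ Touch G K v)
    (hav : ∀ i < n, G.Adj v (h i) → ∀ j < n, (j = i ∨ G.Adj (h i) (h j)) → ¬ Touch G K (h j))
    {i p j : ℕ} (hi : 0 < i) (hip : i < p) (hpj : p < j) (hj : j < n) (hvp : G.Adj v (h p))
    (hTi : Touch G K (h i)) (hTj : Touch G K (h j)) : False := by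
  have h4 := H.four
  obtain ⟨x₀, hx₀, hx₀'⟩ := hTi
  obtain ⟨y₀, hy₀, hy₀'⟩ := hTj
  obtain ⟨k, m, hk, hkK, ⟨i, p, j, hi, hip, hpj, hj, hvp, hki, hkj⟩, hmin⟩ :=
    exists_min_seq (fun x y => ∃ i p j, 0 < i ∧ i < p ∧ p < j ∧ j < n ∧ G.Adj v (h p) ∧
      (x = h i ∨ G.Adj x (h i)) ∧ (y = h j ∨ G.Adj y (h j))) hK
      ⟨x₀, hx₀, y₀, hy₀, i, p, j, hi, hip, hpj, hj, hvp, hx₀', hy₀'⟩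
  clear hx₀' hy₀' hx₀ hy₀ x₀ y₀
  have far : ∀ s ≤ m, ∀ q < n, (k s = h q ∨ G.Adj (k s) (h q)) → ∀ p < n, G.Adj v (h p) →
      q + 1 < p ∨ p + 1 < q := by
    intro s hs q hq hsq p hp hvp
    have hT : Touch G K (h q) := ⟨k s, hkK s hs, hsq⟩
    by_contra e
    by_cases e' : q = p
    · exact hav p hp hvp q hq (Or.inl e') hT
    · exact hav p hp hvp q hq (Or.inr ((H.adj _ hp _ hq).2 (by omega))) hT
  have far0 : ∀ s ≤ m, ∀ q < n, G.Adj (k s) (h q) → q + 1 < n := by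
    intro s hs q hq hsq
    by_contra e
    exact hav 0 (by omega) hv0 q hq (Or.inr ((H.adj _ (by omega) _ hq).2 (by omega)))
      ⟨k s, hkK s hs, Or.inr hsq⟩
  have hkh : ∀ s ≤ m, ∀ q < n, k s ≠ h q := by
    intro s hs q hq e
    have f0 := far s hs q hq (Or.inl e) 0 (by omega) hv0
    have fp := far s hs q hq (Or.inl e) p (by omega) hvp
    have hkk : ∀ a b, a < n → b < n → h a = h b ∨ G.Adj (h a) (h b) →
        a = b ∨ a + 1 = b ∨ b + 1 = a ∨ a = 0 ∨ b = 0 := by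
      intro a b ha hb hab
      rcases hab with hab | hab
      · exact Or.inl (H.inj a ha b hb hab)
      · have := (H.adj a ha b hb).1 hab
        omega
    by_cases hqp : q < p
    · have h1 := hmin s hs m le_rfl ⟨q, p, j, by omega, hqp, hpj, hj, hvp, Or.inl e, hkj⟩
      obtain rfl : s = 0 := by omega
      rcases Nat.eq_zero_or_pos m with rfl | hm
      · rw [e] at hkj
        have := hkk q j hq hj hkj
        omega
      · have := hmin 1 (by omega) m le_rfl ⟨q, p, j, by omega, hqp, hpj, hj, hvp, Or.inr (by
          rw [← e]
          exact (hk.2 _ (by omega) _ (by omega)).2 (by omega)), hkj⟩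
        omega
    · have h1 := hmin 0 (by omega) s hs ⟨i, p, q, hi, hip, by omega, hq, hvp, hki, Or.inl e⟩
      obtain rfl : s = m := by omega
      rcases Nat.eq_zero_or_pos s with rfl | hm
      · rw [e] at hki
        have := hkk q i hq (by omega) hki
        omega
      · have := hmin 0 (by omega) (s - 1) (by omega) ⟨i, p, q, hi, hip, by omega, hq, hvp, hki,
          Or.inr (by
            rw [← e]
            exact (hk.2 _ (by omega) _ (by omega)).2 (by omega))⟩
        omega
  replace hki := hki.resolve_left (hkh 0 (by omega) i (by omega))
  replace hkj := hkj.resolve_left (hkh m le_rfl j hj)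
  replace far : ∀ s ≤ m, ∀ q < n, G.Adj (k s) (h q) → ∀ p < n, G.Adj v (h p) →
      q + 1 < p ∨ p + 1 < q := fun s hs q hq e =>
    far s hs q hq (Or.inr e)
  replace hmin : ∀ s ≤ m, ∀ t ≤ m, ∀ q p q', 0 < q → q < p → p < q' → q' < n → G.Adj v (h p) →
      G.Adj (k s) (h q) → G.Adj (k t) (h q') → (s = 0 ∧ t = m) ∨ (s = m ∧ t = 0) :=
    fun s hs t ht q p q' h1 h2 h3 h4 h5 h6 h7 => hmin s hs t ht
      ⟨q, p, q', h1, h2, h3, h4, h5, Or.inr h6, Or.inr h7⟩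
  have hxv : ∀ s ≤ m, k s ≠ v ∧ ¬ G.Adj (k s) v := fun s hs =>
    ⟨fun e => hKv ⟨k s, hkK s hs, Or.inl e⟩, fun e => hKv ⟨k s, hkK s hs, Or.inr e⟩⟩
  have hleft : ∀ s ≤ m, ∀ q < p, G.Adj (k s) (h q) → s = 0 := by
    intro s hs q hq e
    have := far s hs q (by omega) e 0 (by omega) hv0
    have := hmin s hs m le_rfl q p j (by omega) hq hpj hj hvp e hkj
    omega
  have hright : ∀ s ≤ m, ∀ q < n, p < q → G.Adj (k s) (h q) → s = m := by
    intro s hs q hq hpq e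
    have := hmin 0 (by omega) s hs i p q hi hip hpq hq hvp hki e
    omega
  obtain ⟨l, r, hli, hir, hrn, hvl, hvr, hno⟩ :=
    exists_sector (P := fun s => G.Adj v (h s)) hv0 (i := i) (n := n) (by omega)
  obtain ⟨l', r', hlj, hjr, hrn', hvl', hvr', hno'⟩ :=
    exists_sector (P := fun s => G.Adj v (h s)) hv0 hj
  have hrp : r ≤ p := by
    by_contra hrp
    exact hno p (by omega) (by omega) hvp
  have hpl : p ≤ l' := by
    by_contra hrp
    exact hno' p (by omega) (by omega) hvp
  replace hvr : G.Adj v (h r) := hvr.resolve_left (by omega)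
  have fi := far 0 (by omega) i (by omega) hki
  have fj := far m le_rfl j hj hkj
  have fi0 : l + 1 < i := by have := fi l (by omega) hvl; omega
  have fi1 : i + 1 < r := by have := fi r (by omega) hvr; omega
  have fj0 : l' + 1 < j := by have := fj l' (by omega) hvl'; omega
  have fjn := far0 m le_rfl j hj hkj
  have loc : ∀ s ≤ m, ∀ q < n, G.Adj (k s) (h q) →
      (s = 0 ∧ l < q ∧ q < r) ∨ (s = m ∧ l' < q ∧ q < r') := by
    intro s hs q hq e
    have fq := far s hs q hq e
    have fq0 : 1 < q := by have := fq 0 (by omega) hv0; omega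
    have fqp := fq p (by omega) hvp
    by_contra hcon
    by_cases hqp : q < p
    · obtain rfl := hleft s hs q hqp e
      have fq1 := fq l (by omega) hvl
      by_cases hql : q < l
      · have := hmin 0 hs 0 hs q l i (by omega) hql (by omega) (by omega) hvl e hki
        obtain rfl : m = 0 := by omega
        exact hθ (H.containsTheta_of_three (hxv 0 hs).1 (hxv 0 hs).2 (p₀ := 0) (i₁ := q)
          (p₁ := l) (i₂ := i) (p₂ := p) (i₃ := j) (by omega) (by omega) (by omega) (by omega)
          (by omega) (by omega) (by omega) hv0 hvl hvp e hki hkj)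
      · have fq2 : r + 1 < q := by have := fq r (by omega) hvr; omega
        have := hmin 0 hs 0 hs i r q (by omega) hir (by omega) (by omega) hvr hki e
        obtain rfl : m = 0 := by omega
        exact hθ (H.containsTheta_of_three (hxv 0 hs).1 (hxv 0 hs).2 (p₀ := 0) (i₁ := i)
          (p₁ := r) (i₂ := q) (p₂ := p) (i₃ := j) (by omega) (by omega) (by omega) (by omega)
          (by omega) (by omega) (by omega) hv0 hvr hvp hki e hkj)
    · obtain rfl := hright s hs q hq (by omega) e
      have fq1 := fq l' (by omega) hvl'
      by_cases hql : q < l'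
      · have := hmin s hs s hs q l' j (by omega) hql (by omega) (by omega) hvl' e hkj
        obtain rfl : s = 0 := by omega
        exact hθ (H.containsTheta_of_three (hxv 0 hs).1 (hxv 0 hs).2 (p₀ := 0) (i₁ := i)
          (p₁ := p) (i₂ := q) (p₂ := l') (i₃ := j) (by omega) (by omega) (by omega) (by omega)
          (by omega) (by omega) (by omega) hv0 hvp hvl' hki e hkj)
      · have hvr'' : G.Adj v (h r') := hvr'.resolve_left (by omega)
        have fj3 : j + 1 < r' := by have := fj r' (by omega) hvr''; omega
        have fq3 : r' + 1 < q := by have := fq r' (by omega) hvr''; omega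
        have fqn := far0 s hs q hq e
        have := hmin s hs s hs j r' q (by omega) (by omega) (by omega) (by omega) hvr'' hkj e
        obtain rfl : s = 0 := by omega
        exact hθ (H.containsTheta_of_three (hxv 0 hs).1 (hxv 0 hs).2 (p₀ := 0) (i₁ := i)
          (p₁ := p) (i₂ := j) (p₂ := r') (i₃ := q) (by omega) (by omega) (by omega) (by omega)
          (by omega) (by omega) (by omega) hv0 hvp hvr'' hki hkj e)
  have touchK : ∀ {f : ℕ → V} {x}, (∀ s ≤ m, f s ∈ K) → Touch G (Seg f 0 m) x → Touch G K x := by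
    rintro f x hf ⟨_, ⟨s, _, hs, rfl⟩, hx⟩
    exact ⟨_, hf s hs, hx⟩
  have hkK' : ∀ s ≤ m, k (m - s) ∈ K := fun s _ => hkK _ (by omega)
  obtain ⟨c, hc1, hc2, hc⟩ := H.edge_of_interval hθ hπ hv (l := l) (r := r) (by omega) hrn
    (by omega) hvl (Or.inr ⟨by omega, hvr⟩) hno hk (fun e => hKv (touchK hkK e)) hkh
    (fun a ha hva b hb hab e => hav a ha hva b hb hab (touchK hkK e))
    (fun s hs q h1 h2 e => hleft s hs q (by omega) e) ⟨i, by omega, hir, hki⟩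
    ⟨j, hj, by omega, hkj⟩
  obtain ⟨d, hd1, hd2, hd⟩ := H.edge_of_interval hθ hπ hv (l := l') (r := r') (by omega) hrn'
    (by omega) hvl' (hvr'.elim (fun e => Or.inl ⟨e, hv0⟩) fun e => by
      rcases Nat.lt_or_ge r' n with h | h
      · exact Or.inr ⟨h, e⟩
      · exact Or.inl ⟨by omega, hv0⟩) hno' hk.reverse (fun e => hKv (touchK hkK' e))
    (fun s hs q hq => hkh _ (by omega) q hq)
    (fun a ha hva b hb hab e => hav a ha hva b hb hab (touchK hkK' e))
    (fun s hs q h1 h2 e => by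
      have := hright _ (by omega) q (by omega) (by omega) e
      omega) ⟨j, by omega, hjr, by simpa using hkj⟩
    ⟨i, by omega, by omega, by simpa using hki⟩
  refine hπ (H.containsPrism_of_edges hk hkh (c := c) (d := d) (by omega) (by omega) (by omega)
    fun s hs q hq => ⟨fun e => ?_, ?_⟩)
  · rcases loc s hs q hq e with ⟨rfl, h1, h2⟩ | ⟨rfl, h1, h2⟩
    · exact Or.inl ⟨rfl, (hc q h1 h2).1 e⟩
    · exact Or.inr ⟨rfl, (hd q h1 h2).1 (by simpa using e)⟩
  · rintro (⟨rfl, h1⟩ | ⟨rfl, h1⟩)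
    · exact (hc q (by omega) (by omega)).2 h1
    · simpa using (hd q (by omega) (by omega)).2 h1

/-- A connected set far from a wheel with center `v` cannot attach to the rim both inside and
outside of an interval bounded by two neighbors of `v`. -/
lemma Hole.not_touch_wheel (H : Hole G h n) (hθ : ¬ ContainsTheta G)
    (hπ : ¬ ContainsPrism G) {v : V} (hv : ∀ i < n, v ≠ h i)
    {K : Set V} (hK : Linked G K) (hKv : ¬ Touch G K v)
    (hav : ∀ i < n, G.Adj v (h i) → ∀ j < n, (j = i ∨ G.Adj (h i) (h j)) → ¬ Touch G K (h j))
    {l r i j : ℕ} (hli : l < i) (hir : i < r) (hrn : r < n) (hj : j < n)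
    (hlr : j < l ∨ r < j) (hvl : G.Adj v (h l)) (hvr : G.Adj v (h r))
    (hTi : Touch G K (h i)) (hTj : Touch G K (h j)) : False := by
  have r1 : ∀ s, l ≤ s → s < n → rotSeq h n l (s - l) = h s := fun s h1 h2 => by
    rw [rotSeq_of_lt (by omega), Nat.sub_add_cancel h1]
  obtain ⟨j', hj1, hj2, hj3⟩ : ∃ j', r - l < j' ∧ j' < n ∧ rotSeq h n l j' = h j := by
    rcases hlr with hlr | hlr
    · exact ⟨j + n - l, by omega, by omega, by
        rw [rotSeq_of_ge (by omega)]
        congr 1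
        omega⟩
    · exact ⟨j - l, by omega, by omega, r1 j (by omega) hj⟩
  refine (H.rot (c := l) (by omega)).not_touch_wheel_base hθ hπ (v := v) (fun i hi e => ?_) ?_
    hK hKv (H.rot_avoid (by omega) hav) (i := i - l) (p := r - l) (j := j') (by omega) (by omega)
    hj1 hj2 ?_ ?_ ?_
  · obtain ⟨j, hj, e'⟩ := exists_eq_rot (h := h) (c := l) (by omega) hi
    exact hv j hj (e.trans e')
  · have := r1 l le_rfl (by omega)
    rw [Nat.sub_self] at this
    rwa [this]
  · rwa [r1 r (by omega) hrn]
  · rwa [r1 i (by omega) (by omega)]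
  · rwa [hj3]

end Wheels

section Jumps

variable {G : SimpleGraph V} {h : ℕ → V} {n : ℕ}

/-- An induced path from `h 0` to a vertex with neighbors in the interval `[g, r]` of the hole:
a connected set far from the attachments cannot meet both `[0, r]` and its complement. -/
lemma Hole.not_touch_jump (H : Hole G h n) (hθ : ¬ ContainsTheta G) (hπ : ¬ ContainsPrism G)
    {k : ℕ → V} {m : ℕ} (hk : IsSeq G k m) (hkh : ∀ s ≤ m, ∀ i < n, k s ≠ h i)
    (hk0 : G.Adj (k 0) (h 0)) (hkz : ∀ s ≤ m, G.Adj (k s) (h 0) → s = 0)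
    (hkp : ∀ s ≤ m, ∀ i < n, 0 < i → G.Adj (k s) (h i) → s = m)
    {g r : ℕ} (hg : 2 ≤ g) (hr : r + 2 ≤ n) (hkg : G.Adj (k m) (h g)) (hkr : G.Adj (k m) (h r))
    (hgr : ∀ i < n, 0 < i → G.Adj (k m) (h i) → g ≤ i ∧ i ≤ r)
    {K : Set V} (hK : Linked G K) (h0 : ¬ Touch G K (h 0)) (h1 : ¬ Touch G K (h 1))
    (hn : ¬ Touch G K (h (n - 1))) (hK0 : ¬ Touch G K (k 0)) (hKm : ¬ Touch G K (k m))
    (hav : ∀ i < n, G.Adj (k m) (h i) → ∀ j < n, (j = i ∨ G.Adj (h i) (h j)) →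
      ¬ Touch G K (h j))
    {i j : ℕ} (hi : i ≤ r) (hrj : r < j) (hjn : j < n) (hTi : Touch G K (h i))
    (hTj : Touch G K (h j)) : False := by
  have h4 := H.four
  by_cases hgn : g < n
  swap
  · have := hgr r (by omega)
    by_cases hr0 : 0 < r
    · have := this hr0 hkr
      omega
    · obtain rfl : i = 0 := by omega
      exact h0 hTi
  have hgr' := (hgr g hgn (by omega) hkg).2
  rcases Nat.eq_zero_or_pos m with rfl | hm
  · refine H.not_touch_wheel hθ hπ (v := k 0) (hkh 0 le_rfl) hK hK0 hav (l := 0) (r := r) (i := i)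
      (j := j) ?_ ?_ (by omega) hjn (Or.inr hrj) hk0 hkr hTi hTj
    · by_contra e
      obtain rfl : i = 0 := by omega
      exact h0 hTi
    · by_contra e
      obtain rfl : i = r := by omega
      exact hav i (by omega) hkr i (by omega) (Or.inl rfl) hTi
  have hkA : ∀ {A : Set V} {c d : ℕ}, c ≤ d → d ≤ m → (∀ s, c ≤ s → s ≤ d → k s ∈ A) →
      Reaches G A (k c) (k d) := fun hcd hd hA =>
    hk.reaches hd hA le_rfl hcd hcd le_rfl
  have hhA : ∀ {A : Set V} {c d : ℕ}, c ≤ d → d < n → (∀ s, c ≤ s → s ≤ d → h s ∈ A) →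
      Reaches G A (h c) (h d) := fun hcd hd hA =>
    H.reaches hd hA le_rfl hcd hcd le_rfl
  have out : ∀ {a b x : V} {D : Set V}, x ∈ D → x ∈ insert a (insert b D) := fun hx =>
    Set.mem_insert_of_mem _ (Set.mem_insert_of_mem _ hx)
  have in₁ : ∀ {a b : V} {D : Set V}, a ∈ insert a (insert b D) := Set.mem_insert _ _
  have in₂ : ∀ {a b : V} {D : Set V}, b ∈ insert a (insert b D) :=
    Set.mem_insert_of_mem _ (Set.mem_insert _ _)
  have apartK : ∀ {a b c d : ℕ}, b ≤ m → d < n → (∀ s t, a ≤ s → s ≤ b → c ≤ t → t ≤ d →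
      ¬ G.Adj (k s) (h t)) → Apart G (Seg h c d) (Seg k a b) := fun hb hd hx =>
    Apart.symm (apart_seg fun s t h1 h2 h3 h4 =>
      ⟨hkh s (by omega) t (by omega), hx s t h1 h2 h3 h4⟩)
  rcases (show g = r ∨ r = g + 1 ∨ g + 2 ≤ r by omega) with rfl | rfl | hgr2
  · refine hθ (containsTheta_of_apart (a := h 0) (b := h g) (D₁ := Seg h 1 (g - 1))
      (D₂ := Seg h (g + 1) (n - 1)) (D₃ := Seg k 0 m)
      (H.apart (by omega) (by omega) (by omega) (by omega) (by omega) (by omega) (by omega)).1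
      (H.apart (by omega) (by omega) (by omega) (by omega) (by omega) (by omega) (by omega)).2
      ?_ ?_ ?_ (H.apart_segs (by omega) (by omega) (by omega)) ?_ ?_)
    · exact (reaches_adj in₁ (out (mem_seg le_rfl (by omega))) (H.adj_succ (by omega))).trans
        ((hhA (by omega) (by omega) fun s h1 h2 => out (mem_seg h1 h2)).trans
        (reaches_adj (out (mem_seg (by omega) le_rfl)) in₂
        ((H.adj _ (by omega) _ (by omega)).2 (by omega))))
    · exact (reaches_adj in₁ (out (mem_seg (by omega) le_rfl)) H.adj_last.symm).trans
        ((hhA (by omega) (by omega) fun s h1 h2 => out (mem_seg h1 h2)).symm.trans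
        (reaches_adj (out (mem_seg le_rfl (by omega))) in₂ (H.adj_succ (by omega)).symm))
    · exact (reaches_adj in₁ (out (mem_seg le_rfl (by omega))) hk0.symm).trans
        ((hkA (by omega) le_rfl fun s h1 h2 => out (mem_seg h1 h2)).trans
        (reaches_adj (out (mem_seg (by omega) le_rfl)) in₂ hkg))
    · refine apartK le_rfl (by omega) fun s t h1 h2 h3 h4 e => ?_
      obtain rfl := hkp s h2 t (by omega) (by omega) e
      have := hgr t (by omega) (by omega) e
      omega
    · refine apartK le_rfl (by omega) fun s t h1 h2 h3 h4 e => ?_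
      obtain rfl := hkp s h2 t (by omega) (by omega) e
      have := hgr t (by omega) (by omega) e
      omega
  · refine H.not_touch_two hθ hπ hk hkh (e := g) hg (by omega) (fun s hs t ht => ⟨fun e => ?_, ?_⟩)
      hK h0 h1 hn hK0 hKm (hav _ hgn hkg _ hgn (Or.inl rfl))
      (hav _ (by omega) hkr _ (by omega) (Or.inl rfl)) (i := i) (j := j) ?_ (by omega) hjn hTi hTj
    · rcases Nat.eq_zero_or_pos t with rfl | ht0
      · exact Or.inl ⟨hkz s hs e, rfl⟩
      · obtain rfl := hkp s hs t ht ht0 e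
        have := hgr t ht ht0 e
        omega
    · rintro (⟨rfl, rfl⟩ | ⟨rfl, rfl | rfl⟩) <;> assumption
    · by_contra e
      obtain rfl : i = g + 1 := by omega
      exact hav _ (by omega) hkr _ (by omega) (Or.inl rfl) hTi
  · refine hθ (containsTheta_of_apart (a := h 0) (b := k m) (D₁ := Seg h 1 g)
      (D₂ := Seg h r (n - 1)) (D₃ := Seg k 0 (m - 1)) (hkh m le_rfl 0 (by omega)).symm
      (fun e => ?_) ?_ ?_ ?_ (H.apart_segs (by omega) (by omega) (by omega)) ?_ ?_)
    · have := hkz m le_rfl e.symm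
      omega
    · exact (reaches_adj in₁ (out (mem_seg le_rfl (by omega))) (H.adj_succ (by omega))).trans
        ((hhA (by omega) (by omega) fun s h1 h2 => out (mem_seg h1 h2)).trans
        (reaches_adj (out (mem_seg (by omega) le_rfl)) in₂ hkg.symm))
    · exact (reaches_adj in₁ (out (mem_seg (by omega) le_rfl)) H.adj_last.symm).trans
        ((hhA (by omega) (by omega) fun s h1 h2 => out (mem_seg h1 h2)).symm.trans
        (reaches_adj (out (mem_seg le_rfl (by omega))) in₂ hkr.symm))
    · exact (reaches_adj in₁ (out (mem_seg le_rfl (by omega))) hk0.symm).trans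
        ((hkA (by omega) (by omega) fun s h1 h2 => out (mem_seg h1 h2)).trans
        (reaches_adj (out (mem_seg (by omega) le_rfl)) in₂
        ((hk.2 _ (by omega) _ (by omega)).2 (by omega))))
    · refine apartK (by omega) (by omega) fun s t h1 h2 h3 h4 e => ?_
      have := hkp s (by omega) t (by omega) (by omega) e
      omega
    · refine apartK (by omega) (by omega) fun s t h1 h2 h3 h4 e => ?_
      have := hkp s (by omega) t (by omega) (by omega) e
      omega

/-- An induced path `k` outside of the hole whose first vertex attaches to the interval `[l, f]`
and whose last vertex attaches to the interval `[g, r]`. -/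
structure Jump (G : SimpleGraph V) (h : ℕ → V) (n : ℕ) (k : ℕ → V) (m l f g r : ℕ) : Prop where
  isSeq : IsSeq G k m
  ne : ∀ s ≤ m, ∀ i < n, k s ≠ h i
  pos : 0 < l
  le₁ : l ≤ f
  lt : f + 2 ≤ g
  le₂ : g ≤ r
  lt_n : r < n
  adj_l : G.Adj (k 0) (h l)
  adj_f : G.Adj (k 0) (h f)
  adj_g : G.Adj (k m) (h g)
  adj_r : G.Adj (k m) (h r)
  adj : ∀ s ≤ m, ∀ i < n, G.Adj (k s) (h i) → (s = 0 ∧ l ≤ i ∧ i ≤ f) ∨ (s = m ∧ g ≤ i ∧ i ≤ r)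

variable {k : ℕ → V} {m l f g r : ℕ}

lemma Jump.flip (J : Jump G h n k m l f g r) :
    Jump G (flipSeq h n) n (fun s => k (m - s)) m (n - r) (n - g) (n - f) (n - l) := by
  obtain ⟨h1, h2, h3, h4, h5, h6, h7, h8, h9, h10, h11, h12⟩ := J
  have e : ∀ i, 0 < i → i < n → flipSeq h n (n - i) = h i := fun i h1 h2 => by
    rw [flipSeq_of_pos (by omega), show n - (n - i) = i by omega]
  refine ⟨h1.reverse, fun s hs i hi e => ?_, by omega, by omega, by omega, by omega, by omega,
    ?_, ?_, ?_, ?_, fun s hs i hi e' => ?_⟩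
  · obtain ⟨j, hj, e'⟩ := exists_eq_flip (h := h) hi
    exact h2 _ (by omega) j hj (e.trans e')
  · rwa [e r (by omega) h7]
  · rwa [e g (by omega) (by omega)]
  · rw [e f (by omega) (by omega)]
    simpa using h9
  · rw [e l (by omega) (by omega)]
    simpa using h8
  · rcases Nat.eq_zero_or_pos i with rfl | hi0
    · rw [flipSeq_zero] at e'
      have := h12 _ (by omega) 0 hi e'
      omega
    · rw [flipSeq_of_pos hi0] at e'
      have := h12 _ (by omega) _ (by omega) e'
      omega

/-- The hole obtained by replacing the part of the rim strictly between the extreme neighbors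
of `k 0` by `k 0`. -/
def shortSeq (h : ℕ → V) (n f : ℕ) (v : V) : ℕ → V := fun i =>
  if i = 0 then v else rotSeq h n f (i - 1)

lemma Hole.short (H : Hole G h n) {v : V} (hv : ∀ i < n, v ≠ h i) {l f : ℕ} (hlf : l + 2 ≤ f)
    (hfn : f < n) (hfl : f < n + l - 1) (hl : G.Adj v (h l)) (hf : G.Adj v (h f))
    (hno : ∀ i < n, (i < l ∨ f < i) → ¬ G.Adj v (h i)) :
    Hole G (shortSeq h n f v) (n - f + l + 2) := by
  have h4 := H.four
  have key : ∀ i, 0 < i → i < n - f + l + 2 → ∃ j < n, shortSeq h n f v i = h j ∧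
      ((j = i - 1 + f) ∨ (j + n = i - 1 + f)) := by
    intro i h0 hi
    unfold shortSeq
    rw [if_neg (by omega)]
    by_cases hin : i - 1 + f < n
    · exact ⟨i - 1 + f, hin, rotSeq_of_lt hin, Or.inl rfl⟩
    · exact ⟨i - 1 + f - n, by omega, rotSeq_of_ge (by omega), by omega⟩
  have key0 : shortSeq h n f v 0 = v := if_pos rfl
  have hadj0 : ∀ i, 0 < i → i < n - f + l + 2 → (G.Adj v (shortSeq h n f v i) ↔
      1 = i ∨ i + 1 = n - f + l + 2) := by
    intro i h0 hi
    obtain ⟨j, hj, e, hij⟩ := key i h0 hi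
    rw [e]
    constructor
    · intro hvj
      by_contra hcon
      exact hno j hj (by omega) hvj
    · intro h
      have : j = f ∨ j = l := by omega
      rcases this with rfl | rfl <;> assumption
  refine ⟨by omega, fun i hi j hj e => ?_, fun i hi j hj => ?_⟩
  · rcases Nat.eq_zero_or_pos i with rfl | hi0 <;> rcases Nat.eq_zero_or_pos j with rfl | hj0
    · rfl
    · obtain ⟨j', h1, h2, h3⟩ := key j hj0 hj
      exact (hv j' h1 (by rw [← h2, ← e, key0])).elim
    · obtain ⟨i', h1, h2, h3⟩ := key i hi0 hi
      exact (hv i' h1 (by rw [← h2, e, key0])).elim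
    · obtain ⟨j', h1, h2, h3⟩ := key j hj0 hj
      obtain ⟨i', h4, h5, h6⟩ := key i hi0 hi
      have := H.inj _ h1 _ h4 (by rw [← h2, ← h5, e])
      omega
  · rcases Nat.eq_zero_or_pos i with rfl | hi0 <;> rcases Nat.eq_zero_or_pos j with rfl | hj0
    · simp
    · rw [key0, hadj0 j hj0 hj]
      omega
    · rw [key0, G.adj_comm, hadj0 i hi0 hi]
      omega
    · obtain ⟨j', h1, h2, h3⟩ := key j hj0 hj
      obtain ⟨i', h4, h5, h6⟩ := key i hi0 hi
      rw [h2, h5, H.adj _ h4 _ h1]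
      omega

variable {K : Set V}

lemma Hole.not_touch_of_jump_of_ne (H : Hole G h n) (hθ : ¬ ContainsTheta G)
    (hπ : ¬ ContainsPrism G) (J : Jump G h n k m l f g r) (hf : f ≠ l + 1) (hK : Linked G K)
    (hKk : ∀ s ≤ m, s ≤ 1 ∨ m ≤ s + 1 → ¬ Touch G K (k s))
    (hav : ∀ i < n, (G.Adj (k 0) (h i) ∨ G.Adj (k m) (h i)) → ∀ j < n,
      (j = i ∨ G.Adj (h i) (h j)) → ¬ Touch G K (h j))
    {i j : ℕ} (hli : l < i) (hir : i < r) (hj : j < n) (hjlr : j < l ∨ r < j)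
    (hTi : Touch G K (h i)) (hTj : Touch G K (h j)) : False := by
  have h4 := H.four
  obtain ⟨hk, hkh, hl0, hlf, hfg, hgr, hrn, hl, hf', hg, hr, hadj⟩ := J
  rcases Nat.eq_zero_or_pos m with rfl | hm
  · exact H.not_touch_wheel hθ hπ (v := k 0) (hkh 0 le_rfl) hK (hKk 0 le_rfl (by omega))
      (fun a ha hva => hav a ha (Or.inl hva)) hli hir hrn hj hjlr hl hr hTi hTj
  by_cases hf1 : f = l
  · subst hf1
    have r1 : ∀ s, f ≤ s → s < n → rotSeq h n f (s - f) = h s := fun s h1 h2 => by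
      rw [rotSeq_of_lt (by omega), Nat.sub_add_cancel h1]
    have r0 : rotSeq h n f 0 = h f := by simpa using r1 f le_rfl (by omega)
    have H' := H.rot (c := f) (by omega)
    have key : ∀ i < n, 0 < i → ∃ t < n, rotSeq h n f i = h t ∧ t ≠ f ∧ (t = i + f ∨ t < f) := by
      intro i hi hi0
      by_cases hif : i + f < n
      · exact ⟨i + f, hif, rotSeq_of_lt hif, by omega, by omega⟩
      · exact ⟨i + f - n, by omega, rotSeq_of_ge (by omega), by omega, by omega⟩
    obtain ⟨j', hj1, hj2, hj3⟩ : ∃ j', r - f < j' ∧ j' < n ∧ rotSeq h n f j' = h j := by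
      rcases hjlr with hjl | hjr
      · exact ⟨j + n - f, by omega, by omega, by
          rw [rotSeq_of_ge (by omega)]
          congr 1
          omega⟩
      · exact ⟨j - f, by omega, by omega, r1 j (by omega) hj⟩
    have av0 := H.rot_avoid (l := f) (v := k 0) (by omega)
      (fun a ha hva => hav a ha (Or.inl hva))
    refine H'.not_touch_jump hθ hπ hk (fun s hs i hi e => ?_) (by rwa [r0])
      (fun s hs e => ?_) (fun s hs i hi hi0 e => ?_) (g := g - f) (r := r - f) (by omega) (by omega)
      (by rwa [r1 g (by omega) (by omega)]) (by rwa [r1 r (by omega) (by omega)])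
      (fun i hi hi0 e => ?_) hK (av0 0 (by omega) (by rwa [r0]) 0 (by omega) (Or.inl rfl))
      (av0 0 (by omega) (by rwa [r0]) 1 (by omega) (Or.inr (H'.adj_succ (by omega))))
      (av0 0 (by omega) (by rwa [r0]) _ (by omega) (Or.inr H'.adj_last.symm))
      (hKk 0 (by omega) (by omega)) (hKk m (by omega) (by omega))
      (H.rot_avoid (by omega) (fun a ha hva => hav a ha (Or.inr hva)))
      (i := i - f) (j := j') (by omega) hj1 hj2 (by rwa [r1 i (by omega) (by omega)])
      (by rwa [hj3])
    · obtain ⟨j, hj, e'⟩ := exists_eq_rot (h := h) (c := f) (by omega) hi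
      exact hkh s hs j hj (e.trans e')
    · rw [r0] at e
      have := hadj s hs f (by omega) e
      omega
    · obtain ⟨t, ht, e', htf, -⟩ := key i hi hi0
      rw [e'] at e
      have := hadj s hs t ht e
      omega
    · obtain ⟨t, ht, e', htf, hti⟩ := key i hi hi0
      rw [e'] at e
      have := hadj m le_rfl t ht e
      omega
  · have hif : f < i := by
      by_contra hif
      have : i ≠ f := by
        rintro rfl
        exact hav i (by omega) (Or.inl hf') i (by omega) (Or.inl rfl) hTi
      exact H.not_touch_wheel hθ hπ (v := k 0) (hkh 0 (by omega)) hK (hKk 0 (by omega) (by omega))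
        (fun a ha hva => hav a ha (Or.inl hva)) hli (r := f) (by omega) (by omega) hj (by omega)
        hl hf' hTi hTj
    have H' := H.short (v := k 0) (l := l) (f := f) (hkh 0 (by omega)) (by omega) (by omega)
      (by omega) hl hf' (fun i hi h1 e => by
        have := hadj 0 (by omega) i hi e
        omega)
    have s0 : shortSeq h n f (k 0) 0 = k 0 := if_pos rfl
    have s1 : ∀ t, f ≤ t → t < n → shortSeq h n f (k 0) (t + 1 - f) = h t := by
      intro t h1 h2
      unfold shortSeq
      rw [if_neg (by omega), rotSeq_of_lt (by omega)]
      congr 1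
      omega
    have s2 : ∀ t, t ≤ l → shortSeq h n f (k 0) (t + n + 1 - f) = h t := by
      intro t h1
      unfold shortSeq
      rw [if_neg (by omega), rotSeq_of_ge (by omega)]
      congr 1
      omega
    have key : ∀ i, 0 < i → i < n - f + l + 2 → ∃ t < n, shortSeq h n f (k 0) i = h t ∧
        (t + 1 = i + f ∨ t ≤ l) := by
      intro i hi0 hi
      by_cases hin : i + f ≤ n
      · exact ⟨i + f - 1, by omega, by rw [← s1 _ (by omega) (by omega)]; congr 1; omega,
          by omega⟩
      · exact ⟨i + f - 1 - n, by omega, by rw [← s2 _ (by omega)]; congr 1; omega, by omega⟩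
    obtain ⟨j', hj1, hj2, hj3⟩ : ∃ j', r + 1 - f < j' ∧ j' < n - f + l + 2 ∧
        shortSeq h n f (k 0) j' = h j := by
      rcases hjlr with hjl | hjr
      · exact ⟨j + n + 1 - f, by omega, by omega, s2 _ (by omega)⟩
      · exact ⟨j + 1 - f, by omega, by omega, s1 _ (by omega) hj⟩
    have sl : shortSeq h n f (k 0) (n - f + l + 2 - 1) = h l := by
      rw [← s2 l le_rfl]
      congr 1
      omega
    have sf : shortSeq h n f (k 0) 1 = h f := by
      rw [← s1 f le_rfl (by omega)]
      congr 1
      omega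
    have tl := hav l (by omega) (Or.inl hl) l (by omega) (Or.inl rfl)
    have tf := hav f (by omega) (Or.inl hf') f (by omega) (Or.inl rfl)
    have t0 := hKk 0 (by omega) (by omega)
    refine H'.not_touch_jump hθ hπ (k := fun s => k (s + 1)) (m := m - 1)
      ⟨fun a ha b hb e => ?_, fun a ha b hb => ?_⟩ (fun s hs i hi e => ?_) ?_
      (fun s hs e => ?_) (fun s hs i hi hi0 e => ?_) (g := g + 1 - f) (r := r + 1 - f)
      (by omega) (by omega) ?_ ?_ (fun i hi hi0 e => ?_) hK (by rwa [s0]) (by rwa [sf])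
      (by rwa [sl]) (hKk _ (by omega) (by omega)) (hKk _ (by omega) (by omega))
      (fun a ha e b hb hab => ?_) (i := i + 1 - f) (j := j') (by omega) hj1 hj2
      (by rwa [s1 i (by omega) (by omega)]) (by rwa [hj3])
    · have := hk.1 _ (by omega) _ (by omega) e
      omega
    · rw [hk.2 _ (by omega) _ (by omega)]
      omega
    · rcases Nat.eq_zero_or_pos i with rfl | hi0
      · have := hk.1 _ (by omega) _ (by omega) (e.trans s0)
        omega
      · obtain ⟨t, ht, e', -⟩ := key i hi0 hi
        exact hkh _ (by omega) t ht (e.trans e')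
    · rw [s0]
      exact (hk.2 _ (by omega) _ (by omega)).2 (by omega)
    · rw [s0] at e
      have := (hk.2 _ (by omega) _ (by omega)).1 e
      omega
    · obtain ⟨t, ht, e', -⟩ := key i hi0 hi
      rw [e'] at e
      have := hadj _ (by omega) t ht e
      omega
    · simp only [Nat.sub_add_cancel hm]
      rwa [s1 g (by omega) (by omega)]
    · simp only [Nat.sub_add_cancel hm]
      rwa [s1 r (by omega) (by omega)]
    · obtain ⟨t, ht, e', h3⟩ := key i hi0 hi
      simp only [Nat.sub_add_cancel hm] at e
      rw [e'] at e
      have := hadj _ (by omega) t ht e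
      omega
    · simp only [Nat.sub_add_cancel hm] at e
      rcases Nat.eq_zero_or_pos b with rfl | hb0
      · rwa [s0]
      obtain ⟨t, ht, e', h3⟩ := key b hb0 hb
      rcases Nat.eq_zero_or_pos a with rfl | ha0
      · rcases hab with rfl | hab
        · rwa [s0]
        · rw [s0, e'] at hab
          rw [e']
          exact hav t ht (Or.inl hab) t ht (Or.inl rfl)
      · obtain ⟨u, hu, e'', h3⟩ := key a ha0 ha
        rw [e'']at e
        rw [e', e''] at hab
        rw [e']
        refine hav u hu (Or.inr e) t ht (hab.imp ?_ id)
        rintro rfl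
        exact H.inj _ ht _ hu (e'.symm.trans e'')

lemma Hole.not_touch_of_jump (H : Hole G h n) (hθ : ¬ ContainsTheta G)
    (hπ : ¬ ContainsPrism G) (J : Jump G h n k m l f g r) (hK : Linked G K)
    (hKk : ∀ s ≤ m, s ≤ 1 ∨ m ≤ s + 1 → ¬ Touch G K (k s))
    (hav : ∀ i < n, (G.Adj (k 0) (h i) ∨ G.Adj (k m) (h i)) → ∀ j < n,
      (j = i ∨ G.Adj (h i) (h j)) → ¬ Touch G K (h j))
    {i j : ℕ} (hli : l < i) (hir : i < r) (hj : j < n) (hjlr : j < l ∨ r < j)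
    (hTi : Touch G K (h i)) (hTj : Touch G K (h j)) : False := by
  have h4 := H.four
  obtain ⟨hk, hkh, hl0, hlf, hfg, hgr, hrn, hl, hf', hg, hr, hadj⟩ := id J
  rcases Nat.eq_zero_or_pos m with rfl | hm
  · exact H.not_touch_wheel hθ hπ (v := k 0) (hkh 0 le_rfl) hK (hKk 0 le_rfl (by omega))
      (fun a ha hva => hav a ha (Or.inl hva)) hli hir hrn hj hjlr hl hr hTi hTj
  by_cases hf : f = l + 1
  swap
  · exact H.not_touch_of_jump_of_ne hθ hπ J hf hK hKk hav hli hir hj hjlr hTi hTj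
  by_cases hg' : r = g + 1
  · subst hf hg'
    refine hπ (H.containsPrism_of_edges hk hkh (c := l) (d := g) (by omega) (by omega) (by omega)
      fun s hs i hi => ⟨fun e => ?_, ?_⟩)
    · have := hadj s hs i hi e
      omega
    · rintro (⟨rfl, rfl | rfl⟩ | ⟨rfl, rfl | rfl⟩) <;> assumption
  have fl : ∀ i < n, 0 < i → flipSeq h n (n - i) = h i := fun i h1 h2 => by
    rw [flipSeq_of_pos (by omega), show n - (n - i) = i by omega]
  obtain ⟨j', hj1, hj2, hj3⟩ : ∃ j' < n, (j' < n - r ∨ n - l < j') ∧ flipSeq h n j' = h j := by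
    rcases Nat.eq_zero_or_pos j with rfl | hj0
    · exact ⟨0, by omega, by omega, flipSeq_zero⟩
    · exact ⟨n - j, by omega, by omega, fl j hj hj0⟩
  refine H.flip.not_touch_of_jump_of_ne hθ hπ J.flip (by omega) hK
    (fun s hs h1 => hKk _ (by omega) (by omega)) (fun a ha hva b hb hab => ?_) (i := n - i)
    (j := j') (by omega) (by omega) hj1 hj2 (by rwa [fl i (by omega) (by omega)]) (by rwa [hj3])
  obtain ⟨a', ha', ea⟩ := exists_eq_flip (h := h) ha
  obtain ⟨b', hb', eb⟩ := exists_eq_flip (h := h) hb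
  rw [ea] at hva
  rw [eb]
  refine hav a' ha' ?_ b' hb' (hab.imp (fun e => ?_) fun e => ?_)
  · simpa [or_comm] using hva
  · subst e
    exact H.inj _ hb' _ ha' (eb.symm.trans ea)
  · rwa [ea, eb] at e

end Jumps

section Barriers

variable {G : SimpleGraph V} {h : ℕ → V} {n : ℕ}

lemma Hole.exists_jump (H : Hole G h n) {K : Set V} (hK : Linked G K) {x : ℕ}
    (hx : 2 ≤ x) (hxn : x + 2 ≤ n) (h0 : ¬ Touch G K (h 0)) (hKx : ¬ Touch G K (h x))
    {i j : ℕ} (hi : 0 < i) (hix : i < x) (hxj : x < j) (hjn : j < n) (hTi : Touch G K (h i))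
    (hTj : Touch G K (h j)) :
    ∃ k m l f g r, Jump G h n k m l f g r ∧ f < x ∧ x < g ∧ ∀ s ≤ m, k s ∈ K := by
  obtain ⟨x₀, hx₀, hx₀'⟩ := hTi
  obtain ⟨y₀, hy₀, hy₀'⟩ := hTj
  obtain ⟨k, m, hk, hkK, ⟨i, j, hi, hix, hxj, hjn, hki, hkj⟩, hmin⟩ :=
    exists_min_seq (fun u v => ∃ i j, 0 < i ∧ i < x ∧ x < j ∧ j < n ∧
      (u = h i ∨ G.Adj u (h i)) ∧ (v = h j ∨ G.Adj v (h j))) hK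
      ⟨x₀, hx₀, y₀, hy₀, i, j, hi, hix, hxj, hjn, hx₀', hy₀'⟩
  have hq : ∀ s ≤ m, ∀ q < n, (k s = h q ∨ G.Adj (k s) (h q)) → q ≠ 0 ∧ q ≠ x := by
    refine fun s hs q hq e => ⟨?_, ?_⟩
    · rintro rfl
      exact h0 ⟨k s, hkK s hs, e⟩
    · rintro rfl
      exact hKx ⟨k s, hkK s hs, e⟩
  have hkh : ∀ s ≤ m, ∀ q < n, k s ≠ h q := by
    intro s hs q hqn e
    have hq0 := hq s hs q hqn (Or.inl e)
    have hkk : ∀ a b, a < n → b < n → h a = h b ∨ G.Adj (h a) (h b) →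
        a = b ∨ a + 1 = b ∨ b + 1 = a ∨ a = 0 ∨ b = 0 := by
      intro a b ha hb hab
      rcases hab with hab | hab
      · exact Or.inl (H.inj a ha b hb hab)
      · have := (H.adj a ha b hb).1 hab
        omega
    by_cases hqx : q < x
    · have h1 := hmin s hs m le_rfl ⟨q, j, by omega, hqx, hxj, hjn, Or.inl e, hkj⟩
      obtain rfl : s = 0 := by omega
      rcases Nat.eq_zero_or_pos m with rfl | hm
      · rw [e] at hkj
        have := hkk q j hqn hjn hkj
        omega
      · have := hmin 1 (by omega) m le_rfl ⟨q, j, by omega, hqx, hxj, hjn, Or.inr (by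
          rw [← e]
          exact (hk.2 _ (by omega) _ (by omega)).2 (by omega)), hkj⟩
        omega
    · have h1 := hmin 0 (by omega) s hs ⟨i, q, hi, hix, by omega, hqn, hki, Or.inl e⟩
      obtain rfl : s = m := by omega
      rcases Nat.eq_zero_or_pos s with rfl | hm
      · rw [e] at hki
        have := hkk q i hqn (by omega) hki
        omega
      · have := hmin 0 (by omega) (s - 1) (by omega) ⟨i, q, hi, hix, by omega, hqn, hki,
          Or.inr (by
            rw [← e]
            exact (hk.2 _ (by omega) _ (by omega)).2 (by omega))⟩
        omega
  replace hki := hki.resolve_left (hkh 0 (by omega) i (by omega))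
  replace hkj := hkj.resolve_left (hkh m le_rfl j hjn)
  obtain ⟨l, f, hlf, -, hl, hf, hlf'⟩ := exists_first_last
    (p := fun s => 0 < s ∧ s < x ∧ G.Adj (k 0) (h s)) (N := n) ⟨i, by omega, hi, hix, hki⟩
  obtain ⟨g, r, hgr, -, hg, hr, hgr'⟩ := exists_first_last
    (p := fun s => x < s ∧ s < n ∧ G.Adj (k m) (h s)) (N := n) ⟨j, by omega, hxj, hjn, hkj⟩
  refine ⟨k, m, l, f, g, r, ⟨hk, hkh, hl.1, hlf, by omega, hgr, hr.2.1, hl.2.2, hf.2.2, hg.2.2,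
    hr.2.2, fun s hs q hqn e => ?_⟩, hf.2.1, hg.1, hkK⟩
  have hq0 := hq s hs q hqn (Or.inr e)
  by_cases hqx : q < x
  · have h1 := hmin s hs m le_rfl ⟨q, j, by omega, hqx, hxj, hjn, Or.inr e, Or.inr hkj⟩
    obtain rfl : s = 0 := by omega
    exact Or.inl ⟨rfl, hlf' q (by omega) ⟨by omega, hqx, e⟩⟩
  · have h1 := hmin 0 (by omega) s hs ⟨i, q, hi, hix, by omega, hqn, Or.inr hki, Or.inr e⟩
    obtain rfl : s = m := by omega
    exact Or.inr ⟨rfl, hgr' q (by omega) ⟨by omega, hqn, e⟩⟩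

open Classical in
lemma Hole.card_nbrs_le (H : Hole G h n) {t : ℕ} (ht : ¬ ContainsK1t G t) (v : V) :
    ((Finset.range n).filter fun i => G.Adj v (h i)).card ≤ 2 * t := by
  have h4 := H.four
  have key : ∀ b, ((Finset.range (n - 1)).filter fun i => i % 2 = b ∧ G.Adj v (h i)).card < t := by
    intro b
    by_contra hb
    obtain ⟨S, hS, hSt⟩ := Finset.exists_subset_card_eq (not_lt.1 hb)
    have hS' : ∀ i ∈ S, i < n - 1 ∧ i % 2 = b ∧ G.Adj v (h i) := fun i hi => by
      simpa using hS hi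
    refine ht ⟨v, S.image h, ?_, ?_, ?_, ?_⟩
    · rw [Finset.card_image_of_injOn, hSt]
      intro i hi j hj e
      have := hS' i hi
      have := hS' j hj
      exact H.inj i (by omega) j (by omega) e
    · intro hv
      obtain ⟨i, hi, e⟩ := Finset.mem_image.1 hv
      have := (hS' i hi).2.2
      rw [e] at this
      exact G.irrefl this
    · intro x hx
      obtain ⟨i, hi, rfl⟩ := Finset.mem_image.1 hx
      exact (hS' i hi).2.2
    · intro x hx y hy _
      obtain ⟨i, hi, rfl⟩ := Finset.mem_image.1 hx
      obtain ⟨j, hj, rfl⟩ := Finset.mem_image.1 hy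
      have h1 := hS' i hi
      have h2 := hS' j hj
      rw [H.adj _ (by omega) _ (by omega)]
      omega
  have hsub : ((Finset.range n).filter fun i => G.Adj v (h i)) ⊆
      ((Finset.range (n - 1)).filter fun i => i % 2 = 0 ∧ G.Adj v (h i)) ∪
      ((Finset.range (n - 1)).filter fun i => i % 2 = 1 ∧ G.Adj v (h i)) ∪ {n - 1} := by
    intro i hi
    simp only [Finset.mem_filter, Finset.mem_range, Finset.mem_union, Finset.mem_singleton] at hi ⊢
    have := hi.2
    by_cases hin : i = n - 1
    · exact Or.inr hin
    · rcases Nat.mod_two_eq_zero_or_one i with h | h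
      · exact Or.inl (Or.inl ⟨by omega, h, this⟩)
      · exact Or.inl (Or.inr ⟨by omega, h, this⟩)
  have h1 := key 0
  have h2 := key 1
  have h3 := Finset.card_le_card hsub
  have h5 := Finset.card_union_le
    (((Finset.range (n - 1)).filter fun i => i % 2 = 0 ∧ G.Adj v (h i)) ∪
      ((Finset.range (n - 1)).filter fun i => i % 2 = 1 ∧ G.Adj v (h i))) {n - 1}
  have h6 := Finset.card_union_le
    ((Finset.range (n - 1)).filter fun i => i % 2 = 0 ∧ G.Adj v (h i))
    ((Finset.range (n - 1)).filter fun i => i % 2 = 1 ∧ G.Adj v (h i))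
  rw [Finset.card_singleton] at h5
  omega

/-- If a connected set meets both sides of a hole without touching `h 0` and `h x`, then boundedly
many vertices separate an interval around `x` from the rest of the hole. -/
lemma Hole.exists_barrier (H : Hole G h n) {t : ℕ} (hG : MemCt t G) {K₀ : Set V}
    (hK₀ : Linked G K₀) {x : ℕ} (hx : 2 ≤ x) (hxn : x + 2 ≤ n) (h0 : ¬ Touch G K₀ (h 0))
    (hKx : ¬ Touch G K₀ (h x)) {i j : ℕ} (hi : 0 < i) (hix : i < x) (hxj : x < j) (hjn : j < n)
    (hTi : Touch G K₀ (h i)) (hTj : Touch G K₀ (h j)) :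
    ∃ l r, 0 < l ∧ l < x ∧ x < r ∧ r < n ∧ Touch G K₀ (h l) ∧ Touch G K₀ (h r) ∧
      ∃ Y : Finset V, Y.card ≤ 12 * t + 4 ∧ ∀ K, Linked G K → (∀ y ∈ Y, ¬ Touch G K y) →
        ¬ Touch G K (h l) ∧ ¬ Touch G K (h r) ∧ ∀ i j, l < i → i < r → j < n → (j < l ∨ r < j) →
          Touch G K (h i) → Touch G K (h j) → False := by
  classical
  obtain ⟨hθ, hπ, ht⟩ := hG
  obtain ⟨k, m, l, f, g, r, J, hfx, hxg, hkK⟩ :=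
    H.exists_jump hK₀ hx hxn h0 hKx hi hix hxj hjn hTi hTj
  have hlf := J.le₁
  have hgr := J.le₂
  have hrn := J.lt_n
  refine ⟨l, r, J.pos, by omega, by omega, J.lt_n, ⟨_, hkK 0 (by omega), Or.inr J.adj_l⟩,
    ⟨_, hkK m le_rfl, Or.inr J.adj_r⟩, ?_⟩
  set N : Finset ℕ := ((Finset.range n).filter fun i => G.Adj (k 0) (h i)) ∪
    ((Finset.range n).filter fun i => G.Adj (k m) (h i)) with hN
  have hNmem : ∀ a, a ∈ N ↔ a < n ∧ (G.Adj (k 0) (h a) ∨ G.Adj (k m) (h a)) := fun a => by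
    simp [hN, and_or_left]
  have hNcard : N.card ≤ 4 * t := by
    have h1 := H.card_nbrs_le ht (k 0)
    have h2 := H.card_nbrs_le ht (k m)
    have h3 := Finset.card_union_le ((Finset.range n).filter fun i => G.Adj (k 0) (h i))
      ((Finset.range n).filter fun i => G.Adj (k m) (h i))
    rw [← hN] at h3
    omega
  refine ⟨({0, 1, m - 1, m} : Finset ℕ).image k ∪ (N.image h ∪ (N.image (fun i => h ((i + 1) % n)) ∪
    N.image (fun i => h ((i + (n - 1)) % n)))), ?_, fun K hK hY => ?_⟩
  · have h1 : (({0, 1, m - 1, m} : Finset ℕ).image k).card ≤ 4 :=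
      Finset.card_image_le.trans Finset.card_le_four
    have h2 : (N.image h).card ≤ N.card := Finset.card_image_le
    have h3 : (N.image (fun i => h ((i + 1) % n))).card ≤ N.card := Finset.card_image_le
    have h4 : (N.image (fun i => h ((i + (n - 1)) % n))).card ≤ N.card := Finset.card_image_le
    refine (Finset.card_union_le _ _).trans ((Nat.add_le_add h1 ((Finset.card_union_le _ _).trans
      (Nat.add_le_add h2 ((Finset.card_union_le _ _).trans (Nat.add_le_add h3 h4))))).trans ?_)
    omega
  simp only [Finset.mem_union, Finset.mem_image] at hY
  have hKk : ∀ s ≤ m, s ≤ 1 ∨ m ≤ s + 1 → ¬ Touch G K (k s) := fun s hs h1 =>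
    hY _ (Or.inl ⟨s, by simp; omega, rfl⟩)
  have hav : ∀ i < n, (G.Adj (k 0) (h i) ∨ G.Adj (k m) (h i)) → ∀ j < n,
      (j = i ∨ G.Adj (h i) (h j)) → ¬ Touch G K (h j) := by
    intro a ha hva b hb hab
    have haN := (hNmem a).2 ⟨ha, hva⟩
    rcases hab with rfl | hab
    · exact hY _ (Or.inr (Or.inl ⟨b, haN, rfl⟩))
    · have hab' := (H.adj a ha b hb).1 hab
      by_cases h1 : (a + 1) % n = b
      · exact hY _ (Or.inr (Or.inr (Or.inl ⟨a, haN, by rw [h1]⟩)))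
      · refine hY _ (Or.inr (Or.inr (Or.inr ⟨a, haN, ?_⟩)))
        rcases hab' with rfl | rfl | ⟨rfl, rfl⟩ | ⟨rfl, rfl⟩
        · rw [Nat.mod_eq_of_lt hb] at h1
          exact (h1 rfl).elim
        · rw [show b + 1 + (n - 1) = b + n by omega, Nat.add_mod_right, Nat.mod_eq_of_lt hb]
        · rw [show 0 + (b + 1 - 1) = b by omega, Nat.mod_eq_of_lt hb]
        · simp at h1
  exact ⟨hav l (by omega) (Or.inl J.adj_l) l (by omega) (Or.inl rfl),
    hav r (by omega) (Or.inr J.adj_r) r (by omega) (Or.inl rfl), fun i j h1 h2 h3 h4 h5 h6 =>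
    H.not_touch_of_jump hθ hπ J hK hKk hav h1 h2 h3 h4 h5 h6⟩

end Barriers

section Havens

variable {G : SimpleGraph V} {h : ℕ → V} {n : ℕ}

/-- A monotone choice of connected sets avoiding the closed neighborhoods of all sets of at most
`c` vertices. -/
structure Haven (G : SimpleGraph V) (c : ℕ) (β : Finset V → Set V) : Prop where
  linked : ∀ Y : Finset V, Y.card ≤ c → Linked G (β Y)
  avoid : ∀ Y : Finset V, Y.card ≤ c → ∀ y ∈ Y, ¬ Touch G (β Y) y
  mono : ∀ Y Z : Finset V, Y ⊆ Z → Z.card ≤ c → β Z ⊆ β Y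

lemma Touch.mono {K L : Set V} {u : V} (h : Touch G K u) (hKL : K ⊆ L) : Touch G L u := by
  obtain ⟨x, hx, hxu⟩ := h
  exact ⟨x, hKL hx, hxu⟩

lemma Hole.exists_haven_not_touch (H : Hole G h n) {t : ℕ} (hG : MemCt t G)
    {β : Finset V → Set V} (hβ : Haven G (3 * (12 * t + 4)) β) :
    ∃ Y : Finset V, Y.card ≤ 3 * (12 * t + 4) ∧ ∀ i < n, ¬ Touch G (β Y) (h i) := by
  classical
  by_contra hτ
  push Not at hτ
  have h4 := H.four
  have card2 : ∀ {Y Z : Finset V}, Y.card ≤ 12 * t + 4 → Z.card ≤ 12 * t + 4 →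
      (Y ∪ Z).card ≤ 3 * (12 * t + 4) := fun {Y Z} hY hZ => by
    have := Finset.card_union_le Y Z
    omega
  -- a shortest interval which contains all attachments of some bounded choice
  obtain ⟨s, e, hs, hen, ⟨YI, hYI, hI⟩, hmin⟩ : ∃ s e, 2 ≤ s ∧ e + 2 ≤ n ∧
      (∃ Y : Finset V, Y.card ≤ 12 * t + 4 ∧ ∀ i < n, Touch G (β Y) (h i) → s ≤ i ∧ i ≤ e) ∧
      ∀ s' e', 2 ≤ s' → e' + 2 ≤ n → (∃ Y : Finset V, Y.card ≤ 12 * t + 4 ∧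
        ∀ i < n, Touch G (β Y) (h i) → s' ≤ i ∧ i ≤ e') → e - s ≤ e' - s' := by
    have hex : ∃ d s e, 2 ≤ s ∧ e + 2 ≤ n ∧ (∃ Y : Finset V, Y.card ≤ 12 * t + 4 ∧
        ∀ i < n, Touch G (β Y) (h i) → s ≤ i ∧ i ≤ e) ∧ e - s = d := by
      have hc : ({h 0, h 1, h (n - 1)} : Finset V).card ≤ 12 * t + 4 :=
        Finset.card_le_three.trans (by omega)
      refine ⟨_, 2, n - 2, le_rfl, by omega, ⟨{h 0, h 1, h (n - 1)}, hc, fun i hi hT => ?_⟩, rfl⟩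
      have hav := hβ.avoid _ (hc.trans (by omega))
      by_contra hcon
      have : i = 0 ∨ i = 1 ∨ i = n - 1 := by omega
      rcases this with rfl | rfl | rfl <;> exact hav _ (by simp) hT
    obtain ⟨s, e, h1, h2, h3, h5⟩ := Nat.find_spec hex
    refine ⟨s, e, h1, h2, h3, fun s' e' h1' h2' h3' => ?_⟩
    rw [h5]
    exact Nat.find_min' hex ⟨s', e', h1', h2', h3', rfl⟩
  have hIu : ∀ {Y : Finset V}, (YI ∪ Y).card ≤ 3 * (12 * t + 4) → ∀ i < n,
      Touch G (β (YI ∪ Y)) (h i) → s ≤ i ∧ i ≤ e := fun {Y} hY i hi hT =>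
    hI i hi (hT.mono (hβ.mono _ _ Finset.subset_union_left hY))
  have side : ∀ q, s ≤ q → q ≤ e → ∀ d l r, l ≤ q → q ≤ r → s ≤ l → r ≤ e →
      e + l ≤ s + r + d → (∃ Y : Finset V, Y.card ≤ 12 * t + 4 ∧ ∀ i, l ≤ i → i ≤ r →
        ¬ Touch G (β Y) (h i)) →
      ∃ Y : Finset V, Y.card ≤ 12 * t + 4 ∧
        ((∀ i < n, Touch G (β (YI ∪ Y)) (h i) → q < i) ∨
        (∀ i < n, Touch G (β (YI ∪ Y)) (h i) → i < q)) := by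
    intro q hsq hqe d
    induction d with
    | zero =>
      rintro l r hl hr hsl hre hd ⟨Y, hY, hlr⟩
      exfalso
      obtain ⟨i, hi, hT⟩ := hτ (YI ∪ Y) (card2 hYI hY)
      have := hIu (card2 hYI hY) i hi hT
      exact hlr i (by omega) (by omega)
        (hT.mono (hβ.mono _ _ Finset.subset_union_right (card2 hYI hY)))
    | succ d ih =>
      rintro l r hl hr hsl hre hd ⟨Y, hY, hlr⟩
      have hYY := card2 hYI hY
      have hlr' : ∀ i, Touch G (β (YI ∪ Y)) (h i) → i < l ∨ r < i := fun i hT => by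
        by_contra hcon
        exact hlr i (by omega) (by omega)
          (hT.mono (hβ.mono _ _ Finset.subset_union_right hYY))
      by_cases hleft : ∃ i < n, Touch G (β (YI ∪ Y)) (h i) ∧ i < l
      swap
      · push Not at hleft
        refine ⟨Y, hY, Or.inl fun i hi hT => ?_⟩
        have := hleft i hi hT
        have := hlr' i hT
        omega
      by_cases hright : ∃ i < n, Touch G (β (YI ∪ Y)) (h i) ∧ r < i
      swap
      · push Not at hright
        refine ⟨Y, hY, Or.inr fun i hi hT => ?_⟩
        have := hright i hi hT
        have := hlr' i hT
        omega
      obtain ⟨i, hi, hTi, hil⟩ := hleft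
      obtain ⟨j, hj, hTj, hrj⟩ := hright
      have hi' := hIu hYY i hi hTi
      have hj' := hIu hYY j hj hTj
      obtain ⟨l', r', h1, h2, h3, h5, h6, h7, Z, hZ, hsep⟩ := H.exists_barrier hG
        (hβ.linked _ hYY) (x := q) (by omega) (by omega)
        (fun hT => by have := hIu hYY 0 (by omega) hT; omega)
        (fun hT => by have := hlr' q hT; omega) (i := i) (j := j) (by omega) (by omega)
        (by omega) hj hTi hTj
      have h6' := hIu hYY l' (by omega) h6
      have h7' := hIu hYY r' (by omega) h7
      have h6'' := hlr' l' h6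
      have h7'' := hlr' r' h7
      have hZ' : Z.card ≤ 3 * (12 * t + 4) := by omega
      obtain ⟨nl, nr, hno⟩ := hsep (β Z) (hβ.linked _ hZ') (hβ.avoid _ hZ')
      have hne : ∀ i, Touch G (β Z) (h i) → i ≠ l' ∧ i ≠ r' := by
        refine fun i hT => ⟨?_, ?_⟩ <;> rintro rfl
        · exact nl hT
        · exact nr hT
      by_cases hin : ∃ i, l' < i ∧ i < r' ∧ Touch G (β Z) (h i)
      · obtain ⟨a, ha1, ha2, ha3⟩ := hin
        have := hmin (l' + 1) (r' - 1) (by omega) (by omega) ⟨Z, hZ, fun b hb hTb => by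
          have := hne b hTb
          by_contra hcon
          exact hno a b ha1 ha2 hb (by omega) ha3 hTb⟩
        omega
      · refine ih l' r' (by omega) (by omega) (by omega) (by omega) (by omega)
          ⟨Z, hZ, fun b hb1 hb2 hTb => hin ⟨b, ?_, ?_, hTb⟩⟩ <;>
        · have := hne b hTb
          omega
  have side' : ∀ q, s ≤ q → q ≤ e → ∃ Y : Finset V, Y.card ≤ 12 * t + 4 ∧
        ((∀ i < n, Touch G (β (YI ∪ Y)) (h i) → q < i) ∨
        (∀ i < n, Touch G (β (YI ∪ Y)) (h i) → i < q)) := by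
    intro q hsq hqe
    refine side q hsq hqe (e - s) q q le_rfl le_rfl hsq hqe (by omega)
      ⟨{h q}, by simp, fun i h1 h2 => ?_⟩
    obtain rfl : i = q := by omega
    exact hβ.avoid _ (by simp; omega) _ (by simp)
  have right : ∀ d, s + d ≤ e → ∃ Y : Finset V, Y.card ≤ 12 * t + 4 ∧
      ∀ i < n, Touch G (β (YI ∪ Y)) (h i) → s + d < i := by
    intro d
    induction d with
    | zero =>
      intro hd
      obtain ⟨Y, hY, h1 | h1⟩ := side' s le_rfl hd
      · exact ⟨Y, hY, h1⟩
      · obtain ⟨i, hi, hT⟩ := hτ (YI ∪ Y) (card2 hYI hY)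
        have := hIu (card2 hYI hY) i hi hT
        have := h1 i hi hT
        omega
    | succ d ih =>
      intro hd
      obtain ⟨Y, hY, hYr⟩ := ih (by omega)
      obtain ⟨Z, hZ, h1 | h1⟩ := side' (s + (d + 1)) (by omega) hd
      · exact ⟨Z, hZ, h1⟩
      · have hc : (YI ∪ (Y ∪ Z)).card ≤ 3 * (12 * t + 4) := by
          have h1 := Finset.card_union_le YI (Y ∪ Z)
          have h2 := Finset.card_union_le Y Z
          omega
        obtain ⟨i, hi, hT⟩ := hτ _ hc
        have h2 := hYr i hi (hT.mono (hβ.mono _ _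
          (Finset.union_subset_union_right Finset.subset_union_left) hc))
        have h3 := h1 i hi (hT.mono (hβ.mono _ _
          (Finset.union_subset_union_right Finset.subset_union_right) hc))
        omega
  have hse : s ≤ e := by
    obtain ⟨i, hi, hT⟩ := hτ YI (by omega)
    have := hI i hi hT
    omega
  obtain ⟨Y, hY, hYr⟩ := right (e - s) (by omega)
  obtain ⟨i, hi, hT⟩ := hτ (YI ∪ Y) (card2 hYI hY)
  have := hIu (card2 hYI hY) i hi hT
  have := hYr i hi hT
  omega

end Havens

section BigComponents

variable {G : SimpleGraph V} {A K L D D' : Set V} {X Y Z : Set V} {w : V → ℝ}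

lemma Linked.connected (hK : Linked G K) (hne : K.Nonempty) : (G.induce K).Connected := by
  have := hne.to_subtype
  refine ⟨fun x y => ?_⟩
  obtain ⟨p, hp⟩ := hK x x.2 y y.2
  exact ⟨p.induce K hp⟩

lemma linked_of_connected (hK : (G.induce K).Connected) : Linked G K := by
  intro u hu v hv
  obtain ⟨p⟩ := hK.preconnected ⟨u, hu⟩ ⟨v, hv⟩
  have hp : ∀ z ∈ (p.map (Embedding.induce K).toHom).support, z ∈ K := by
    intro z hz
    rw [Walk.support_map, List.mem_map] at hz
    obtain ⟨y, -, rfl⟩ := hz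
    exact y.2
  exact ⟨_, hp⟩

lemma Linked.union (hK : Linked G K) (hL : Linked G L) (h : (K ∩ L).Nonempty) :
    Linked G (K ∪ L) := by
  obtain ⟨c, hcK, hcL⟩ := h
  have key : ∀ u ∈ K ∪ L, Reaches G (K ∪ L) u c := by
    rintro u (hu | hu)
    · exact (hK u hu c hcK).mono Set.subset_union_left
    · exact (hL u hu c hcL).mono Set.subset_union_right
  exact fun u hu v hv => (key u hu).trans (key v hv).symm

lemma Linked.insert_adj (hK : Linked G K) {u x : V} (hx : x ∈ K) (h : G.Adj u x) :
    Linked G (insert u K) := by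
  have hux : Linked G {u, x} := by
    rintro a (rfl | rfl) b (rfl | rfl)
    · exact reaches_refl (by simp)
    · exact reaches_adj (by simp) (by simp) h
    · exact reaches_adj (by simp) (by simp) h.symm
    · exact reaches_refl (by simp)
  have := hux.union hK ⟨x, by simp, hx⟩
  rwa [show ({u, x} : Set V) ∪ K = insert u K by
    ext z
    simp only [Set.mem_union, Set.mem_insert_iff, Set.mem_singleton_iff]
    constructor
    · rintro ((rfl | rfl) | h) <;> simp_all
    · rintro (rfl | h) <;> simp_all] at this

lemma linked_setOf_reaches (d : V) : Linked G {v | Reaches G A d v} := by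
  have key : ∀ v, Reaches G A d v → Reaches G {v | Reaches G A d v} d v := by
    intro v hv
    obtain ⟨B, hBA, hB, hd, hv⟩ := hv.linked
    exact (hB d hd v hv).mono fun z hz => (hB d hd z hz).mono hBA
  exact fun u hu v hv => (key u hu).symm.trans (key v hv)

lemma exists_adj_of_linked (hD : Linked G D) (hsub : D' ⊆ D) (hne : D'.Nonempty) (h : D' ≠ D) :
    ∃ u ∈ D, u ∉ D' ∧ ∃ x ∈ D', G.Adj u x := by
  obtain ⟨a, ha⟩ := hne
  obtain ⟨b, hb, hb'⟩ := Set.exists_of_ssubset (hsub.ssubset_of_ne h)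
  obtain ⟨k, m, rfl, rfl, hk, hadj⟩ := (hD a (hsub ha) b hb).exists_seq
  by_contra hcon
  push Not at hcon
  have key : ∀ i ≤ m, k i ∈ D' := by
    intro i
    induction i with
    | zero => exact fun _ => ha
    | succ i ih =>
      intro hi
      by_contra hn
      exact hcon _ (hk _ hi) hn _ (ih (by omega)) (hadj i hi).symm
  exact hb' (key m le_rfl)

lemma not_touch_iff_subset : (∀ y ∈ Y, ¬ Touch G K y) ↔ K ⊆ (ClosedNbhd G Y)ᶜ := by
  constructor
  · rintro h x hx (hY | ⟨a, ha, hxa⟩)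
    · exact h x hY ⟨x, hx, Or.inl rfl⟩
    · exact h a ha ⟨x, hx, Or.inr hxa⟩
  · rintro h y hy ⟨x, hx, rfl | hxy⟩
    · exact h hx (Or.inl hy)
    · exact h hx (Or.inr ⟨y, hy, hxy⟩)

variable [Fintype V]

/-- `D` is a component of `G \ N[Y]` of weight more than `1/2`. -/
structure Big (G : SimpleGraph V) (w : V → ℝ) (Y D : Set V) : Prop where
  linked : Linked G D
  avoid : ∀ y ∈ Y, ¬ Touch G D y
  maximal : ∀ K, Linked G K → (∀ y ∈ Y, ¬ Touch G K y) → (K ∩ D).Nonempty → K ⊆ D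
  heavy : 1 / 2 < wSum w D

lemma exists_big_of_not_balanced (h : ¬ BalancedSeparator G w (ClosedNbhd G Y)) :
    ∃ D, Big G w Y D := by
  unfold BalancedSeparator at h
  push Not at h
  obtain ⟨D, ⟨hne, hsub, hconn, hmax⟩, hw⟩ := h
  have hD := linked_of_connected hconn
  refine ⟨D, hD, not_touch_iff_subset.2 hsub, fun K hK hKY hKD => ?_, hw⟩
  have := hmax (K ∪ D) Set.subset_union_right
    (Set.union_subset (not_touch_iff_subset.1 hKY) hsub)
    ((hK.union hD hKD).connected (hKD.mono fun x hx => Or.inl hx.1))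
  rw [← this]
  exact Set.subset_union_left

lemma wSum_mono (hw : ∀ v, 0 ≤ w v) (h : K ⊆ L) : wSum w K ≤ wSum w L :=
  Finset.sum_le_sum fun v _ => Set.indicator_le_indicator_of_subset h hw v

lemma Big.nonempty (hD : Big G w Y D) : D.Nonempty := by
  rw [Set.nonempty_iff_ne_empty]
  rintro rfl
  have := hD.heavy
  simp only [wSum, Set.indicator_empty, Finset.sum_const_zero] at this
  norm_num at this

lemma Big.inter_nonempty (hD : Big G w Y D) (hD' : Big G w Z D') (hw : ∀ v, 0 ≤ w v)
    (hw1 : ∑ v, w v = 1) : (D ∩ D').Nonempty := by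
  rw [Set.nonempty_iff_ne_empty]
  intro h
  have h1 := hD.heavy
  have h2 := hD'.heavy
  have h3 : wSum w D + wSum w D' ≤ 1 := by
    rw [← hw1, wSum, wSum, ← Finset.sum_add_distrib]
    refine Finset.sum_le_sum fun v _ => ?_
    by_cases hv : v ∈ D
    · have hv' : v ∉ D' := fun hv' => (h ▸ ⟨hv, hv'⟩ : v ∈ (∅ : Set V))
      simp [hv, hv']
    · rw [Set.indicator_of_notMem hv, zero_add]
      exact Set.indicator_le_self' (fun _ _ => hw _) v
  linarith

lemma Big.exists_of_subset (hD : Big G w Y D) (hXY : X ⊆ Y) (hw : ∀ v, 0 ≤ w v) :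
    ∃ D', Big G w X D' := by
  obtain ⟨d, hd⟩ := hD.nonempty
  refine ⟨{v | Reaches G (ClosedNbhd G X)ᶜ d v}, linked_setOf_reaches d,
    not_touch_iff_subset.2 fun v hv => hv.mem_right, ?_, hD.heavy.trans_le (wSum_mono hw ?_)⟩
  · rintro K hK hKX ⟨x, hxK, hx⟩ y hy
    exact hx.trans ((hK x hxK y hy).mono (not_touch_iff_subset.1 hKX))
  · exact fun v hv => (hD.linked d hd v hv).mono
      (not_touch_iff_subset.1 fun y hy => hD.avoid y (hXY hy))

lemma Big.subset (hD : Big G w X D) (hD' : Big G w Y D') (hXY : X ⊆ Y) (hw : ∀ v, 0 ≤ w v)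
    (hw1 : ∑ v, w v = 1) : D' ⊆ D :=
  hD.maximal D' hD'.linked (fun y hy => hD'.avoid y (hXY hy)) (hD'.inter_nonempty hD hw hw1)

lemma Big.union_of_not_touch (hD : Big G w Y D) {X : Set V} (hX : ∀ x ∈ X, ¬ Touch G D x) :
    Big G w (Y ∪ X) D := by
  refine ⟨hD.linked, ?_, fun K hK hKY => hD.maximal K hK fun y hy => hKY y (Or.inl hy), hD.heavy⟩
  rintro y (hy | hy)
  exacts [hD.avoid y hy, hX y hy]

end BigComponents

section BigPaths

variable {G : SimpleGraph V} {w : V → ℝ}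

/-- The set of the first `k` values of a sequence. -/
def Pre (p : ℕ → V) (k : ℕ) : Set V := {x | ∃ i < k, x = p i}

lemma hole_of_seqs {p q : ℕ → V} {k m : ℕ} (hp : IsSeq G p k) (hq : IsSeq G q m) (hk : 2 ≤ k)
    (h0 : q 0 = p k) (hm : q m = p 0)
    (hsep : ∀ i, 0 < i → i < k → ∀ j, 0 < j → j < m → p i ≠ q j ∧ ¬ G.Adj (p i) (q j)) :
    Hole G (fun i => if i ≤ k then p i else q (i - k)) (k + m) := by
  have hm2 : 2 ≤ m := by
    by_contra hcon
    obtain rfl | rfl : m = 0 ∨ m = 1 := by omega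
    · have := hp.1 k le_rfl 0 (by omega) (h0.symm.trans hm)
      omega
    · have := (hq.2 0 (by omega) 1 le_rfl).2 (by omega)
      rw [h0, hm] at this
      have := (hp.2 k le_rfl 0 (by omega)).1 this
      omega
  have hcross : ∀ i ≤ k, ∀ j, 0 < j → j < m →
      p i ≠ q j ∧ (G.Adj (p i) (q j) ↔ (i = 0 ∧ j + 1 = m) ∨ (i = k ∧ j = 1)) := by
    intro i hi j hj hj'
    rcases Nat.eq_zero_or_pos i with rfl | hi0
    · rw [← hm]
      refine ⟨fun e => ?_, ?_⟩
      · have := hq.1 _ le_rfl _ hj'.le e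
        omega
      · rw [hq.2 _ le_rfl _ hj'.le]
        omega
    · rcases hi.eq_or_lt with rfl | hik
      · rw [← h0]
        refine ⟨fun e => ?_, ?_⟩
        · have := hq.1 _ (Nat.zero_le _) _ hj'.le e
          omega
        · rw [hq.2 _ (Nat.zero_le _) _ hj'.le]
          omega
      · obtain ⟨h1, h2⟩ := hsep i hi0 hik j hj hj'
        refine ⟨h1, iff_of_false h2 (by omega)⟩
  refine ⟨by omega, fun i hi j hj => ?_, fun i hi j hj => ?_⟩
  · split_ifs with h1 h2 h2 <;> intro e
    · exact hp.1 i h1 j h2 e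
    · exact ((hcross i h1 (j - k) (by omega) (by omega)).1 e).elim
    · exact ((hcross j h2 (i - k) (by omega) (by omega)).1 e.symm).elim
    · have := hq.1 _ (by omega) _ (by omega) e
      omega
  · split_ifs with h1 h2 h2
    · rw [hp.2 i h1 j h2]
      omega
    · rw [(hcross i h1 (j - k) (by omega) (by omega)).2]
      omega
    · rw [G.adj_comm, (hcross j h2 (i - k) (by omega) (by omega)).2]
      omega
    · rw [hq.2 _ (by omega) _ (by omega)]
      omega

variable [Fintype V]

lemma IsSeq.exists_not_big {N : ℕ} (hw : ∀ v, 0 ≤ w v) (hw1 : ∑ v, w v = 1) :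
    ∀ {p : ℕ → V} {i : ℕ} {D : Set V}, D.ncard ≤ N → IsSeq G p i → Big G w (Pre p i) D →
      Touch G D (p i) → ∃ (p : ℕ → V) (k : ℕ), IsSeq G p k ∧ ¬ ∃ D, Big G w (Pre p (k + 1)) D := by
  induction N with
  | zero =>
    intro p i D hN _ hD _
    have := hD.nonempty.ncard_pos
    omega
  | succ N ih =>
    intro p i D hN hp hD hT
    by_cases hnext : ∃ D, Big G w (Pre p (i + 1)) D
    swap
    · exact ⟨p, i, hp, hnext⟩
    obtain ⟨D', hD'⟩ := hnext
    have hpre : Pre p i ⊆ Pre p (i + 1) := by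
      rintro _ ⟨j, hj, rfl⟩
      exact ⟨j, by omega, rfl⟩
    have hsub := hD.subset hD' hpre hw hw1
    have hi : p i ∈ Pre p (i + 1) := ⟨i, by omega, rfl⟩
    have hne : D' ≠ D := by
      rintro rfl
      exact hD'.avoid _ hi hT
    obtain ⟨u, huD, huD', x, hx, hux⟩ := exists_adj_of_linked hD.linked hsub hD'.nonempty hne
    have hui : u ≠ p i := by
      rintro rfl
      exact hD'.avoid _ hi ⟨x, hx, Or.inr hux.symm⟩
    have hadj : G.Adj u (p i) := by
      by_contra hn
      refine huD' (hD'.maximal (insert u D') (hD'.linked.insert_adj hx hux) ?_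
        ⟨x, Or.inr hx, hx⟩ (Or.inl rfl))
      rintro _ ⟨j, hj, rfl⟩ ⟨z, rfl | hz, hzj⟩
      · rcases (Nat.lt_succ_iff.1 hj).eq_or_lt with rfl | hj
        · exact hzj.elim hui hn
        · exact hD.avoid _ ⟨j, hj, rfl⟩ ⟨z, huD, hzj⟩
      · exact hD'.avoid _ ⟨j, hj, rfl⟩ ⟨z, hz, hzj⟩
    have hfar : ∀ j < i, u ≠ p j ∧ ¬ G.Adj u (p j) := fun j hj =>
      ⟨fun e => hD.avoid _ ⟨j, hj, rfl⟩ ⟨u, huD, Or.inl e⟩,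
        fun e => hD.avoid _ ⟨j, hj, rfl⟩ ⟨u, huD, Or.inr e⟩⟩
    have hu : ∀ j ≤ i, u ≠ p j ∧ (G.Adj u (p j) ↔ j = i) := by
      intro j hj
      rcases hj.eq_or_lt with rfl | hj
      · exact ⟨hui, by simpa using hadj⟩
      · exact ⟨(hfar j hj).1, iff_of_false (hfar j hj).2 hj.ne⟩
    let p' : ℕ → V := fun j => if j ≤ i then p j else u
    have hp' : IsSeq G p' (i + 1) := by
      refine ⟨fun a ha b hb => ?_, fun a ha b hb => ?_⟩
      · dsimp only [p']
        split_ifs with h1 h2 h2 <;> intro e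
        · exact hp.1 a h1 b h2 e
        · exact ((hu a h1).1 e.symm).elim
        · exact ((hu b h2).1 e).elim
        · omega
      · dsimp only [p']
        split_ifs with h1 h2 h2
        · exact hp.2 a h1 b h2
        · rw [G.adj_comm, (hu a h1).2]
          omega
        · rw [(hu b h2).2]
          omega
        · exact iff_of_false (G.irrefl) (by omega)
    have hpre' : Pre p' (i + 1) = Pre p (i + 1) := by
      ext z
      constructor <;> rintro ⟨j, hj, rfl⟩ <;> exact ⟨j, hj, by simp [p', Nat.lt_succ_iff.1 hj]⟩
    have hcard : D'.ncard < D.ncard := Set.ncard_lt_ncard (hsub.ssubset_of_ne hne)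
    exact ih (by omega) hp' (hpre' ▸ hD') ⟨x, hx, Or.inr (by simpa [p'] using hux.symm)⟩

lemma exists_hole_of_forall_big {c : ℕ} (hc : 3 ≤ c) (hw : ∀ v, 0 ≤ w v) (hw1 : ∑ v, w v = 1)
    (hbig : ∀ Y : Finset V, Y.card ≤ c → ∃ D, Big G w Y D) :
    ∃ (h : ℕ → V) (n : ℕ), Hole G h n ∧ ¬ ∃ D, Big G w (Pre h n) D := by
  classical
  have hex : ∃ k, ∃ p : ℕ → V, IsSeq G p k ∧ ¬ ∃ D, Big G w (Pre p (k + 1)) D := by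
    obtain ⟨D, hD⟩ := hbig ∅ (by simp)
    obtain ⟨d, hd⟩ := hD.nonempty
    have hpre : Pre (fun _ : ℕ => d) 0 = ((∅ : Finset V) : Set V) := by
      ext z
      simp [Pre]
    obtain ⟨p, k, hp⟩ := IsSeq.exists_not_big (G := G) (p := fun _ => d) (i := 0) hw hw1 le_rfl
      ⟨fun i hi j hj _ => by omega, fun i hi j hj => iff_of_false G.irrefl (by omega)⟩
      (hpre ▸ hD) ⟨d, hd, Or.inl rfl⟩
    exact ⟨k, p, hp⟩
  obtain ⟨p, hp, hpn⟩ := Nat.find_spec hex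
  have hmin : ∀ l < Nat.find hex, ∀ p : ℕ → V, IsSeq G p l → ∃ D, Big G w (Pre p (l + 1)) D :=
    fun l hl p hp => by
      by_contra hcon
      exact Nat.find_min hex hl ⟨p, hp, hcon⟩
  set k := Nat.find hex
  have hk : 3 ≤ k := by
    by_contra hcon
    apply hpn
    have : Pre p (k + 1) = (((Finset.range (k + 1)).image p : Finset V) : Set V) := by
      ext z
      simp [Pre, eq_comm]
    rw [this]
    refine hbig _ (Finset.card_image_le.trans ?_)
    rw [Finset.card_range]
    omega
  obtain ⟨l, hl⟩ : ∃ l, k = l + 1 := ⟨k - 1, by omega⟩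
  obtain ⟨D, hD⟩ := hmin l (by omega) p
    ⟨fun i hi j hj => hp.1 i (by omega) j (by omega),
      fun i hi j hj => hp.2 i (by omega) j (by omega)⟩
  obtain ⟨D', hD'⟩ := hmin l (by omega) (fun i => p (i + 1))
    ⟨fun i hi j hj e => by have := hp.1 _ (by omega) _ (by omega) e; omega,
      fun i hi j hj => by rw [hp.2 _ (by omega) _ (by omega)]; omega⟩
  have havD : ∀ i < k, ¬ Touch G D (p i) := fun i hi => hD.avoid _ ⟨i, by omega, rfl⟩
  have havD' : ∀ i, 0 < i → i ≤ k → ¬ Touch G D' (p i) := fun i hi hik =>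
    hD'.avoid _ ⟨i - 1, by omega, by simp [Nat.sub_add_cancel hi]⟩
  have hall : ∀ {Y K : Set V}, Big G w Y K → ¬ ∀ i ≤ k, ¬ Touch G K (p i) := by
    intro Y K hK hno
    refine hpn ((hK.union_of_not_touch (X := Pre p (k + 1)) ?_).exists_of_subset
      Set.subset_union_right hw)
    rintro _ ⟨i, hi, rfl⟩
    exact hno i (by omega)
  have hDk : Touch G D (p k) := by
    by_contra hn
    refine hall hD fun i hi => ?_
    rcases hi.eq_or_lt with rfl | hi
    exacts [hn, havD i hi]
  have hD0 : Touch G D' (p 0) := by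
    by_contra hn
    refine hall hD' fun i hi => ?_
    rcases Nat.eq_zero_or_pos i with rfl | hi0
    exacts [hn, havD' i hi0 hi]
  obtain ⟨z, hzD, hzD'⟩ := hD.inter_nonempty hD' hw hw1
  obtain ⟨x, hx, hxk⟩ := hDk
  obtain ⟨y, hy, hy0⟩ := hD0
  have step : ∀ {A : Set V} {a b : V}, a ∈ A → b ∈ A → a = b ∨ G.Adj a b → Reaches G A a b := by
    rintro A a b ha hb (rfl | h)
    exacts [reaches_refl ha, reaches_adj ha hb h]
  have hreach : Reaches G ({p k, p 0} ∪ (D ∪ D')) (p k) (p 0) := by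
    have h1 : Reaches G ({p k, p 0} ∪ (D ∪ D')) x (p k) :=
      step (Or.inr (Or.inl hx)) (Or.inl (by simp)) hxk
    have h2 : Reaches G ({p k, p 0} ∪ (D ∪ D')) y (p 0) :=
      step (Or.inr (Or.inr hy)) (Or.inl (by simp)) hy0
    have h3 := (hD.linked x hx z hzD).mono
      (Set.subset_union_left.trans Set.subset_union_right : D ⊆ {p k, p 0} ∪ (D ∪ D'))
    have h4 := (hD'.linked z hzD' y hy).mono
      (Set.subset_union_right.trans Set.subset_union_right : D' ⊆ {p k, p 0} ∪ (D ∪ D'))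
    exact h1.symm.trans (h3.trans (h4.trans h2))
  obtain ⟨q, m, hq, hq0, hqm, hqA⟩ := hreach.exists_isSeq
  refine ⟨_, _, hole_of_seqs hp hq (by omega) hq0 hqm ?_, ?_⟩
  · intro i hi hik j hj hjm
    have hqj : q j ∈ D ∪ D' := by
      rcases hqA j hjm.le with (h | h) | h
      · have := hq.1 j hjm.le 0 (by omega) (h.trans hq0.symm)
        omega
      · have := hq.1 j hjm.le m le_rfl ((Set.mem_singleton_iff.1 h).trans hqm.symm)
        omega
      · exact h
    have hno : ¬ (q j = p i ∨ G.Adj (q j) (p i)) := fun hT => by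
      rcases hqj with h | h
      · exact havD i hik ⟨_, h, hT⟩
      · exact havD' i hi hik.le ⟨_, h, hT⟩
    exact ⟨fun e => hno (Or.inl e.symm), fun e => hno (Or.inr e.symm)⟩
  · rintro ⟨E, hE⟩
    refine hall hE fun i hi => hE.avoid _ ⟨i, ?_, by simp [hi]⟩
    have : m ≠ 0 := by
      rintro rfl
      have := hp.1 k le_rfl 0 (by omega) (hq0.symm.trans hqm)
      omega
    omega

lemma exists_balancedSeparator {t : ℕ} (hG : MemCt t G) (hw : ∀ v, 0 ≤ w v)
    (hw1 : ∑ v, w v = 1) :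
    ∃ Y : Finset V, Y.card ≤ 3 * (12 * t + 4) ∧ BalancedSeparator G w (ClosedNbhd G ↑Y) := by
  classical
  by_contra! hcon
  have hbig : ∀ Y : Finset V, Y.card ≤ 3 * (12 * t + 4) → ∃ D, Big G w Y D :=
    fun Y hY => exists_big_of_not_balanced (hcon Y hY)
  obtain ⟨h, n, H, hn⟩ := exists_hole_of_forall_big (by omega) hw hw1 hbig
  choose! β hβ using hbig
  obtain ⟨Y, hY, hno⟩ := H.exists_haven_not_touch hG (β := β)
    ⟨fun Y hY => (hβ Y hY).linked, fun Y hY y hy => (hβ Y hY).avoid y hy, fun Y Z hYZ hZ =>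
      (hβ Y ((Finset.card_le_card hYZ).trans hZ)).subset (hβ Z hZ) (by exact_mod_cast hYZ) hw hw1⟩
  refine hn (((hβ Y hY).union_of_not_touch (X := Pre h n) ?_).exists_of_subset
    Set.subset_union_right hw)
  rintro _ ⟨i, hi, rfl⟩
  exact hno i hi

end BigPaths

/-- for every `t` there is `c` such that every graph in `C_t` has,
for every normal weight function, a `w`-balanced separator of the form `N[Y]`, `|Y| ≤ c`. -/
theorem statement_1 :
    ∀ t : ℕ, 0 < t → ∃ c : ℕ, 0 < c ∧
      ∀ (V : Type) [Fintype V], ∀ (G : SimpleGraph V), MemCt t G →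
        ∀ w : V → ℝ, (∀ v, 0 ≤ w v) → (∑ v, w v) = 1 →
          ∃ Y : Finset V, Y.card ≤ c ∧ BalancedSeparator G w (ClosedNbhd G ↑Y) := by
  intro t _
  exact ⟨3 * (12 * t + 4), by omega, fun V _ G hG w hw hw1 => exists_balancedSeparator hG hw hw1⟩

end Paper
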